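/- Assume (F1). Let v₁ be a solution of the pressure problem with free boundaries on [t₁,t₂) whose left free boundary is l₁ ≡ −∞ and whose right free boundary r₁ is bounded continuous, and let v₃ be a solution of the pressure problem on [t₁,t₂) with bounded continuous free boundaries l₃(t) < r₃(t). If r₁(t₁) = l₃(t₁), then either r₁(t) = l₃(t) for all t ∈ [t₁,t₂), or there exist s₃, s₄, s₅ with t₁ ≤ s₃ < s₄ ≤ s₅ ≤ t₂ such that r₁(t) = l₃(t) for t ∈ [t₁, s₃], v₁(·,t) ▷ v₃(·,t) for t ∈ (s₃, s₄), v₁(·,t) ⪆ v₃(·,t) for t ∈ [s₄, s₅] ∩ [t₁,t₂), and v₁(·,t) ≻ v₃(·,t) for t ∈ (s₅, t₂). -/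

import Mathlib

open MeasureTheory Set Filter

noncomputable section

/-- Condition (F1): `f` and `κ` are `C²`, 1-periodic in `x`, `f(x,0)=0`, and there is `θ > 0`
with `f(x,u) > 0` for `u > θ` and `κ(x) > θ`. -/
def CondF1 (f : ℝ → ℝ → ℝ) (κ : ℝ → ℝ) (θ : ℝ) : Prop :=
  ContDiff ℝ 2 (Function.uncurry f) ∧ ContDiff ℝ 2 κ ∧
  (∀ x u, f (x + 1) u = f x u) ∧ (∀ x, κ (x + 1) = κ x) ∧
  (∀ x, f x 0 = 0) ∧ 0 < θ ∧ (∀ x u, θ < u → 0 < f x u) ∧ (∀ x, θ < κ x)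

/-- `κ₀ := min κ` (over a period). -/
def kappaMin (κ : ℝ → ℝ) : ℝ := sInf (κ '' Icc 0 1)

/-- `κ⁰ := max κ` (over a period). -/
def kappaMax (κ : ℝ → ℝ) : ℝ := sSup (κ '' Icc 0 1)

/-- Condition (F2): existence of a compactly supported traveling subsolution profile `φ₀`
with speed `c₀`. -/
def CondF2 (m : ℝ) (f : ℝ → ℝ → ℝ) (κ : ℝ → ℝ) (c₀ l₀ : ℝ) (φ₀ : ℝ → ℝ) : Prop :=
  0 < c₀ ∧ 0 < l₀ ∧ ContDiffOn ℝ 2 φ₀ (Icc (-l₀) l₀) ∧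
  φ₀ (-l₀) = 0 ∧ φ₀ l₀ = 0 ∧ (∀ z ∈ Ioo (-l₀) l₀, 0 < φ₀ z) ∧
  c₀ < -(derivWithin φ₀ (Icc (-l₀) l₀) l₀) ∧
  ∀ (x : ℝ), ∀ z ∈ Icc (-l₀) l₀,
    0 ≤ derivWithin (derivWithin (fun w => φ₀ w ^ m) (Icc (-l₀) l₀)) (Icc (-l₀) l₀) z
        + c₀ * derivWithin φ₀ (Icc (-l₀) l₀) z
        + f x (φ₀ z) * (κ x - φ₀ z)

/-- A (bounded, continuous) very weak solution of `u_t = (u^m)_{xx} + f(x,u)(κ(x)-u)`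
on `ℝ × (0,τ)` with initial data `u₀`. -/
def VeryWeakSol (m : ℝ) (f : ℝ → ℝ → ℝ) (κ : ℝ → ℝ) (τ : ℝ)
    (u₀ : ℝ → ℝ) (u : ℝ → ℝ → ℝ) : Prop :=
  ContinuousOn (fun q : ℝ × ℝ => u q.1 q.2) (univ ×ˢ Ioc (0:ℝ) τ) ∧
  (∃ M : ℝ, ∀ x : ℝ, ∀ t ∈ Ioc (0:ℝ) τ, |u x t| ≤ M) ∧
  ∀ φ : ℝ → ℝ → ℝ, ContDiff ℝ (⊤ : ℕ∞) (Function.uncurry φ) →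
    HasCompactSupport (Function.uncurry φ) →
    ∫ x : ℝ, u x τ * φ x τ =
      (∫ x : ℝ, u₀ x * φ x 0)
      + (∫ t in Ioo (0:ℝ) τ, ∫ x : ℝ, f x (u x t) * (κ x - u x t) * φ x t)
      + (∫ t in Ioo (0:ℝ) τ, ∫ x : ℝ,
          (u x t * deriv (fun s => φ x s) t + u x t ^ m * deriv (deriv (fun y => φ y t)) x))

/-- A global very weak solution: a very weak solution on `ℝ × (0,τ)` for every `τ > 0`. -/
def GlobalVeryWeakSol (m : ℝ) (f : ℝ → ℝ → ℝ) (κ : ℝ → ℝ)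
    (u₀ : ℝ → ℝ) (u : ℝ → ℝ → ℝ) : Prop :=
  ∀ τ > (0:ℝ), VeryWeakSol m f κ τ u₀ u

/-- The density corresponding to a pressure function `v`, namely `u = ((m-1)v/m)^{1/(m-1)}`. -/
def PressureDensity (m : ℝ) (v : ℝ → ℝ → ℝ) : ℝ → ℝ → ℝ :=
  fun x t => ((m - 1) * v x t / m) ^ (1 / (m - 1))

/-- A solution of the pressure problem on `[t₁, t₂)` whose left free boundary is `-∞` and whose
right free boundary is the bounded continuous function `r`: `v(·,t) > 0` exactly on `(-∞, r(t))`,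
`v` is `C^{2,1}` where positive, the corresponding density is a very weak solution of the PME,
and `r` obeys Darcy's law. -/
def PressureSolLeftInf (m : ℝ) (f : ℝ → ℝ → ℝ) (κ : ℝ → ℝ) (t₁ t₂ : ℝ)
    (v : ℝ → ℝ → ℝ) (r : ℝ → ℝ) : Prop :=
  ContinuousOn (fun q : ℝ × ℝ => v q.1 q.2) (univ ×ˢ Ico t₁ t₂) ∧
  ContinuousOn r (Ico t₁ t₂) ∧
  (∃ M : ℝ, ∀ t ∈ Ico t₁ t₂, |r t| ≤ M) ∧
  (∀ t ∈ Ico t₁ t₂, ∀ x : ℝ, (x < r t → 0 < v x t) ∧ (r t ≤ x → v x t = 0)) ∧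
  (∀ t ∈ Ioo t₁ t₂, ∀ x < r t,
      DifferentiableAt ℝ (fun s => v x s) t ∧
      DifferentiableAt ℝ (fun y => v y t) x ∧
      DifferentiableAt ℝ (deriv (fun y => v y t)) x) ∧
  (∀ τ ∈ Ioo t₁ t₂, VeryWeakSol m f κ (τ - t₁)
      (fun x => PressureDensity m v x t₁) (fun x t => PressureDensity m v x (t + t₁))) ∧
  (∀ t ∈ Ioo t₁ t₂, DifferentiableAt ℝ r t ∧
      deriv r t = -(derivWithin (fun y => v y t) (Iic (r t)) (r t)))

/-- A solution of the pressure problem on `[t₁, t₂)` with bounded continuous free boundaries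
`l(t) < r(t)`: `v(·,t) > 0` exactly on `(l(t), r(t))`, `v` is `C^{2,1}` where positive, the
corresponding density is a very weak solution of the PME, and both boundaries obey Darcy's law. -/
def PressureSolBdd (m : ℝ) (f : ℝ → ℝ → ℝ) (κ : ℝ → ℝ) (t₁ t₂ : ℝ)
    (v : ℝ → ℝ → ℝ) (l r : ℝ → ℝ) : Prop :=
  ContinuousOn (fun q : ℝ × ℝ => v q.1 q.2) (univ ×ˢ Ico t₁ t₂) ∧
  ContinuousOn l (Ico t₁ t₂) ∧ ContinuousOn r (Ico t₁ t₂) ∧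
  (∃ M : ℝ, ∀ t ∈ Ico t₁ t₂, |l t| ≤ M ∧ |r t| ≤ M) ∧
  (∀ t ∈ Ico t₁ t₂, l t < r t) ∧
  (∀ t ∈ Ico t₁ t₂, ∀ x : ℝ,
      (l t < x → x < r t → 0 < v x t) ∧ (x ≤ l t → v x t = 0) ∧ (r t ≤ x → v x t = 0)) ∧
  (∀ t ∈ Ioo t₁ t₂, ∀ x : ℝ, l t < x → x < r t →
      DifferentiableAt ℝ (fun s => v x s) t ∧
      DifferentiableAt ℝ (fun y => v y t) x ∧
      DifferentiableAt ℝ (deriv (fun y => v y t)) x) ∧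
  (∀ τ ∈ Ioo t₁ t₂, VeryWeakSol m f κ (τ - t₁)
      (fun x => PressureDensity m v x t₁) (fun x t => PressureDensity m v x (t + t₁))) ∧
  (∀ t ∈ Ioo t₁ t₂, DifferentiableAt ℝ l t ∧ DifferentiableAt ℝ r t ∧
      deriv l t = -(derivWithin (fun y => v y t) (Ici (l t)) (l t)) ∧
      deriv r t = -(derivWithin (fun y => v y t) (Iic (r t)) (r t)))

/-- `v₁ ▷ v₃` for a profile `v₁` supported on `(-∞, r₁)` and a profile `v₃` supported on
`(l₃, r₃)`: one crossing at some `x₀ ∈ (l₃, min r₁ r₃)`. -/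
def TriRelMix (v₁ v₃ : ℝ → ℝ) (r₁ l₃ r₃ : ℝ) : Prop :=
  ∃ x₀ : ℝ, l₃ < x₀ ∧ x₀ < min r₁ r₃ ∧
    (∀ x : ℝ, l₃ ≤ x → x < x₀ → v₃ x < v₁ x) ∧
    (∀ x : ℝ, x₀ < x → x ≤ min r₁ r₃ → v₁ x < v₃ x)

/-- `v₁ ⪆ v₃` for a profile `v₁` supported on `(-∞, r₁)` and a profile `v₃` supported on
`(l₃, r₃)`: the right endpoints agree and `v₁ > v₃` on `(l₃, r₃)`. -/
def SteepGeMix (v₁ v₃ : ℝ → ℝ) (r₁ l₃ r₃ : ℝ) : Prop :=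
  l₃ < r₃ ∧ r₃ = r₁ ∧ ∀ x : ℝ, l₃ < x → x < r₃ → v₃ x < v₁ x

/-- `v₁ ≻ v₃` for a profile `v₁` supported on `(-∞, r₁)` and a profile `v₃` supported on
`(l₃, r₃)`: the support of `v₃` is strictly inside that of `v₁` and `v₁ > v₃` on `(l₃, r₃)`. -/
def SteepGtMix (v₁ v₃ : ℝ → ℝ) (r₁ l₃ r₃ : ℝ) : Prop :=
  l₃ < r₃ ∧ r₃ < r₁ ∧ ∀ x : ℝ, l₃ < x → x < r₃ → v₃ x < v₁ x

section

open scoped Topology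

/-- The second difference quotient of a grid function at the node `i + 1`. -/
def lap (h : ℝ) (φ : ℕ → ℝ) (i : ℕ) : ℝ := (φ (i + 2) - 2 * φ (i + 1) + φ i) / h ^ 2

/-- `φ` solves backwards in the time index `k` the explicit scheme for
`φ_t + A φ_xx + B φ = 0` with Dirichlet conditions at the nodes `0` and `n + 1`. The entries
`A k i`, `B k i` are the coefficients at the node `i + 1`. -/
structure DualScheme (n K : ℕ) (h δ : ℝ) (A B : ℕ → ℕ → ℝ) (φ : ℕ → ℕ → ℝ) : Prop where
  left : ∀ k ≤ K, φ k 0 = 0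
  right : ∀ k ≤ K, φ k (n + 1) = 0
  step : ∀ k < K, ∀ i < n, φ k (i + 1) = φ (k + 1) (i + 1) +
    δ * (A k i * lap h (φ (k + 1)) i + B k i * φ (k + 1) (i + 1))

/-- Bounds on the coefficients of the scheme together with the stability condition. -/
structure SchemeBounds (n K : ℕ) (h δ : ℝ) (A B : ℕ → ℕ → ℝ) (ν Λ L : ℝ) : Prop where
  h_pos : 0 < h
  δ_pos : 0 < δ
  ν_pos : 0 < ν
  ν_le : ∀ k < K, ∀ i < n, ν ≤ A k i
  le_Λ : ∀ k < K, ∀ i < n, A k i ≤ Λ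
  B_le : ∀ k < K, ∀ i < n, |B k i| ≤ L
  Λ_pos : 0 < Λ
  L_nonneg : 0 ≤ L
  cfl : 16 * (δ * Λ) ≤ h ^ 2
  cfl' : 4 * (δ * L) ≤ 1

theorem DualScheme.restrict {n K : ℕ} {h δ : ℝ} {A B φ : ℕ → ℕ → ℝ}
    (H : DualScheme n K h δ A B φ) {K' : ℕ} (hK : K' ≤ K) : DualScheme n K' h δ A B φ :=
  ⟨fun k hk => H.left k (hk.trans hK), fun k hk => H.right k (hk.trans hK),
    fun k hk => H.step k (hk.trans_le hK)⟩

theorem SchemeBounds.restrict {n K : ℕ} {h δ : ℝ} {A B : ℕ → ℕ → ℝ} {ν Λ L : ℝ}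
    (S : SchemeBounds n K h δ A B ν Λ L) {K' : ℕ} (hK : K' ≤ K) :
    SchemeBounds n K' h δ A B ν Λ L :=
  { S with
    ν_le := fun k hk => S.ν_le k (hk.trans_le hK)
    le_Λ := fun k hk => S.le_Λ k (hk.trans_le hK)
    B_le := fun k hk => S.B_le k (hk.trans_le hK) }

theorem DualScheme.combine {n K : ℕ} {h δ : ℝ} {A B φ ψ : ℕ → ℕ → ℝ}
    (H : DualScheme n K h δ A B φ) (H' : DualScheme n K h δ A B ψ) (a b : ℝ) :
    DualScheme n K h δ A B (fun k i => a * φ k i + b * ψ k i) := by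
  refine ⟨fun k hk => by simp [H.left k hk, H'.left k hk],
    fun k hk => by simp [H.right k hk, H'.right k hk], fun k hk i hi => ?_⟩
  simp only [H.step k hk i hi, H'.step k hk i hi, lap]
  ring

theorem downward_induction {P : ℕ → Prop} {K : ℕ} (hK : P K) (hs : ∀ k < K, P (k + 1) → P k) :
    ∀ k ≤ K, P k := by
  have key : ∀ j k, k + j = K → P k := by
    intro j
    induction j with
    | zero => rintro k rfl; exact hK
    | succ j ih => exact fun k hk => hs k (by omega) (ih (k + 1) (by omega))
  exact fun k hk => key (K - k) k (by omega)

/-- The auxiliary recursion for `dualSol`, counted from the terminal time. -/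
def dualAux (n K : ℕ) (h δ : ℝ) (A B : ℕ → ℕ → ℝ) (g : ℕ → ℝ) : ℕ → ℕ → ℝ
  | 0, i => g i
  | j + 1, 0 => 0 * (j : ℝ)
  | j + 1, i + 1 => if i < n then
      dualAux n K h δ A B g j (i + 1) + δ * (A (K - 1 - j) i * lap h (dualAux n K h δ A B g j) i
        + B (K - 1 - j) i * dualAux n K h δ A B g j (i + 1)) else 0

/-- The solution of the dual scheme with terminal values `g`. -/
def dualSol (n K : ℕ) (h δ : ℝ) (A B : ℕ → ℕ → ℝ) (g : ℕ → ℝ) (k i : ℕ) : ℝ :=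
  dualAux n K h δ A B g (K - k) i

theorem dualSol_last (n K : ℕ) (h δ : ℝ) (A B : ℕ → ℕ → ℝ) (g : ℕ → ℝ) (i : ℕ) :
    dualSol n K h δ A B g K i = g i := by
  simp [dualSol, dualAux]

theorem dualSol_scheme (n K : ℕ) (h δ : ℝ) (A B : ℕ → ℕ → ℝ) (g : ℕ → ℝ) (h0 : g 0 = 0)
    (h1 : g (n + 1) = 0) : DualScheme n K h δ A B (dualSol n K h δ A B g) := by
  refine ⟨fun k _ => ?_, fun k _ => ?_, fun k hk i hi => ?_⟩
  · unfold dualSol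
    cases K - k <;> simp [dualAux, h0]
  · unfold dualSol
    cases K - k <;> simp [dualAux, h1]
  · unfold dualSol
    obtain ⟨j, hj⟩ : ∃ j, K - k = j + 1 := ⟨K - k - 1, by omega⟩
    have e1 : K - (k + 1) = j := by omega
    have e2 : K - 1 - j = k := by omega
    rw [hj, e1]
    conv_lhs => rw [dualAux]
    rw [if_pos hi, e2]

/-- One step of the scheme as a combination with nonnegative weights. -/
theorem DualScheme.step' {n K : ℕ} {h δ : ℝ} {A B φ : ℕ → ℕ → ℝ}
    (H : DualScheme n K h δ A B φ) {k i : ℕ} (hk : k < K) (hi : i < n) :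
    φ k (i + 1) = (1 - 2 * (δ * A k i / h ^ 2) + δ * B k i) * φ (k + 1) (i + 1)
      + (δ * A k i / h ^ 2) * (φ (k + 1) (i + 2) + φ (k + 1) i) := by
  rw [H.step k hk i hi, lap]
  ring

theorem SchemeBounds.off {n K : ℕ} {h δ : ℝ} {A B : ℕ → ℕ → ℝ} {ν Λ L : ℝ}
    (S : SchemeBounds n K h δ A B ν Λ L) {k i : ℕ} (hk : k < K) (hi : i < n) :
    0 < δ * A k i / h ^ 2 ∧ δ * A k i / h ^ 2 ≤ 1 / 16 := by
  have hA : 0 < A k i := S.ν_pos.trans_le (S.ν_le k hk i hi)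
  have hh := S.h_pos
  have hδ := S.δ_pos
  refine ⟨by positivity, ?_⟩
  rw [div_le_iff₀ (by positivity)]
  have := mul_le_mul_of_nonneg_left (S.le_Λ k hk i hi) hδ.le
  linarith [S.cfl]

theorem SchemeBounds.reac {n K : ℕ} {h δ : ℝ} {A B : ℕ → ℕ → ℝ} {ν Λ L : ℝ}
    (S : SchemeBounds n K h δ A B ν Λ L) {k i : ℕ} (hk : k < K) (hi : i < n) :
    |δ * B k i| ≤ δ * L ∧ |δ * B k i| ≤ 1 / 4 := by
  have hδ := S.δ_pos
  have : |δ * B k i| ≤ δ * L := by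
    rw [abs_mul, abs_of_pos hδ]
    exact mul_le_mul_of_nonneg_left (S.B_le k hk i hi) hδ.le
  exact ⟨this, by linarith [S.cfl']⟩

theorem DualScheme.nonneg {n K : ℕ} {h δ : ℝ} {A B φ : ℕ → ℕ → ℝ} {ν Λ L : ℝ}
    (H : DualScheme n K h δ A B φ) (S : SchemeBounds n K h δ A B ν Λ L)
    (hT : ∀ i ≤ n + 1, 0 ≤ φ K i) : ∀ k ≤ K, ∀ i ≤ n + 1, 0 ≤ φ k i := by
  refine downward_induction hT fun k hk ih i hi => ?_
  rcases i with _ | i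
  · rw [H.left k hk.le]
  rcases Nat.lt_or_ge i n with hin | hin
  · rw [H.step' hk hin]
    obtain ⟨h1, h2⟩ := S.off hk hin
    have h3 := abs_le.1 (S.reac hk hin).2
    have := ih (i + 1) (by omega)
    have := ih (i + 2) (by omega)
    have := ih i (by omega)
    have : 0 ≤ 1 - 2 * (δ * A k i / h ^ 2) + δ * B k i := by linarith
    positivity
  · obtain rfl : i = n := by omega
    rw [H.right k hk.le]

/-- Growth bound for a perturbed scheme. -/
theorem scheme_growth {n K : ℕ} {h δ : ℝ} {A B e f : ℕ → ℕ → ℝ} {ν Λ L C : ℝ}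
    (S : SchemeBounds n K h δ A B ν Λ L) (hC : 0 ≤ C)
    (h0 : ∀ k ≤ K, |e k 0| ≤ 0) (h1 : ∀ k ≤ K, |e k (n + 1)| ≤ 0)
    (hf : ∀ k < K, ∀ i < n, |f k i| ≤ C)
    (hs : ∀ k < K, ∀ i < n, e k (i + 1) = e (k + 1) (i + 1) +
      δ * (A k i * lap h (e (k + 1)) i + B k i * e (k + 1) (i + 1)) + δ * f k i)
    {Φ : ℝ} (hΦ : 0 ≤ Φ) (hT : ∀ i ≤ n + 1, |e K i| ≤ Φ) :
    ∀ k ≤ K, ∀ i ≤ n + 1, |e k i| ≤ (1 + δ * L) ^ (K - k) * (Φ + C * (δ * (K - k : ℕ))) := by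
  have hδ := S.δ_pos
  have hL := S.L_nonneg
  refine downward_induction (by simpa using hT) fun k hk ih i hi => ?_
  have hb : 1 ≤ 1 + δ * L := by nlinarith
  have hpos : 0 ≤ (1 + δ * L) ^ (K - k) * (Φ + C * (δ * (K - k : ℕ))) := by positivity
  rcases i with _ | i
  · exact (h0 k hk.le).trans hpos
  rcases Nat.lt_or_ge i n with hin | hin
  · obtain ⟨j, hj⟩ : ∃ j, K - k = j + 1 := ⟨K - k - 1, by omega⟩
    have e1 : K - (k + 1) = j := by omega
    rw [e1] at ih
    rw [hj]
    set D := (1 + δ * L) ^ j * (Φ + C * (δ * (j : ℕ))) with hD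
    obtain ⟨o1, o2⟩ := S.off hk hin
    have r1 := abs_le.1 (S.reac hk hin).1
    have r2 := abs_le.1 (S.reac hk hin).2
    have i1 := abs_le.1 (ih (i + 1) (by omega))
    have i2 := abs_le.1 (ih (i + 2) (by omega))
    have i3 := abs_le.1 (ih i (by omega))
    have ff := abs_le.1 (hf k hk i hin)
    have hD0 : 0 ≤ D := by positivity
    set a := δ * A k i / h ^ 2
    set b := δ * B k i
    have es : e k (i + 1) = (1 - 2 * a + b) * e (k + 1) (i + 1)
        + a * (e (k + 1) (i + 2) + e (k + 1) i) + δ * f k i := by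
      rw [hs k hk i hin, lap]; ring
    have key : |e k (i + 1)| ≤ (1 + δ * L) * D + δ * C := by
      rw [es, abs_le]
      have c0 : 0 ≤ 1 - 2 * a + b := by linarith
      constructor
      · nlinarith [mul_le_mul_of_nonneg_left i1.1 c0, mul_le_mul_of_nonneg_left i2.1 o1.le,
          mul_le_mul_of_nonneg_left i3.1 o1.le, mul_le_mul_of_nonneg_left ff.1 hδ.le,
          mul_le_mul_of_nonneg_right r1.2 hD0]
      · nlinarith [mul_le_mul_of_nonneg_left i1.2 c0, mul_le_mul_of_nonneg_left i2.2 o1.le,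
          mul_le_mul_of_nonneg_left i3.2 o1.le, mul_le_mul_of_nonneg_left ff.2 hδ.le,
          mul_le_mul_of_nonneg_right r1.2 hD0]
    refine key.trans ?_
    have hpw : 1 ≤ (1 + δ * L) ^ (j + 1) := one_le_pow₀ hb
    have : (1 + δ * L) ^ (j + 1) * (Φ + C * (δ * ((j + 1 : ℕ) : ℝ)))
        = (1 + δ * L) * D + (1 + δ * L) ^ (j + 1) * (δ * C) := by
      rw [hD]; push_cast; ring
    rw [this]
    have : 0 ≤ δ * C := by positivity
    nlinarith
  · obtain rfl : i = n := by omega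
    exact (h1 k hk.le).trans hpos

theorem pow_le_exp_of_le {x a : ℝ} (hx : 0 ≤ x) {j : ℕ} (hj : (j : ℝ) * x ≤ a) :
    (1 + x) ^ j ≤ Real.exp a := by
  calc (1 + x) ^ j ≤ (Real.exp x) ^ j := by
        gcongr; linarith [Real.add_one_le_exp x]
    _ = Real.exp (j * x) := by rw [← Real.exp_nat_mul]
    _ ≤ _ := Real.exp_le_exp.2 hj

theorem DualScheme.bound {n K : ℕ} {h δ : ℝ} {A B φ : ℕ → ℕ → ℝ} {ν Λ L : ℝ}
    (H : DualScheme n K h δ A B φ) (S : SchemeBounds n K h δ A B ν Λ L) {Φ : ℝ} (hΦ : 0 ≤ Φ)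
    (hT : ∀ i ≤ n + 1, |φ K i| ≤ Φ) :
    ∀ k ≤ K, ∀ i ≤ n + 1, |φ k i| ≤ Real.exp (K * δ * L) * Φ := by
  intro k hk i hi
  have := scheme_growth (e := φ) (f := fun _ _ => 0) S le_rfl
    (fun k hk => by simp [H.left k hk]) (fun k hk => by simp [H.right k hk]) (by simp)
    (fun k hk i hi => by simpa using H.step k hk i hi) hΦ hT k hk i hi
  refine this.trans ?_
  simp only [zero_mul, add_zero]
  refine mul_le_mul_of_nonneg_right (pow_le_exp_of_le
    (mul_nonneg S.δ_pos.le S.L_nonneg) ?_) hΦ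
  have : ((K - k : ℕ) : ℝ) ≤ K := by exact_mod_cast Nat.sub_le K k
  have h2 := mul_nonneg S.δ_pos.le S.L_nonneg
  nlinarith

/-- Over a short time the dual solution stays close to its terminal values. -/
theorem DualScheme.close {n K : ℕ} {h δ : ℝ} {A B φ : ℕ → ℕ → ℝ} {ν Λ L C : ℝ}
    (H : DualScheme n K h δ A B φ) (S : SchemeBounds n K h δ A B ν Λ L) {Φ : ℝ} (hC : 0 ≤ C)
    (hΦ : 0 ≤ Φ) (hT : ∀ i ≤ n + 1, |φ K i| ≤ Φ) (hl : ∀ i < n, |lap h (φ K) i| ≤ C) :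
    ∀ k ≤ K, ∀ i ≤ n + 1, |φ k i - φ K i| ≤
      Real.exp (K * δ * L) * ((Λ * C + L * Φ) * (K * δ)) := by
  intro k hk i hi
  have hΛ := S.Λ_pos
  have hL := S.L_nonneg
  have hδ := S.δ_pos
  have := scheme_growth (e := fun k i => φ k i - φ K i) (C := Λ * C + L * Φ) (Φ := 0)
    (f := fun k i => A k i * lap h (φ K) i + B k i * φ K (i + 1)) S (by positivity)
    (fun k hk => by simp [H.left k hk, H.left K le_rfl])
    (fun k hk => by simp [H.right k hk, H.right K le_rfl]) (fun k hk i hi => ?_)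
    (fun k hk i hi => ?_) le_rfl (by simp) k hk i hi
  · refine this.trans ?_
    have h3 : ((K - k : ℕ) : ℝ) ≤ K := by exact_mod_cast Nat.sub_le K k
    have h2 := mul_nonneg hδ.le hL
    simp only [zero_add]
    refine mul_le_mul (pow_le_exp_of_le h2 (by nlinarith)) ?_ (by positivity) (by positivity)
    refine mul_le_mul_of_nonneg_left (by nlinarith) (by positivity)
  · refine (abs_add_le _ _).trans (add_le_add ?_ ?_)
    · rw [abs_mul]
      refine mul_le_mul ?_ (hl i hi) (abs_nonneg _) hΛ.le
      rw [abs_of_pos (S.ν_pos.trans_le (S.ν_le k hk i hi))]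
      exact S.le_Λ k hk i hi
    · rw [abs_mul]
      exact mul_le_mul (S.B_le k hk i hi) (hT _ (by omega)) (abs_nonneg _) hL
  · simp only [H.step k hk i hi, lap]
    ring

theorem DualScheme.pos {n K : ℕ} {h δ : ℝ} {A B φ : ℕ → ℕ → ℝ} {ν Λ L : ℝ}
    (H : DualScheme n K h δ A B φ) (S : SchemeBounds n K h δ A B ν Λ L)
    (hT : ∀ i ≤ n + 1, 0 ≤ φ K i) {i₀ : ℕ} (hi₀ : i₀ < n) (hp : 0 < φ K (i₀ + 1))
    (hK : n ≤ K) {i : ℕ} (hi : i < n) : 0 < φ 0 (i + 1) := by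
  have hn := H.nonneg S hT
  have key : ∀ j ≤ K, ∀ i < n, i ≤ i₀ + j → i₀ ≤ i + j → 0 < φ (K - j) (i + 1) := by
    intro j
    induction j with
    | zero =>
      intro _ i hi h1 h2
      obtain rfl : i = i₀ := by omega
      simpa using hp
    | succ j ih =>
      intro hj i hi h1 h2
      have hk : K - (j + 1) < K := by omega
      have e : K - (j + 1) + 1 = K - j := by omega
      rw [H.step' hk hi, e]
      obtain ⟨o1, o2⟩ := S.off hk hi
      have r2 := abs_le.1 (S.reac hk hi).2
      have n1 := hn (K - j) (by omega) (i + 1) (by omega)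
      have n2 := hn (K - j) (by omega) (i + 2) (by omega)
      have n3 := hn (K - j) (by omega) i (by omega)
      have c : 0 < 1 - 2 * (δ * A (K - (j + 1)) i / h ^ 2) + δ * B (K - (j + 1)) i := by linarith
      rcases lt_trichotomy i i₀ with hlt | rfl | hgt
      · have := ih (by omega) (i + 1) (by omega) (by omega) (by omega)
        have : 0 < φ (K - j) (i + 2) := this
        have : 0 < (δ * A (K - (j + 1)) i / h ^ 2) * (φ (K - j) (i + 2) + φ (K - j) i) := by
          positivity
        nlinarith [mul_nonneg c.le n1]
      · have := ih (by omega) i (by omega) (by omega) (by omega)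
        have : 0 ≤ (δ * A (K - (j + 1)) i / h ^ 2) * (φ (K - j) (i + 2) + φ (K - j) i) := by
          positivity
        nlinarith [mul_pos c ‹0 < φ (K - j) (i + 1)›]
      · obtain ⟨i', rfl⟩ : ∃ i', i = i' + 1 := ⟨i - 1, by omega⟩
        have := ih (by omega) i' (by omega) (by omega) (by omega)
        have : 0 < (δ * A (K - (j + 1)) (i' + 1) / h ^ 2) *
            (φ (K - j) (i' + 1 + 2) + φ (K - j) (i' + 1)) := by
          positivity
        nlinarith [mul_nonneg c.le n1]
  have := key K le_rfl i hi (by omega) (by omega)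
  simpa using this

/-- Total positivity of order two: ordered pairs stay ordered. -/
theorem DualScheme.minor {n K : ℕ} {h δ : ℝ} {A B φ ψ : ℕ → ℕ → ℝ} {ν Λ L : ℝ}
    (H : DualScheme n K h δ A B φ) (H' : DualScheme n K h δ A B ψ)
    (S : SchemeBounds n K h δ A B ν Λ L)
    (hT : ∀ i j, i ≤ j → j ≤ n + 1 → φ K j * ψ K i ≤ φ K i * ψ K j) :
    ∀ k ≤ K, ∀ i j, i ≤ j → j ≤ n + 1 → φ k j * ψ k i ≤ φ k i * ψ k j := by
  refine downward_induction hT fun k hk ih i j hij hj => ?_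
  rcases hij.eq_or_lt with rfl | hij
  · exact le_rfl
  rcases i with _ | i
  · simp [H.left k hk.le, H'.left k hk.le]
  obtain ⟨j, rfl⟩ : ∃ j', j = j' + 1 := ⟨j - 1, by omega⟩
  rcases Nat.lt_or_ge j n with hjn | hjn
  swap
  · obtain rfl : j = n := by omega
    simp [H.right k hk.le, H'.right k hk.le]
  have hin : i < n := by omega
  rw [H.step' hk hin, H.step' hk hjn, H'.step' hk hin, H'.step' hk hjn]
  obtain ⟨o1, o2⟩ := S.off hk hin
  obtain ⟨p1, p2⟩ := S.off hk hjn
  have r := abs_le.1 (S.reac hk hin).2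
  have s := abs_le.1 (S.reac hk hjn).2
  generalize δ * A k i / h ^ 2 = a at *
  generalize δ * A k j / h ^ 2 = b at *
  generalize δ * B k i = c at *
  generalize δ * B k j = d at *
  have hc : 1 / 2 ≤ 1 - 2 * a + c := by linarith
  have hd : 1 / 2 ≤ 1 - 2 * b + d := by linarith
  generalize 1 - 2 * a + c = c' at *
  generalize 1 - 2 * b + d = d' at *
  have m11 := ih (i + 1) (j + 1) (by omega) (by omega)
  have m12 := ih (i + 1) (j + 2) (by omega) (by omega)
  have m10 := ih (i + 1) j (by omega) (by omega)
  have m01 := ih i (j + 1) (by omega) (by omega)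
  have m02 := ih i (j + 2) (by omega) (by omega)
  have m00 := ih i j (by omega) (by omega)
  have m21 := ih (i + 2) (j + 1) (by omega) (by omega)
  have m22 := ih (i + 2) (j + 2) (by omega) (by omega)
  have hab : 0 < a * b := mul_pos o1 p1
  have hca : 0 < c' * b := mul_pos (by linarith) p1
  have hda : 0 < a * d' := mul_pos o1 (by linarith)
  have hcd : a * b ≤ c' * d' := by nlinarith
  by_cases hj2 : i + 2 ≤ j
  · have m20 := ih (i + 2) j hj2 (by omega)
    have hcd0 : 0 < c' * d' := by linarith
    nlinarith [mul_le_mul_of_nonneg_left m11 hcd0.le, mul_le_mul_of_nonneg_left m12 hca.le,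
      mul_le_mul_of_nonneg_left m10 hca.le, mul_le_mul_of_nonneg_left m01 hda.le,
      mul_le_mul_of_nonneg_left m21 hda.le, mul_le_mul_of_nonneg_left m00 hab.le,
      mul_le_mul_of_nonneg_left m02 hab.le, mul_le_mul_of_nonneg_left m20 hab.le,
      mul_le_mul_of_nonneg_left m22 hab.le]
  · obtain rfl : j = i + 1 := by omega
    nlinarith [mul_le_mul_of_nonneg_right hcd (sub_nonneg.2 m11),
      mul_le_mul_of_nonneg_left m12 hca.le,
      mul_le_mul_of_nonneg_left m10 hca.le, mul_le_mul_of_nonneg_left m01 hda.le,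
      mul_le_mul_of_nonneg_left m21 hda.le, mul_le_mul_of_nonneg_left m00 hab.le,
      mul_le_mul_of_nonneg_left m02 hab.le,
      mul_le_mul_of_nonneg_left m22 hab.le]

/-- The squared length of the discrete gradient. -/
def gradSq (n : ℕ) (φ : ℕ → ℝ) : ℝ := ∑ i ∈ Finset.range (n + 1), (φ (i + 1) - φ i) ^ 2

theorem sum_diff_mul_diff (p G : ℕ → ℝ) (n : ℕ) (h0 : G 0 = 0) (h1 : G (n + 1) = 0) :
    ∑ i ∈ Finset.range (n + 1), (p (i + 1) - p i) * (G (i + 1) - G i)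
      = - ∑ i ∈ Finset.range n, (p (i + 2) - 2 * p (i + 1) + p i) * G (i + 1) := by
  have key : ∀ n, ∑ i ∈ Finset.range (n + 1), (p (i + 1) - p i) * (G (i + 1) - G i)
      = (p (n + 1) - p n) * G (n + 1) - (p 1 - p 0) * G 0
        - ∑ i ∈ Finset.range n, (p (i + 2) - 2 * p (i + 1) + p i) * G (i + 1) := by
    intro n
    induction n with
    | zero => simp; ring
    | succ n ih =>
      rw [Finset.sum_range_succ, ih, Finset.sum_range_succ _ n]
      ring
  rw [key, h0, h1]; ring

theorem gradSq_le (G : ℕ → ℝ) (n : ℕ) (h0 : G 0 = 0) (h1 : G (n + 1) = 0) :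
    gradSq n G ≤ 4 * ∑ i ∈ Finset.range n, G (i + 1) ^ 2 := by
  have : gradSq n G ≤ ∑ i ∈ Finset.range (n + 1), (2 * G (i + 1) ^ 2 + 2 * G i ^ 2) :=
    Finset.sum_le_sum fun i _ => by nlinarith [sq_nonneg (G (i + 1) + G i)]
  refine this.trans ?_
  rw [Finset.sum_add_distrib, Finset.sum_range_succ, Finset.sum_range_succ' (fun i => 2 * G i ^ 2),
    h0, h1, ← Finset.mul_sum]
  linarith

theorem DualScheme.energy_step {n K : ℕ} {h δ : ℝ} {A B φ : ℕ → ℕ → ℝ} {ν Λ L : ℝ}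
    (H : DualScheme n K h δ A B φ) (S : SchemeBounds n K h δ A B ν Λ L) {k : ℕ} (hk : k < K) :
    gradSq n (φ k) + δ * h ^ 2 * ∑ i ∈ Finset.range n, ν * lap h (φ (k + 1)) i ^ 2 ≤
      gradSq n (φ (k + 1)) +
        δ * h ^ 2 * (3 * L ^ 2 / ν) * ∑ i ∈ Finset.range n, φ (k + 1) (i + 1) ^ 2 := by
  have hh := S.h_pos
  have hδ := S.δ_pos
  have hν := S.ν_pos
  set p := φ (k + 1) with hp
  set G : ℕ → ℝ := fun i => (φ k i - p i) / δ with hG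
  have hGi : ∀ i < n, G (i + 1) = A k i * lap h p i + B k i * p (i + 1) := by
    intro i hi
    simp only [hG, H.step k hk i hi, ← hp]
    field_simp; ring
  have hG0 : G 0 = 0 := by simp [hG, hp, H.left k hk.le, H.left (k + 1) hk]
  have hG1 : G (n + 1) = 0 := by simp [hG, hp, H.right k hk.le, H.right (k + 1) hk]
  have hφ : ∀ i, φ k i = p i + δ * G i := fun i => by simp only [hG]; field_simp; ring
  have e1 : gradSq n (φ k) = gradSq n p
      + 2 * δ * ∑ i ∈ Finset.range (n + 1), (p (i + 1) - p i) * (G (i + 1) - G i)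
      + δ ^ 2 * gradSq n G := by
    simp only [gradSq, Finset.mul_sum, ← Finset.sum_add_distrib]
    refine Finset.sum_congr rfl fun i _ => ?_
    rw [hφ, hφ]; ring
  rw [sum_diff_mul_diff p G n hG0 hG1] at e1
  have e2 := mul_le_mul_of_nonneg_left (gradSq_le G n hG0 hG1) (sq_nonneg δ)
  have e3 : ∑ i ∈ Finset.range n, (δ * h ^ 2 * (ν * lap h p i ^ 2)
      + δ ^ 2 * (4 * G (i + 1) ^ 2)) ≤
      ∑ i ∈ Finset.range n, (2 * δ * ((p (i + 2) - 2 * p (i + 1) + p i) * G (i + 1))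
        + δ * h ^ 2 * (3 * L ^ 2 / ν) * p (i + 1) ^ 2) := by
    refine Finset.sum_le_sum fun i hi => ?_
    have hi := Finset.mem_range.1 hi
    have el : p (i + 2) - 2 * p (i + 1) + p i = h ^ 2 * lap h p i := by
      rw [lap]; field_simp
    rw [el, hGi i hi]
    set l := lap h p i
    set q := p (i + 1)
    set a := A k i
    set b := B k i
    have ha : ν ≤ a := S.ν_le k hk i hi
    have hb : b ^ 2 ≤ L ^ 2 := sq_le_sq' (abs_le.1 (S.B_le k hk i hi)).1
      (abs_le.1 (S.B_le k hk i hi)).2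
    have haΛ : a ≤ Λ := S.le_Λ k hk i hi
    have hcfl : 16 * (δ * a) ≤ h ^ 2 := by nlinarith [S.cfl]
    have hL := mul_le_mul_of_nonneg_right hb (sq_nonneg q)
    have t1 : δ ^ 2 * (4 * (a * l + b * q) ^ 2) ≤
        δ * h ^ 2 * (a * l ^ 2 / 2) + δ * h ^ 2 * (L ^ 2 * q ^ 2 / (2 * ν)) := by
      have s1 : (a * l + b * q) ^ 2 ≤ 2 * (a * l) ^ 2 + 2 * (b * q) ^ 2 := by
        nlinarith [sq_nonneg (a * l - b * q)]
      have s2 : 8 * δ * (a * l) ^ 2 ≤ h ^ 2 * (a * l ^ 2 / 2) := by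
        have : 0 ≤ a * l ^ 2 := mul_nonneg (hν.le.trans ha) (sq_nonneg l)
        nlinarith
      have s3 : 8 * δ * (b * q) ^ 2 ≤ h ^ 2 * (L ^ 2 * q ^ 2 / (2 * ν)) := by
        have : 16 * (δ * ν) ≤ h ^ 2 := by nlinarith
        have h8 : 8 * δ ≤ h ^ 2 / (2 * ν) := by
          rw [le_div_iff₀ (by positivity)]; linarith
        calc 8 * δ * (b * q) ^ 2 ≤ 8 * δ * (L ^ 2 * q ^ 2) := by
              rw [mul_pow]; gcongr
          _ ≤ h ^ 2 / (2 * ν) * (L ^ 2 * q ^ 2) := by gcongr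
          _ = _ := by ring
      nlinarith
    have t2 : -(b * q * l) ≤ a * l ^ 2 / 4 + L ^ 2 * q ^ 2 / ν := by
      have : -(b * q * l) ≤ ν * l ^ 2 / 4 + (b * q) ^ 2 / ν := by
        have : 0 ≤ (ν * l / 2 + b * q) ^ 2 / ν := by positivity
        have e : (ν * l / 2 + b * q) ^ 2 / ν = ν * l ^ 2 / 4 + b * q * l + (b * q) ^ 2 / ν := by
          field_simp; ring
        linarith
      have h2 : (b * q) ^ 2 / ν ≤ L ^ 2 * q ^ 2 / ν := by rw [mul_pow]; gcongr
      nlinarith [sq_nonneg l]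
    have hδh : 0 < δ * h ^ 2 := by positivity
    have t3 := mul_le_mul_of_nonneg_left t2 (by positivity : 0 ≤ 2 * (δ * h ^ 2))
    have t4 : δ * h ^ 2 * (ν * l ^ 2) ≤ δ * h ^ 2 * (a * l ^ 2) := by gcongr
    have t5 : 0 ≤ δ * h ^ 2 * (L ^ 2 * q ^ 2 / ν) := by positivity
    have t6 : δ * h ^ 2 * (L ^ 2 * q ^ 2 / (2 * ν)) = δ * h ^ 2 * (L ^ 2 * q ^ 2 / ν) / 2 := by
      field_simp
    have t7 : δ * h ^ 2 * (3 * L ^ 2 / ν) * q ^ 2 = 3 * (δ * h ^ 2 * (L ^ 2 * q ^ 2 / ν)) := by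
      ring
    rw [t7]
    linarith
  simp only [Finset.sum_add_distrib, ← Finset.mul_sum] at e3 e2 ⊢
  linarith

/-- Bound for the sum of the second differences of a dual solution. -/
theorem DualScheme.sum_abs_lap {n K : ℕ} {h δ : ℝ} {A B φ : ℕ → ℕ → ℝ} {ν Λ L : ℝ}
    (H : DualScheme n K h δ A B φ) (S : SchemeBounds n K h δ A B ν Λ L) (hν1 : ν ≤ 1)
    {P ℓ : ℝ} (hP : ∀ k ≤ K, ∀ i ≤ n + 1, |φ k i| ≤ P)
    (hl : ∀ i ≤ n, |φ K (i + 1) - φ K i| ≤ ℓ * h) :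
    δ * h * ∑ k ∈ Finset.range K, ∑ i ∈ Finset.range n, |lap h (φ (k + 1)) i| ≤
      ((n + 1) * h * ℓ ^ 2 + (K * δ) * (n * h) * (3 * L ^ 2 * P ^ 2 + 1)) / ν := by
  have hh := S.h_pos
  have hδ := S.δ_pos
  have hν := S.ν_pos
  have tel : ∀ j ≤ K, gradSq n (φ 0) +
      δ * h ^ 2 * ∑ k ∈ Finset.range j, ∑ i ∈ Finset.range n, ν * lap h (φ (k + 1)) i ^ 2 ≤
      gradSq n (φ j) + j * (δ * h ^ 2 * (3 * L ^ 2 / ν) * (n * P ^ 2)) := by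
    intro j
    induction j with
    | zero => simp
    | succ j ih =>
      intro hj
      have h1 := ih (by omega)
      have h2 := H.energy_step S (k := j) (by omega)
      have h3 : ∑ i ∈ Finset.range n, φ (j + 1) (i + 1) ^ 2 ≤ n * P ^ 2 := by
        calc _ ≤ ∑ i ∈ Finset.range n, P ^ 2 := Finset.sum_le_sum fun i hi => by
              have := hP (j + 1) hj (i + 1) (by have := Finset.mem_range.1 hi; omega)
              exact sq_le_sq' (abs_le.1 this).1 (abs_le.1 this).2
          _ = _ := by simp
      have h4 := mul_le_mul_of_nonneg_left h3
        (by positivity : 0 ≤ δ * h ^ 2 * (3 * L ^ 2 / ν))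
      rw [Finset.sum_range_succ]
      push_cast
      linarith
  have e1 := tel K le_rfl
  have e0 : 0 ≤ gradSq n (φ 0) := Finset.sum_nonneg fun i _ => sq_nonneg _
  have eK : gradSq n (φ K) ≤ (n + 1) * (ℓ * h) ^ 2 := by
    calc _ ≤ ∑ i ∈ Finset.range (n + 1), (ℓ * h) ^ 2 := Finset.sum_le_sum fun i hi => by
          have := hl i (by have := Finset.mem_range.1 hi; omega)
          exact sq_le_sq' (abs_le.1 this).1 (abs_le.1 this).2
      _ = _ := by simp
  have e2 : ∑ k ∈ Finset.range K, ∑ i ∈ Finset.range n, |lap h (φ (k + 1)) i| ≤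
      ∑ k ∈ Finset.range K, ∑ i ∈ Finset.range n, (ν * lap h (φ (k + 1)) i ^ 2 + 1 / ν) := by
    refine Finset.sum_le_sum fun k _ => Finset.sum_le_sum fun i _ => ?_
    set l := lap h (φ (k + 1)) i
    rw [← sq_abs l]
    have : 0 ≤ (ν * |l| - 1 / 2) ^ 2 / ν := by positivity
    have e : (ν * |l| - 1 / 2) ^ 2 / ν = ν * |l| ^ 2 - |l| + 1 / ν / 4 := by field_simp; ring
    have : 0 < 1 / ν := by positivity
    linarith
  simp only [Finset.sum_add_distrib, Finset.sum_const, Finset.card_range, nsmul_eq_mul] at e2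
  set Q := ∑ k ∈ Finset.range K, ∑ i ∈ Finset.range n, ν * lap h (φ (k + 1)) i ^ 2
  have e3 : δ * h * Q ≤ (n + 1) * h * ℓ ^ 2 + K * (δ * h * (3 * L ^ 2 / ν) * (n * P ^ 2)) := by
    have : h * (δ * h * Q) ≤
        h * ((n + 1) * h * ℓ ^ 2 + K * (δ * h * (3 * L ^ 2 / ν) * (n * P ^ 2))) := by
      linarith
    exact le_of_mul_le_mul_left this hh
  have e4 := mul_le_mul_of_nonneg_left e2 (by positivity : 0 ≤ δ * h)
  have e5 : (n + 1) * h * ℓ ^ 2 ≤ (n + 1) * h * ℓ ^ 2 / ν := by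
    rw [le_div_iff₀ hν]
    have : 0 ≤ (n + 1) * h * ℓ ^ 2 := by positivity
    nlinarith
  calc _ ≤ _ := e4
    _ = δ * h * Q + δ * h * (K * (n * (1 / ν))) := by ring
    _ ≤ (n + 1) * h * ℓ ^ 2 / ν + K * (δ * h * (3 * L ^ 2 / ν) * (n * P ^ 2))
        + δ * h * (K * (n * (1 / ν))) := by linarith
    _ = _ := by field_simp; ring

theorem sum_lap_mul (h : ℝ) (Z φ : ℕ → ℝ) (n : ℕ) (h0 : φ 0 = 0) (h1 : φ (n + 1) = 0) :
    ∑ i ∈ Finset.range n, lap h Z i * φ (i + 1) =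
      ∑ i ∈ Finset.range n, Z (i + 1) * lap h φ i + (Z 0 * φ 1 + Z (n + 1) * φ n) / h ^ 2 := by
  have key : ∀ n, ∑ i ∈ Finset.range n, lap h Z i * φ (i + 1) =
      ∑ i ∈ Finset.range n, Z (i + 1) * lap h φ i +
      (Z 0 * φ 1 - Z 1 * φ 0 + Z (n + 1) * φ n - Z n * φ (n + 1)) / h ^ 2 := by
    intro n
    induction n with
    | zero => simp
    | succ n ih =>
      rw [Finset.sum_range_succ, ih, Finset.sum_range_succ]
      simp only [lap]
      ring
  rw [key, h0, h1]; ring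

/-- Pairing a discrete subsolution with a nonnegative dual solution. -/
theorem DualScheme.pairing {n K : ℕ} {h δ : ℝ} {A B φ W Z : ℕ → ℕ → ℝ} {ε₁ ε₂ : ℝ}
    (H : DualScheme n K h δ A B φ) (hδ : 0 < δ)
    (hφ : ∀ k ≤ K, ∀ i ≤ n + 1, 0 ≤ φ k i)
    (hW : ∀ k < K, ∀ i < n, W (k + 1) (i + 1) - W k (i + 1) ≤
      δ * (lap h (Z k) i + B k i * W k (i + 1) + ε₁))
    (hZ : ∀ k < K, ∀ i < n, |Z k (i + 1) - A k i * W k (i + 1)| ≤ ε₂) :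
    ∑ i ∈ Finset.range n, W K (i + 1) * φ K (i + 1) ≤
      ∑ i ∈ Finset.range n, W 0 (i + 1) * φ 0 (i + 1)
      + δ * ∑ k ∈ Finset.range K, (Z k 0 * φ (k + 1) 1 + Z k (n + 1) * φ (k + 1) n) / h ^ 2
      + δ * ∑ k ∈ Finset.range K, ∑ i ∈ Finset.range n,
        (ε₂ * |lap h (φ (k + 1)) i| + ε₁ * φ (k + 1) (i + 1)) := by
  have key : ∀ j ≤ K, ∑ i ∈ Finset.range n, W j (i + 1) * φ j (i + 1) ≤
      ∑ i ∈ Finset.range n, W 0 (i + 1) * φ 0 (i + 1)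
      + δ * ∑ k ∈ Finset.range j, (Z k 0 * φ (k + 1) 1 + Z k (n + 1) * φ (k + 1) n) / h ^ 2
      + δ * ∑ k ∈ Finset.range j, ∑ i ∈ Finset.range n,
        (ε₂ * |lap h (φ (k + 1)) i| + ε₁ * φ (k + 1) (i + 1)) := by
    intro j
    induction j with
    | zero => simp
    | succ k ih =>
      intro hk
      have ih := ih (by omega)
      rw [Finset.sum_range_succ _ k, Finset.sum_range_succ _ k]
      have hs := sum_lap_mul h (Z k) (φ (k + 1)) n (H.left _ hk) (H.right _ hk)
      have e : ∑ i ∈ Finset.range n, W (k + 1) (i + 1) * φ (k + 1) (i + 1) ≤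
          ∑ i ∈ Finset.range n, (W k (i + 1) * φ k (i + 1)
          + (δ * (lap h (Z k) i * φ (k + 1) (i + 1)) - δ * (Z k (i + 1) * lap h (φ (k + 1)) i))
          + δ * (ε₂ * |lap h (φ (k + 1)) i| + ε₁ * φ (k + 1) (i + 1))) := by
        refine Finset.sum_le_sum fun i hi => ?_
        have hi := Finset.mem_range.1 hi
        have hp := hφ (k + 1) hk (i + 1) (by omega)
        have h1 := mul_le_mul_of_nonneg_right (hW k hk i hi) hp
        have h2 : (Z k (i + 1) - A k i * W k (i + 1)) * lap h (φ (k + 1)) i ≤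
            ε₂ * |lap h (φ (k + 1)) i| := by
          refine (le_abs_self _).trans ?_
          rw [abs_mul]
          exact mul_le_mul_of_nonneg_right (hZ k hk i hi) (abs_nonneg _)
        have h3 := mul_le_mul_of_nonneg_left h2 hδ.le
        rw [H.step k hk i hi]
        linarith
      simp only [Finset.sum_add_distrib, Finset.sum_sub_distrib, ← Finset.mul_sum] at e hs ih ⊢
      rw [hs] at e
      linarith
  exact key K le_rfl

/-- The average of `g` around `x` against the hat function of width `h`. -/
def hatAvg (g : ℝ → ℝ) (x h : ℝ) : ℝ := ∫ s in (-1 : ℝ)..1, (1 - |s|) * g (x + h * s)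

/-- The symmetric second difference quotient. -/
def sd (g : ℝ → ℝ) (x h : ℝ) : ℝ := (g (x + h) - 2 * g x + g (x - h)) / h ^ 2

theorem integral_hat : ∫ s in (-1 : ℝ)..1, (1 - |s|) = 1 := by
  have hc : Continuous fun s : ℝ => 1 - |s| := by fun_prop
  rw [← intervalIntegral.integral_add_adjacent_intervals (b := 0) (hc.intervalIntegrable _ _)
    (hc.intervalIntegrable _ _)]
  have e1 : ∫ s in (-1 : ℝ)..0, (1 - |s|) = ∫ s in (-1 : ℝ)..0, (1 + s) := by
    refine intervalIntegral.integral_congr fun s hs => ?_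
    rw [uIcc_of_le (by norm_num)] at hs
    simp [abs_of_nonpos hs.2]
  have e2 : ∫ s in (0 : ℝ)..1, (1 - |s|) = ∫ s in (0 : ℝ)..1, (1 - s) := by
    refine intervalIntegral.integral_congr fun s hs => ?_
    rw [uIcc_of_le (by norm_num)] at hs
    simp [abs_of_nonneg hs.1]
  rw [e1, e2, intervalIntegral.integral_add (by simp) (by simp),
    intervalIntegral.integral_sub (by simp) (by simp)]
  simp [integral_id]
  norm_num

theorem hat_intervalIntegrable {g : ℝ → ℝ} (hg : Continuous g) (x h a b : ℝ) :
    IntervalIntegrable (fun s => (1 - |s|) * g (x + h * s)) volume a b :=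
  Continuous.intervalIntegrable (by fun_prop) _ _

theorem hatAvg_add {f g : ℝ → ℝ} (hf : Continuous f) (hg : Continuous g) (x h : ℝ) :
    hatAvg (fun y => f y + g y) x h = hatAvg f x h + hatAvg g x h := by
  unfold hatAvg
  rw [← intervalIntegral.integral_add (hat_intervalIntegrable hf x h _ _)
    (hat_intervalIntegrable hg x h _ _)]
  simp only [mul_add]

theorem hatAvg_sub {f g : ℝ → ℝ} (hf : Continuous f) (hg : Continuous g) (x h : ℝ) :
    hatAvg (fun y => f y - g y) x h = hatAvg f x h - hatAvg g x h := by
  unfold hatAvg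
  rw [← intervalIntegral.integral_sub (hat_intervalIntegrable hf x h _ _)
    (hat_intervalIntegrable hg x h _ _)]
  simp only [mul_sub]

theorem hatAvg_const_mul (a : ℝ) (g : ℝ → ℝ) (x h : ℝ) :
    hatAvg (fun y => a * g y) x h = a * hatAvg g x h := by
  unfold hatAvg
  rw [← intervalIntegral.integral_const_mul]
  congr 1; ext s; ring

theorem hatAvg_const (a x h : ℝ) : hatAvg (fun _ => a) x h = a := by
  unfold hatAvg
  rw [intervalIntegral.integral_mul_const, integral_hat, one_mul]

theorem hatAvg_mono {f g : ℝ → ℝ} (hf : Continuous f) (hg : Continuous g) {x h : ℝ} (hh : 0 ≤ h)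
    (hfg : ∀ y ∈ Icc (x - h) (x + h), f y ≤ g y) : hatAvg f x h ≤ hatAvg g x h := by
  unfold hatAvg
  refine intervalIntegral.integral_mono_on (by norm_num) (hat_intervalIntegrable hf x h _ _)
    (hat_intervalIntegrable hg x h _ _) fun s hs => ?_
  have : |s| ≤ 1 := abs_le.2 hs
  refine mul_le_mul_of_nonneg_left (hfg _ ⟨?_, ?_⟩) (by linarith)
  · nlinarith [hs.1]
  · nlinarith [hs.2]

theorem abs_hatAvg_sub_le {g : ℝ → ℝ} (hg : Continuous g) {x h a ε : ℝ} (hh : 0 ≤ h)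
    (H : ∀ y ∈ Icc (x - h) (x + h), |g y - a| ≤ ε) : |hatAvg g x h - a| ≤ ε := by
  have h1 : hatAvg g x h ≤ a + ε := by
    rw [← hatAvg_const (a + ε) x h]
    exact hatAvg_mono hg continuous_const hh fun y hy => by linarith [abs_le.1 (H y hy)]
  have h2 : a - ε ≤ hatAvg g x h := by
    rw [← hatAvg_const (a - ε) x h]
    exact hatAvg_mono continuous_const hg hh fun y hy => by linarith [abs_le.1 (H y hy)]
  rw [abs_le]; constructor <;> linarith

theorem continuous_hatAvg {α : Type*} [TopologicalSpace α] [FirstCountableTopology α]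
    {u : ℝ → α → ℝ} (hu : Continuous (Function.uncurry u)) (x h : ℝ) :
    Continuous fun t => hatAvg (fun y => u y t) x h := by
  unfold hatAvg
  refine intervalIntegral.continuous_parametric_intervalIntegral_of_continuous' ?_ _ _
  have : Continuous fun q : α × ℝ => u (x + h * q.2) q.1 :=
    hu.comp (by fun_prop : Continuous fun q : α × ℝ => (x + h * q.2, q.1))
  simp only [Function.uncurry_def]
  fun_prop

theorem lap_grid (g : ℝ → ℝ) (c h : ℝ) (i : ℕ) :
    lap h (fun j => g (c + j * h)) i = sd g (c + (i + 1 : ℕ) * h) h := by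
  simp only [lap, sd]
  congr 2
  · push_cast; ring_nf
  · push_cast; ring_nf

/-- Taylor's formula with integral remainder, in symmetric form. -/
theorem sd_eq_hatAvg {g g' g'' : ℝ → ℝ} (hg : ∀ x, HasDerivAt g (g' x) x)
    (hg' : ∀ x, HasDerivAt g' (g'' x) x) (hc : Continuous g'') (x : ℝ) {h : ℝ} (hh : h ≠ 0) :
    sd g x h = hatAvg g'' x h := by
  have hlin : ∀ s, HasDerivAt (fun s => x + h * s) h s := fun s => by
    simpa using ((hasDerivAt_id s).const_mul h).const_add x
  have c1 : ∀ s, HasDerivAt (fun s => g (x + h * s)) (g' (x + h * s) * h) s := fun s =>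
    (hg _).comp s (hlin s)
  have c2 : ∀ s, HasDerivAt (fun s => g' (x + h * s)) (g'' (x + h * s) * h) s := fun s =>
    (hg' _).comp s (hlin s)
  unfold hatAvg
  have hi := hat_intervalIntegrable hc x h
  rw [← intervalIntegral.integral_add_adjacent_intervals (b := 0) (hi _ _) (hi _ _)]
  have e1 : ∫ s in (-1 : ℝ)..0, (1 - |s|) * g'' (x + h * s) =
      ∫ s in (-1 : ℝ)..0, (1 + s) * g'' (x + h * s) := by
    refine intervalIntegral.integral_congr fun s hs => ?_
    rw [uIcc_of_le (by norm_num)] at hs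
    simp [abs_of_nonpos hs.2]
  have e2 : ∫ s in (0 : ℝ)..1, (1 - |s|) * g'' (x + h * s) =
      ∫ s in (0 : ℝ)..1, (1 - s) * g'' (x + h * s) := by
    refine intervalIntegral.integral_congr fun s hs => ?_
    rw [uIcc_of_le (by norm_num)] at hs
    simp [abs_of_nonneg hs.1]
  have f1 : ∀ s, HasDerivAt (fun s => (1 + s) * g' (x + h * s) / h - g (x + h * s) / h ^ 2)
      ((1 + s) * g'' (x + h * s)) s := fun s => by
    have := ((((hasDerivAt_id s).const_add 1).mul (c2 s)).div_const h).sub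
      ((c1 s).div_const (h ^ 2))
    refine this.congr_deriv ?_
    simp only [id]; field_simp; ring
  have f2 : ∀ s, HasDerivAt (fun s => (1 - s) * g' (x + h * s) / h + g (x + h * s) / h ^ 2)
      ((1 - s) * g'' (x + h * s)) s := fun s => by
    have := ((((hasDerivAt_id s).const_sub 1).mul (c2 s)).div_const h).add
      ((c1 s).div_const (h ^ 2))
    refine this.congr_deriv ?_
    simp only [id]; field_simp; ring
  rw [e1, e2, intervalIntegral.integral_eq_sub_of_hasDerivAt (fun s _ => f1 s)
    (Continuous.intervalIntegrable (by fun_prop) _ _),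
    intervalIntegral.integral_eq_sub_of_hasDerivAt (fun s _ => f2 s)
    (Continuous.intervalIntegrable (by fun_prop) _ _)]
  simp only [sd]
  rw [show x + h * -1 = x - h by ring, show x + h * 1 = x + h by ring, show x + h * 0 = x by ring]
  field_simp
  ring

/-- For `σ = 1` (resp. `σ = -1`), `u` is an averaged subsolution (resp. supersolution) of
`u_t = (u ^ m)_xx + R(x, u)` on `[c, d] × [t₀, T]`. -/
def AvgSol (σ m : ℝ) (R : ℝ → ℝ → ℝ) (u : ℝ → ℝ → ℝ) (c d t₀ T : ℝ) : Prop :=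
  ∀ x h, 0 < h → c ≤ x - h → x + h ≤ d → ∀ s ∈ Ico t₀ T, ∀ ε > 0, ∀ᶠ t in 𝓝[>] s,
    σ * (hatAvg (fun y => u y t) x h - hatAvg (fun y => u y s) x h) ≤
      (t - s) * (σ * (sd (fun y => u y s ^ m) x h + hatAvg (fun y => R y (u y s)) x h) + ε)

theorem AvgSol.mono {σ m : ℝ} {R u : ℝ → ℝ → ℝ} {c d t₀ T : ℝ} (H : AvgSol σ m R u c d t₀ T)
    {c' d' t₀' T' : ℝ} (hc : c ≤ c') (hd : d' ≤ d) (ht : t₀ ≤ t₀') (hT : T' ≤ T) :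
    AvgSol σ m R u c' d' t₀' T' := fun x h hh h1 h2 s hs =>
  H x h hh (hc.trans h1) (h2.trans hd) s ⟨ht.trans hs.1, hs.2.trans_le hT⟩

/-- A right Dini derivative bound gives a uniform increment bound. -/
theorem increment_le_of_dini {a D : ℝ → ℝ} {t₀ T : ℝ} (ha : Continuous a) (hD : Continuous D)
    (H : ∀ s ∈ Ico t₀ T, ∀ ε > 0, ∀ᶠ t in 𝓝[>] s, a t - a s ≤ (t - s) * (D s + ε))
    {ε : ℝ} (hε : 0 < ε) :
    ∃ ρ > 0, ∀ s ∈ Icc t₀ T, ∀ t ∈ Icc s T, t < s + ρ → a t - a s ≤ (t - s) * (D s + ε) := by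
  have huc := isCompact_Icc (a := t₀) (b := T) |>.uniformContinuousOn_of_continuous hD.continuousOn
  obtain ⟨ρ, hρ, hρ'⟩ := Metric.uniformContinuousOn_iff.1 huc (ε / 2) (by positivity)
  refine ⟨ρ, hρ, fun s hs t hst htρ => ?_⟩
  have key := image_le_of_liminf_slope_right_le_deriv_boundary (f := a) (a := s) (b := t)
    (B := fun r => a s + (r - s) * (D s + ε)) (B' := fun _ => D s + ε) ha.continuousOn
    (by simp) (by fun_prop) (fun x hx => ?_) (fun x hx r hr => ?_) (right_mem_Icc.2 hst.1)
  · linarith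
  · have : HasDerivAt (fun r => a s + (r - s) * (D s + ε)) (1 * (D s + ε)) x :=
      (((hasDerivAt_id x).sub_const s).mul_const _).const_add _
    rw [one_mul] at this
    exact this.hasDerivWithinAt
  · have hx0 : x ∈ Icc t₀ T := ⟨hs.1.trans hx.1, hx.2.le.trans hst.2⟩
    have hd := hρ' x hx0 s hs (by
      rw [Real.dist_eq, abs_of_nonneg (sub_nonneg.2 hx.1)]; linarith [hx.2])
    rw [Real.dist_eq] at hd
    have hd := (abs_lt.1 hd).2
    refine Eventually.frequently ?_
    filter_upwards [H x ⟨hx0.1, hx.2.trans_le hst.2⟩ (ε / 2) (by positivity),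
      self_mem_nhdsWithin] with z hz hxz
    have hxz : x < z := hxz
    rw [slope_def_field, div_lt_iff₀ (by linarith)]
    have : (z - x) * (D x + ε / 2) < (z - x) * r := mul_lt_mul_of_pos_left (by linarith)
      (by linarith)
    linarith

theorem continuous_sd {u : ℝ → ℝ → ℝ} (hu : Continuous (Function.uncurry u)) {m : ℝ} (hm : 0 ≤ m)
    (x h : ℝ) : Continuous fun t => sd (fun y => u y t ^ m) x h := by
  have : ∀ y, Continuous fun t => u y t ^ m := fun y =>
    (hu.comp (by fun_prop : Continuous fun t : ℝ => (y, t))).rpow_const fun _ => Or.inr hm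
  unfold sd
  have h1 := this (x + h)
  have h2 := this x
  have h3 := this (x - h)
  fun_prop

theorem continuous_reac {R u : ℝ → ℝ → ℝ} (hR : Continuous (Function.uncurry R))
    (hu : Continuous (Function.uncurry u)) :
    Continuous (Function.uncurry fun y t => R y (u y t)) :=
  hR.comp (by
    have : Continuous fun q : ℝ × ℝ => u q.1 q.2 := hu
    exact continuous_fst.prodMk this : Continuous fun q : ℝ × ℝ => (q.1, u q.1 q.2))

theorem AvgSol.increment {σ m : ℝ} {R u : ℝ → ℝ → ℝ} {c d t₀ T : ℝ}
    (H : AvgSol σ m R u c d t₀ T) (hm : 0 ≤ m) (hR : Continuous (Function.uncurry R))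
    (hu : Continuous (Function.uncurry u)) {x h : ℝ} (hh : 0 < h) (hc : c ≤ x - h)
    (hd : x + h ≤ d) {ε : ℝ} (hε : 0 < ε) :
    ∃ ρ > 0, ∀ s ∈ Icc t₀ T, ∀ t ∈ Icc s T, t < s + ρ →
      σ * (hatAvg (fun y => u y t) x h - hatAvg (fun y => u y s) x h) ≤
      (t - s) * (σ * (sd (fun y => u y s ^ m) x h + hatAvg (fun y => R y (u y s)) x h) + ε) := by
  have h1 := continuous_hatAvg hu x h
  have h2 := continuous_sd hu hm x h
  have h3 := continuous_hatAvg (continuous_reac hR hu) x h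
  obtain ⟨ρ, hρ, H'⟩ := increment_le_of_dini
    (a := fun t => σ * hatAvg (fun y => u y t) x h)
    (D := fun s => σ * (sd (fun y => u y s ^ m) x h + hatAvg (fun y => R y (u y s)) x h))
    (t₀ := t₀) (T := T) (by fun_prop) (by fun_prop)
    (fun s hs ε hε => by simpa only [mul_sub] using H x h hh hc hd s hs ε hε) hε
  exact ⟨ρ, hρ, fun s hs t ht htρ => by simpa only [mul_sub] using H' s hs t ht htρ⟩

/-- The regularised difference quotient of `a ↦ a ^ m`. -/
def coefA (m ν a b : ℝ) : ℝ := max ν ((a ^ m - b ^ m) / (a - b))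

/-- The difference quotient of the reaction term. -/
def coefB (R : ℝ → ℝ → ℝ) (x a b : ℝ) : ℝ := (R x a - R x b) / (a - b)

theorem coefA_comm (m ν a b : ℝ) : coefA m ν a b = coefA m ν b a := by
  unfold coefA
  rw [← neg_sub (b ^ m), ← neg_sub b a, neg_div_neg_eq]

theorem coefB_comm (R : ℝ → ℝ → ℝ) (x a b : ℝ) : coefB R x a b = coefB R x b a := by
  unfold coefB
  rw [← neg_sub (R x b), ← neg_sub b a, neg_div_neg_eq]

theorem sub_rpow_le {m a b : ℝ} (hm : 1 ≤ m) (hb : 0 ≤ b) (hab : b ≤ a) :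
    (a - b) ^ m ≤ a ^ m - b ^ m := by
  have := Real.add_rpow_le_rpow_add (sub_nonneg.2 hab) hb hm
  rw [sub_add_cancel] at this
  linarith

theorem abs_rpow_sub_rpow_le {m M a b : ℝ} (hm : 1 ≤ m) (ha : a ∈ Icc 0 M) (hb : b ∈ Icc 0 M) :
    |a ^ m - b ^ m| ≤ m * M ^ (m - 1) * |a - b| := by
  refine Convex.norm_image_sub_le_of_norm_hasDerivWithin_le (s := Icc 0 M)
    (fun x _ => (Real.hasDerivAt_rpow_const (Or.inr hm)).hasDerivWithinAt) (fun x hx => ?_)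
    (convex_Icc 0 M) hb ha
  have h0 := Real.rpow_nonneg hx.1 (m - 1)
  rw [Real.norm_eq_abs, abs_of_nonneg (by positivity)]
  exact mul_le_mul_of_nonneg_left (Real.rpow_le_rpow hx.1 hx.2 (by linarith)) (by linarith)

theorem coefA_le {m M ν a b : ℝ} (hm : 1 ≤ m) (hν1 : ν ≤ 1) (ha : a ∈ Icc 0 M)
    (hb : b ∈ Icc 0 M) : coefA m ν a b ≤ m * M ^ (m - 1) + 1 := by
  have hM : 0 ≤ M := ha.1.trans ha.2
  have h0 : 0 ≤ m * M ^ (m - 1) := by positivity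
  refine max_le (by linarith) ?_
  have h1 : |(a ^ m - b ^ m) / (a - b)| ≤ m * M ^ (m - 1) := by
    rw [abs_div]
    exact div_le_of_le_mul₀ (abs_nonneg _) h0 (abs_rpow_sub_rpow_le hm ha hb)
  linarith [le_abs_self ((a ^ m - b ^ m) / (a - b))]

theorem abs_sub_coefA_mul_le {m ν a b : ℝ} (hm : 1 < m) (hν : 0 < ν) (ha : 0 ≤ a)
    (hb : 0 ≤ b) : |a ^ m - b ^ m - coefA m ν a b * (a - b)| ≤ ν * ν ^ (1 / (m - 1)) := by
  wlog hab : b ≤ a generalizing a b with H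
  · have := H hb ha (le_of_not_ge hab)
    rw [coefA_comm, ← abs_neg] at this
    convert this using 2
    ring
  rcases hab.eq_or_lt with rfl | hab
  · simp; positivity
  have hw : 0 < a - b := sub_pos.2 hab
  have hle := sub_rpow_le hm.le hb hab.le
  have hq : (a - b) ^ (m - 1) ≤ (a ^ m - b ^ m) / (a - b) := by
    rw [le_div_iff₀ hw]
    calc _ = (a - b) ^ m := by rw [Real.rpow_sub_one hw.ne']; field_simp
      _ ≤ _ := hle
  unfold coefA
  rcases le_total ν ((a ^ m - b ^ m) / (a - b)) with hc | hc
  · rw [max_eq_right hc, div_mul_cancel₀ _ hw.ne']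
    simp; positivity
  · rw [max_eq_left hc]
    have hwν : a - b ≤ ν ^ (1 / (m - 1)) := by
      have h1 : (a - b) ^ (m - 1) ≤ ν := hq.trans hc
      have := Real.rpow_le_rpow (by positivity) h1 (by
        have : 0 < m - 1 := by linarith
        positivity : 0 ≤ 1 / (m - 1))
      rwa [← Real.rpow_mul hw.le, mul_one_div_cancel (by linarith), Real.rpow_one] at this
    have h2 : 0 ≤ a ^ m - b ^ m := le_trans (by positivity) hle
    have h3 : a ^ m - b ^ m ≤ ν * (a - b) := by rwa [div_le_iff₀ hw] at hc
    rw [abs_sub_comm, abs_of_nonneg (by linarith)]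
    nlinarith

/-- The grid points `c = x₀ < ⋯ < x_{n+1} = d`. -/
def gX (c d : ℝ) (n : ℕ) (i : ℕ) : ℝ := c + i * ((d - c) / (n + 1))

/-- The time levels `t₀ = τ₀ < ⋯ < τ_K = T`. -/
def gT (t₀ T : ℝ) (K : ℕ) (k : ℕ) : ℝ := t₀ + k * ((T - t₀) / K)

theorem gX_zero (c d : ℝ) (n : ℕ) : gX c d n 0 = c := by simp [gX]

theorem gX_last (c d : ℝ) (n : ℕ) : gX c d n (n + 1) = d := by
  have : (n : ℝ) + 1 ≠ 0 := by positivity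
  simp only [gX]; push_cast; field_simp; ring

theorem gX_mono {c d : ℝ} (hcd : c ≤ d) (n : ℕ) : Monotone (gX c d n) := by
  intro i j hij
  have : (0 : ℝ) ≤ (d - c) / (n + 1) := div_nonneg (by linarith) (by positivity)
  have h2 : (i : ℝ) ≤ j := by exact_mod_cast hij
  simp only [gX]
  nlinarith

theorem gX_mem {c d : ℝ} (hcd : c ≤ d) {n i : ℕ} (hi : i ≤ n + 1) : gX c d n i ∈ Icc c d :=
  ⟨(gX_zero c d n).symm.le.trans (gX_mono hcd n (Nat.zero_le i)),
    (gX_mono hcd n hi).trans (gX_last c d n).le⟩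

theorem gX_succ (c d : ℝ) (n i : ℕ) : gX c d n (i + 1) = gX c d n i + (d - c) / (n + 1) := by
  simp only [gX]; push_cast; ring

theorem gT_last (t₀ T : ℝ) {K : ℕ} (hK : 0 < K) : gT t₀ T K K = T := by
  have : (K : ℝ) ≠ 0 := by positivity
  simp only [gT]; field_simp; ring

theorem gT_zero (t₀ T : ℝ) (K : ℕ) : gT t₀ T K 0 = t₀ := by simp [gT]

theorem gT_succ (t₀ T : ℝ) (K k : ℕ) : gT t₀ T K (k + 1) = gT t₀ T K k + (T - t₀) / K := by
  simp only [gT]; push_cast; ring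

theorem gT_mem {t₀ T : ℝ} (htT : t₀ ≤ T) {K k : ℕ} (hk : k ≤ K) :
    gT t₀ T K k ∈ Icc t₀ T := by
  have h2 : (k : ℝ) ≤ K := by exact_mod_cast hk
  rcases Nat.eq_zero_or_pos K with rfl | hK
  · obtain rfl : k = 0 := by omega
    simp [gT, htT]
  have hK : (0 : ℝ) < K := by positivity
  have h3 : 0 ≤ (T - t₀) / K := div_nonneg (by linarith) hK.le
  simp only [gT]
  refine ⟨by nlinarith [(Nat.cast_nonneg k : (0 : ℝ) ≤ k)], ?_⟩
  have : (k : ℝ) * ((T - t₀) / K) ≤ K * ((T - t₀) / K) := by gcongr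
  rw [mul_div_cancel₀ _ hK.ne'] at this
  linarith

/-- Hypotheses under which two functions are compared on `[c, d] × [t₀, T]`. -/
structure CompData (m M L : ℝ) (R u z : ℝ → ℝ → ℝ) (c d t₀ T : ℝ) : Prop where
  one_lt : 1 < m
  L_nonneg : 0 ≤ L
  c_lt : c < d
  t_lt : t₀ < T
  contR : Continuous (Function.uncurry R)
  contu : Continuous (Function.uncurry u)
  contz : Continuous (Function.uncurry z)
  u_mem : ∀ x ∈ Icc c d, ∀ t ∈ Icc t₀ T, u x t ∈ Icc 0 M
  z_mem : ∀ x ∈ Icc c d, ∀ t ∈ Icc t₀ T, z x t ∈ Icc 0 M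
  lip : ∀ x ∈ Icc c d, ∀ a ∈ Icc 0 M, ∀ b ∈ Icc 0 M, |R x a - R x b| ≤ L * |a - b|

theorem CompData.symm {m M L : ℝ} {R u z : ℝ → ℝ → ℝ} {c d t₀ T : ℝ}
    (D : CompData m M L R u z c d t₀ T) : CompData m M L R z u c d t₀ T :=
  { D with contu := D.contz, contz := D.contu, u_mem := D.z_mem, z_mem := D.u_mem }

/-- Diffusion coefficients on the grid. -/
def gridA (m : ℝ) (u z : ℝ → ℝ → ℝ) (c d t₀ T ν : ℝ) (n K k i : ℕ) : ℝ :=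
  coefA m ν (u (gX c d n (i + 1)) (gT t₀ T K k)) (z (gX c d n (i + 1)) (gT t₀ T K k))

/-- Reaction coefficients on the grid. -/
def gridB (R u z : ℝ → ℝ → ℝ) (c d t₀ T : ℝ) (n K k i : ℕ) : ℝ :=
  coefB R (gX c d n (i + 1)) (u (gX c d n (i + 1)) (gT t₀ T K k))
    (z (gX c d n (i + 1)) (gT t₀ T K k))

/-- The dual solution on the grid with terminal values sampled from `g`. -/
def gridDual (m : ℝ) (R u z : ℝ → ℝ → ℝ) (c d t₀ T ν : ℝ) (n K : ℕ) (g : ℝ → ℝ) : ℕ → ℕ → ℝ :=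
  dualSol n K ((d - c) / (n + 1)) ((T - t₀) / K) (gridA m u z c d t₀ T ν n K)
    (gridB R u z c d t₀ T n K) (fun i => g (gX c d n i))

theorem gridDual_comm (m : ℝ) (R u z : ℝ → ℝ → ℝ) (c d t₀ T ν : ℝ) (n K : ℕ) (g : ℝ → ℝ) :
    gridDual m R u z c d t₀ T ν n K g = gridDual m R z u c d t₀ T ν n K g := by
  unfold gridDual
  congr 1
  · funext k i; exact coefA_comm _ _ _ _
  · funext k i; exact coefB_comm _ _ _ _

theorem gridDual_last (m : ℝ) (R u z : ℝ → ℝ → ℝ) (c d t₀ T ν : ℝ) (n K : ℕ) (g : ℝ → ℝ)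
    (i : ℕ) : gridDual m R u z c d t₀ T ν n K g K i = g (gX c d n i) :=
  dualSol_last _ _ _ _ _ _ _ _

theorem gridDual_scheme (m : ℝ) (R u z : ℝ → ℝ → ℝ) (c d t₀ T ν : ℝ) (n K : ℕ) {g : ℝ → ℝ}
    (hc : g c = 0) (hd : g d = 0) :
    DualScheme n K ((d - c) / (n + 1)) ((T - t₀) / K) (gridA m u z c d t₀ T ν n K)
      (gridB R u z c d t₀ T n K) (gridDual m R u z c d t₀ T ν n K g) :=
  dualSol_scheme _ _ _ _ _ _ _ (by rw [gX_zero, hc]) (by rw [gX_last, hd])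

/-- `P` holds for all small regularisations, then all fine space grids, then all fine time grids. -/
def EvGrid (P : ℝ → ℕ → ℕ → Prop) : Prop :=
  ∀ᶠ ν in 𝓝[>] (0 : ℝ), ∀ᶠ n in atTop, ∀ᶠ K in atTop, P ν n K

theorem EvGrid.and {P Q : ℝ → ℕ → ℕ → Prop} (hP : EvGrid P) (hQ : EvGrid Q) :
    EvGrid fun ν n K => P ν n K ∧ Q ν n K := by
  unfold EvGrid at *
  filter_upwards [hP, hQ] with ν h1 h2
  filter_upwards [h1, h2] with n h1 h2
  filter_upwards [h1, h2] with K h1 h2 using ⟨h1, h2⟩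

theorem EvGrid.exists {P : ℝ → ℕ → ℕ → Prop} (hP : EvGrid P) : ∃ ν n K, P ν n K := by
  obtain ⟨ν, h1⟩ := Eventually.exists hP
  obtain ⟨n, h2⟩ := h1.exists
  obtain ⟨K, h3⟩ := h2.exists
  exact ⟨ν, n, K, h3⟩

theorem CompData.bounds {m M L : ℝ} {R u z : ℝ → ℝ → ℝ} {c d t₀ T : ℝ}
    (D : CompData m M L R u z c d t₀ T) {ν : ℝ} (hν : 0 < ν) (hν1 : ν ≤ 1) (n : ℕ) :
    ∀ᶠ K in atTop, n ≤ K ∧ 0 < K ∧ SchemeBounds n K ((d - c) / (n + 1)) ((T - t₀) / K)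
      (gridA m u z c d t₀ T ν n K) (gridB R u z c d t₀ T n K) ν (m * M ^ (m - 1) + 1) L := by
  have hcd := sub_pos.2 D.c_lt
  have htT := sub_pos.2 D.t_lt
  have hM : 0 ≤ M := by
    have := D.u_mem c (left_mem_Icc.2 D.c_lt.le) t₀ (left_mem_Icc.2 D.t_lt.le)
    exact this.1.trans this.2
  have hΛ : 0 < m * M ^ (m - 1) + 1 := by
    have := D.one_lt
    positivity
  have hh : 0 < (d - c) / (n + 1) := by positivity
  have t1 : Tendsto (fun K : ℕ => (T - t₀) / (K : ℝ)) atTop (𝓝 0) :=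
    tendsto_const_div_atTop_nhds_zero_nat _
  have t2 := t1.mul_const (m * M ^ (m - 1) + 1)
  have t3 := t2.const_mul 16
  have t4 := (t1.mul_const L).const_mul 4
  simp only [zero_mul, mul_zero] at t3 t4
  filter_upwards [eventually_ge_atTop n, eventually_gt_atTop 0,
    t3.eventually (eventually_le_nhds (by positivity : 0 < ((d - c) / (n + 1)) ^ 2)),
    t4.eventually (eventually_le_nhds one_pos)] with K hnK hK c1 c2
  refine ⟨hnK, hK, hh, by positivity, hν, fun k _ i _ => le_max_left _ _, fun k hk i hi => ?_,
    fun k hk i hi => ?_, hΛ, D.L_nonneg, c1, c2⟩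
  · exact coefA_le D.one_lt.le hν1
      (D.u_mem _ (gX_mem D.c_lt.le (by omega)) _ (gT_mem D.t_lt.le hk.le))
      (D.z_mem _ (gX_mem D.c_lt.le (by omega)) _ (gT_mem D.t_lt.le hk.le))
  · unfold gridB coefB
    rw [abs_div]
    exact div_le_of_le_mul₀ (abs_nonneg _) D.L_nonneg
      (D.lip _ (gX_mem D.c_lt.le (by omega)) _
        (D.u_mem _ (gX_mem D.c_lt.le (by omega)) _ (gT_mem D.t_lt.le hk.le)) _
        (D.z_mem _ (gX_mem D.c_lt.le (by omega)) _ (gT_mem D.t_lt.le hk.le)))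

theorem CompData.evGrid_bounds {m M L : ℝ} {R u z : ℝ → ℝ → ℝ} {c d t₀ T : ℝ}
    (D : CompData m M L R u z c d t₀ T) : EvGrid fun ν n K => n ≤ K ∧ 0 < K ∧
      SchemeBounds n K ((d - c) / (n + 1)) ((T - t₀) / K)
      (gridA m u z c d t₀ T ν n K) (gridB R u z c d t₀ T n K) ν (m * M ^ (m - 1) + 1) L := by
  unfold EvGrid
  filter_upwards [self_mem_nhdsWithin, mem_nhdsWithin_of_mem_nhds (Iic_mem_nhds one_pos)]
    with ν hν hν1
  exact Eventually.of_forall fun n => D.bounds hν hν1 n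

theorem evGrid_of_n {P : ℕ → Prop} (hP : ∀ᶠ n in atTop, P n) : EvGrid fun _ n _ => P n :=
  Eventually.of_forall fun _ => hP.mono fun _ h => Eventually.of_forall fun _ => h

theorem exists_modulus {F : ℝ → ℝ → ℝ} (hF : Continuous (Function.uncurry F)) (c d t₀ T : ℝ)
    {ε : ℝ} (hε : 0 < ε) : ∃ ρ > 0, ∀ x ∈ Icc c d, ∀ y ∈ Icc c d, ∀ t ∈ Icc t₀ T,
      |x - y| < ρ → |F x t - F y t| ≤ ε := by
  have hc : IsCompact (Icc c d ×ˢ Icc t₀ T) := isCompact_Icc.prod isCompact_Icc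
  obtain ⟨ρ, hρ, H⟩ := Metric.uniformContinuousOn_iff.1
    (hc.uniformContinuousOn_of_continuous hF.continuousOn) ε hε
  refine ⟨ρ, hρ, fun x hx y hy t ht hxy => ?_⟩
  have := H (x, t) ⟨hx, ht⟩ (y, t) ⟨hy, ht⟩ (by
    simpa [Prod.dist_eq, Real.dist_eq, hρ] using hxy)
  rw [Real.dist_eq] at this
  exact this.le

theorem exists_lipschitz_Icc {g : ℝ → ℝ} (hg : ContDiff ℝ 1 g) (c d : ℝ) :
    ∃ ℓ, 0 ≤ ℓ ∧ ∀ x ∈ Icc c d, ∀ y ∈ Icc c d, |g x - g y| ≤ ℓ * |x - y| := by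
  obtain ⟨ℓ, hℓ⟩ := isCompact_Icc.exists_bound_of_continuousOn (s := Icc c d)
    (hg.continuous_deriv le_rfl).continuousOn
  refine ⟨max ℓ 0, le_max_right _ _, fun x hx y hy => ?_⟩
  exact Convex.norm_image_sub_le_of_norm_deriv_le (s := Icc c d)
    (fun x _ => (hg.differentiable one_ne_zero) x)
    (fun x hx => (hℓ x hx).trans (le_max_left _ _)) (convex_Icc c d) hy hx

theorem exists_bound_Icc {g : ℝ → ℝ} (hg : Continuous g) (c d : ℝ) :
    ∃ Φ, 0 ≤ Φ ∧ ∀ x ∈ Icc c d, |g x| ≤ Φ := by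
  obtain ⟨ℓ, hℓ⟩ := isCompact_Icc.exists_bound_of_continuousOn (s := Icc c d) hg.continuousOn
  exact ⟨max ℓ 0, le_max_right _ _, fun x hx => (hℓ x hx).trans (le_max_left _ _)⟩

/-- The contribution of the lateral boundary. -/
def gridFlux (m : ℝ) (u z : ℝ → ℝ → ℝ) (c d t₀ T : ℝ) (n K : ℕ) (φ : ℕ → ℕ → ℝ) : ℝ :=
  (T - t₀) / K * ∑ k ∈ Finset.range K,
    ((u c (gT t₀ T K k) ^ m - z c (gT t₀ T K k) ^ m) * φ (k + 1) 1
      + (u d (gT t₀ T K k) ^ m - z d (gT t₀ T K k) ^ m) * φ (k + 1) n) / ((d - c) / (n + 1)) ^ 2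

theorem gridFlux_swap (m : ℝ) (u z : ℝ → ℝ → ℝ) (c d t₀ T : ℝ) (n K : ℕ) (φ : ℕ → ℕ → ℝ) :
    gridFlux m z u c d t₀ T n K φ = - gridFlux m u z c d t₀ T n K φ := by
  unfold gridFlux
  rw [← mul_neg, ← Finset.sum_neg_distrib]
  congr 1
  refine Finset.sum_congr rfl fun k _ => ?_
  ring

theorem CompData.increment {m M L : ℝ} {R u z : ℝ → ℝ → ℝ} {c d t₀ T : ℝ}
    (D : CompData m M L R u z c d t₀ T) (hu : AvgSol 1 m R u c d t₀ T)
    (hz : AvgSol (-1) m R z c d t₀ T) (n : ℕ) {ε : ℝ} (hε : 0 < ε) :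
    ∀ᶠ K : ℕ in atTop, ∀ k < K, ∀ i < n,
      (hatAvg (fun y => u y (gT t₀ T K (k + 1)) - z y (gT t₀ T K (k + 1)))
          (gX c d n (i + 1)) ((d - c) / (n + 1))
        - hatAvg (fun y => u y (gT t₀ T K k) - z y (gT t₀ T K k))
          (gX c d n (i + 1)) ((d - c) / (n + 1))) ≤
      (T - t₀) / K * (lap ((d - c) / (n + 1))
          (fun j => u (gX c d n j) (gT t₀ T K k) ^ m - z (gX c d n j) (gT t₀ T K k) ^ m) i
        + hatAvg (fun y => R y (u y (gT t₀ T K k)) - R y (z y (gT t₀ T K k)))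
          (gX c d n (i + 1)) ((d - c) / (n + 1)) + ε) := by
  have hm : 0 ≤ m := by linarith [D.one_lt]
  have hcd := sub_pos.2 D.c_lt
  have htT := sub_pos.2 D.t_lt
  set h := (d - c) / (n + 1) with hh
  have hh0 : 0 < h := by positivity
  have key : ∀ i < n, ∃ ρ > 0, ∀ s ∈ Icc t₀ T, ∀ t ∈ Icc s T, t < s + ρ →
      (hatAvg (fun y => u y t) (gX c d n (i + 1)) h - hatAvg (fun y => u y s) (gX c d n (i + 1)) h ≤
      (t - s) * ((sd (fun y => u y s ^ m) (gX c d n (i + 1)) h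
        + hatAvg (fun y => R y (u y s)) (gX c d n (i + 1)) h) + ε / 2)) ∧
      (-(hatAvg (fun y => z y t) (gX c d n (i + 1)) h
        - hatAvg (fun y => z y s) (gX c d n (i + 1)) h) ≤
      (t - s) * (-(sd (fun y => z y s ^ m) (gX c d n (i + 1)) h
        + hatAvg (fun y => R y (z y s)) (gX c d n (i + 1)) h) + ε / 2)) := by
    intro i hi
    have e1 : c ≤ gX c d n (i + 1) - h := by
      rw [gX_succ, ← hh]; linarith [(gX_mem D.c_lt.le (show i ≤ n + 1 by omega)).1]
    have e2 : gX c d n (i + 1) + h ≤ d := by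
      rw [hh, ← gX_succ]; exact (gX_mem D.c_lt.le (by omega)).2
    obtain ⟨ρ₁, h1, H1⟩ := hu.increment hm D.contR D.contu hh0 e1 e2 (half_pos hε)
    obtain ⟨ρ₂, h2, H2⟩ := hz.increment hm D.contR D.contz hh0 e1 e2 (half_pos hε)
    refine ⟨min ρ₁ ρ₂, lt_min h1 h2, fun s hs t ht hst => ⟨?_, ?_⟩⟩
    · simpa using H1 s hs t ht (hst.trans_le (by gcongr; exact min_le_left _ _))
    · simpa only [neg_one_mul] using H2 s hs t ht (hst.trans_le (by gcongr; exact min_le_right _ _))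
  have t1 : Tendsto (fun K : ℕ => (T - t₀) / (K : ℝ)) atTop (𝓝 0) :=
    tendsto_const_div_atTop_nhds_zero_nat _
  have ev : ∀ᶠ K : ℕ in atTop, ∀ i ∈ Finset.range n,
      ∀ s ∈ Icc t₀ T, ∀ t ∈ Icc s T, t = s + (T - t₀) / K →
      (hatAvg (fun y => u y t) (gX c d n (i + 1)) h - hatAvg (fun y => u y s) (gX c d n (i + 1)) h ≤
      (t - s) * ((sd (fun y => u y s ^ m) (gX c d n (i + 1)) h
        + hatAvg (fun y => R y (u y s)) (gX c d n (i + 1)) h) + ε / 2)) ∧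
      (-(hatAvg (fun y => z y t) (gX c d n (i + 1)) h
        - hatAvg (fun y => z y s) (gX c d n (i + 1)) h) ≤
      (t - s) * (-(sd (fun y => z y s ^ m) (gX c d n (i + 1)) h
        + hatAvg (fun y => R y (z y s)) (gX c d n (i + 1)) h) + ε / 2)) := by
    rw [Filter.eventually_all_finset]
    intro i hi
    obtain ⟨ρ, hρ, H⟩ := key i (Finset.mem_range.1 hi)
    filter_upwards [t1.eventually (gt_mem_nhds hρ)] with K hK s hs t ht hst
    exact H s hs t ht (by rw [hst]; gcongr)
  filter_upwards [ev] with K hK k hk i hi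
  have hs := gT_mem D.t_lt.le hk.le
  have ht := gT_mem D.t_lt.le (show k + 1 ≤ K by omega)
  have hst := gT_succ t₀ T K k
  have hKpos : (0 : ℝ) < K := by
    have : 0 < K := by omega
    positivity
  have hδ : 0 < (T - t₀) / K := by positivity
  obtain ⟨a1, a2⟩ := hK i (Finset.mem_range.2 hi) _ hs _ ⟨by rw [hst]; linarith, ht.2⟩ hst
  have cu : ∀ t, Continuous fun y => u y t := fun t =>
    D.contu.comp (by fun_prop : Continuous fun y : ℝ => (y, t))
  have cz : ∀ t, Continuous fun y => z y t := fun t =>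
    D.contz.comp (by fun_prop : Continuous fun y : ℝ => (y, t))
  have cRu : ∀ t, Continuous fun y => R y (u y t) := fun t =>
    (continuous_reac D.contR D.contu).comp (by fun_prop : Continuous fun y : ℝ => (y, t))
  have cRz : ∀ t, Continuous fun y => R y (z y t) := fun t =>
    (continuous_reac D.contR D.contz).comp (by fun_prop : Continuous fun y : ℝ => (y, t))
  rw [hatAvg_sub (cu _) (cz _), hatAvg_sub (cu _) (cz _), hatAvg_sub (cRu _) (cRz _)]
  have e : lap h (fun j => u (gX c d n j) (gT t₀ T K k) ^ m - z (gX c d n j) (gT t₀ T K k) ^ m) i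
      = sd (fun y => u y (gT t₀ T K k) ^ m) (gX c d n (i + 1)) h
        - sd (fun y => z y (gT t₀ T K k) ^ m) (gX c d n (i + 1)) h := by
    have := lap_grid (fun y => u y (gT t₀ T K k) ^ m - z y (gT t₀ T K k) ^ m) c h i
    refine this.trans ?_
    simp only [sd, gX]
    ring
  rw [e]
  have e3 : gT t₀ T K (k + 1) - gT t₀ T K k = (T - t₀) / K := by rw [hst]; ring
  rw [e3] at a1 a2
  linarith

set_option maxHeartbeats 2000000 in
theorem CompData.master {m M L : ℝ} {R u z : ℝ → ℝ → ℝ} {c d t₀ T : ℝ}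
    (D : CompData m M L R u z c d t₀ T) (hu : AvgSol 1 m R u c d t₀ T)
    (hz : AvgSol (-1) m R z c d t₀ T) {g : ℝ → ℝ} (hg : ContDiff ℝ 2 g) (hgc : g c = 0)
    (hgd : g d = 0) (hg0 : ∀ x ∈ Icc c d, 0 ≤ g x) {ε : ℝ} (hε : 0 < ε) :
    EvGrid fun ν n K => (d - c) / (n + 1) * ∑ i ∈ Finset.range n,
        (u (gX c d n (i + 1)) T - z (gX c d n (i + 1)) T) * g (gX c d n (i + 1)) ≤
      (d - c) / (n + 1) * (∑ i ∈ Finset.range n,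
        (u (gX c d n (i + 1)) t₀ - z (gX c d n (i + 1)) t₀) *
          gridDual m R u z c d t₀ T ν n K g 0 (i + 1)
        + gridFlux m u z c d t₀ T n K (gridDual m R u z c d t₀ T ν n K g)) + ε := by
  have hcd := sub_pos.2 D.c_lt
  have htT := sub_pos.2 D.t_lt
  have hm := D.one_lt
  have hL := D.L_nonneg
  obtain ⟨ℓ, hℓ0, hℓ⟩ := exists_lipschitz_Icc (hg.of_le (by norm_num)) c d
  obtain ⟨Φ, hΦ0, hΦ⟩ := exists_bound_Icc hg.continuous c d
  set P := Real.exp ((T - t₀) * L) * Φ with hP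
  have hP0 : 0 ≤ P := by positivity
  set D' := (d - c) * ℓ ^ 2 + (T - t₀) * (d - c) * (3 * L ^ 2 * P ^ 2 + 1) with hD'
  have hD'0 : 0 ≤ D' := by positivity
  have hM : 0 ≤ M := by
    have := D.u_mem c (left_mem_Icc.2 D.c_lt.le) t₀ (left_mem_Icc.2 D.t_lt.le)
    exact this.1.trans this.2
  set Λ := m * M ^ (m - 1) + 1 with hΛ
  have hΛ0 : 0 < Λ := by positivity
  set ε₁ := ε / (4 * ((T - t₀) * (d - c) * P + 1)) with hε₁
  have hε₁0 : 0 < ε₁ := by positivity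
  have hp : 0 < 1 / (m - 1) := by
    have : 0 < m - 1 := by linarith
    positivity
  have tν : Tendsto (fun ν : ℝ => ν ^ (1 / (m - 1)) * D') (𝓝[>] 0) (𝓝 0) := by
    have : Continuous fun ν : ℝ => ν ^ (1 / (m - 1)) * D' :=
      (Real.continuous_rpow_const hp.le).mul continuous_const
    have h2 := this.tendsto 0
    simp only [Real.zero_rpow hp.ne', zero_mul] at h2
    exact h2.mono_left nhdsWithin_le_nhds
  unfold EvGrid
  filter_upwards [self_mem_nhdsWithin, mem_nhdsWithin_of_mem_nhds (Iic_mem_nhds one_pos),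
    tν.eventually (eventually_le_nhds (by positivity : 0 < ε / 4))] with ν hν hν1 hνε
  have hν : 0 < ν := hν
  have hν1 : ν ≤ 1 := hν1
  set ω := min (ε / (4 * (2 * (d - c) * P + Λ * D' / ν + 1))) (ε₁ / (3 * (L + 1))) with hω
  have hω0 : 0 < ω := by positivity
  obtain ⟨ρ₁, hρ₁, H1⟩ := exists_modulus (F := fun x t => u x t - z x t)
    (D.contu.sub D.contz) c d t₀ T hω0
  obtain ⟨ρ₂, hρ₂, H2⟩ := exists_modulus (F := fun x t => R x (u x t) - R x (z x t))
    ((continuous_reac D.contR D.contu).sub (continuous_reac D.contR D.contz)) c d t₀ T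
    (by positivity : 0 < ε₁ / 3)
  have th : Tendsto (fun n : ℕ => (d - c) / ((n : ℝ) + 1)) atTop (𝓝 0) := by
    have := (tendsto_const_div_atTop_nhds_zero_nat (d - c)).comp (tendsto_add_atTop_nat 1)
    refine this.congr fun n => ?_
    simp
  filter_upwards [th.eventually (gt_mem_nhds hρ₁), th.eventually (gt_mem_nhds hρ₂)] with n hn1 hn2
  filter_upwards [D.bounds hν hν1 n, D.increment hu hz n (by positivity : 0 < ε₁ / 3)]
    with K hK hinc
  obtain ⟨hnK, hKpos, S⟩ := hK
  have hKpos' : (0 : ℝ) < K := by positivity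
  set h := (d - c) / ((n : ℝ) + 1) with hh
  have hh0 : 0 < h := by positivity
  set δ := (T - t₀) / (K : ℝ) with hδ
  have hδ0 : 0 < δ := by positivity
  have hKδ : K * δ = T - t₀ := by rw [hδ]; field_simp
  have hnh : (n + 1) * h = d - c := by rw [hh]; field_simp
  have hnh' : n * h ≤ d - c := by linarith
  set φ := gridDual m R u z c d t₀ T ν n K g with hφ
  have hφs := gridDual_scheme m R u z c d t₀ T ν n K hgc hgd
  rw [← hφ] at hφs
  have hφK : ∀ i, φ K i = g (gX c d n i) := gridDual_last m R u z c d t₀ T ν n K g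
  have hφ0 := hφs.nonneg S fun i hi => by rw [hφK]; exact hg0 _ (gX_mem D.c_lt.le hi)
  have hφP : ∀ k ≤ K, ∀ i ≤ n + 1, |φ k i| ≤ P := by
    have := hφs.bound S hΦ0 fun i hi => by rw [hφK]; exact hΦ _ (gX_mem D.c_lt.le hi)
    rwa [hKδ, ← hP] at this
  set W : ℕ → ℕ → ℝ := fun k i =>
    hatAvg (fun y => u y (gT t₀ T K k) - z y (gT t₀ T K k)) (gX c d n i) h with hW
  set Z : ℕ → ℕ → ℝ := fun k j =>
    u (gX c d n j) (gT t₀ T K k) ^ m - z (gX c d n j) (gT t₀ T K k) ^ m with hZ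
  have cw : ∀ t, Continuous fun y => u y t - z y t := fun t =>
    (D.contu.sub D.contz).comp (by fun_prop : Continuous fun y : ℝ => (y, t))
  have cRw : ∀ t, Continuous fun y => R y (u y t) - R y (z y t) := fun t =>
    ((continuous_reac D.contR D.contu).sub (continuous_reac D.contR D.contz)).comp
      (by fun_prop : Continuous fun y : ℝ => (y, t))
  have hball : ∀ i < n, ∀ y ∈ Icc (gX c d n (i + 1) - h) (gX c d n (i + 1) + h),
      y ∈ Icc c d ∧ |y - gX c d n (i + 1)| ≤ h := by
    intro i hi y hy
    refine ⟨⟨?_, ?_⟩, abs_le.2 ⟨by linarith [hy.1], by linarith [hy.2]⟩⟩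
    · have := (gX_mem D.c_lt.le (show i ≤ n + 1 by omega)).1
      have h3 := gX_succ c d n i
      rw [← hh] at h3
      linarith [hy.1]
    · have := (gX_mem D.c_lt.le (show i + 2 ≤ n + 1 by omega)).2
      have h3 := gX_succ c d n (i + 1)
      rw [← hh] at h3
      linarith [hy.2]
  have hWw : ∀ k ≤ K, ∀ i < n, |W k (i + 1) -
      (u (gX c d n (i + 1)) (gT t₀ T K k) - z (gX c d n (i + 1)) (gT t₀ T K k))| ≤ ω := by
    intro k hk i hi
    refine abs_hatAvg_sub_le (cw _) hh0.le fun y hy => ?_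
    obtain ⟨b1, b2⟩ := hball i hi y hy
    exact H1 y b1 _ (gX_mem D.c_lt.le (by omega)) _ (gT_mem D.t_lt.le hk) (b2.trans_lt hn1)
  have hmemX : ∀ i < n, gX c d n (i + 1) ∈ Icc c d := fun i hi => gX_mem D.c_lt.le (by omega)
  have hωε₁ : L * ω ≤ ε₁ / 3 := by
    have : ω ≤ ε₁ / (3 * (L + 1)) := min_le_right _ _
    calc L * ω ≤ L * (ε₁ / (3 * (L + 1))) := by gcongr
      _ ≤ (L + 1) * (ε₁ / (3 * (L + 1))) := by gcongr; linarith
      _ = _ := by field_simp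
  have pair := hφs.pairing (W := W) (Z := Z) (ε₁ := ε₁)
    (ε₂ := ν * ν ^ (1 / (m - 1)) + Λ * ω) hδ0 hφ0 (fun k hk i hi => ?_) (fun k hk i hi => ?_)
  · have sumlap := hφs.sum_abs_lap S hν1 hφP (ℓ := ℓ) (fun i hi => by
      rw [hφK, hφK]
      refine (hℓ _ (gX_mem D.c_lt.le (by omega)) _ (gX_mem D.c_lt.le (by omega))).trans ?_
      rw [gX_succ, add_sub_cancel_left, abs_of_pos (hh ▸ hh0)])
    rw [hnh, hKδ] at sumlap
    have sumlap' : δ * h * ∑ k ∈ Finset.range K, ∑ i ∈ Finset.range n, |lap h (φ (k + 1)) i| ≤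
        D' / ν := by
      refine sumlap.trans ?_
      rw [hD']
      gcongr
    have esum : ∀ k ≤ K, ∀ ψ : ℕ → ℝ, (∀ i ≤ n + 1, |ψ i| ≤ P) →
        |h * ∑ i ∈ Finset.range n, W k (i + 1) * ψ (i + 1) - h * ∑ i ∈ Finset.range n,
        (u (gX c d n (i + 1)) (gT t₀ T K k) - z (gX c d n (i + 1)) (gT t₀ T K k)) * ψ (i + 1)|
        ≤ (d - c) * P * ω := by
      intro k hk ψ hψ
      rw [← mul_sub, ← Finset.sum_sub_distrib, abs_mul, abs_of_pos hh0]
      calc h * |_| ≤ h * ∑ i ∈ Finset.range n, ω * P := by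
            gcongr
            refine (Finset.abs_sum_le_sum_abs _ _).trans (Finset.sum_le_sum fun i hi => ?_)
            have hi := Finset.mem_range.1 hi
            rw [← sub_mul, abs_mul]
            exact mul_le_mul (hWw k hk i hi) (hψ _ (by omega)) (abs_nonneg _) hω0.le
        _ = n * h * (P * ω) := by simp; ring
        _ ≤ (d - c) * (P * ω) := by gcongr
        _ = _ := by ring
    have eK := abs_le.1 (esum K le_rfl (φ K) (hφP K le_rfl))
    have e0 := abs_le.1 (esum 0 (Nat.zero_le _) (φ 0) (hφP 0 (Nat.zero_le _)))
    rw [gT_last t₀ T hKpos] at eK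
    rw [gT_zero] at e0
    have hflux : δ * ∑ k ∈ Finset.range K, (Z k 0 * φ (k + 1) 1 + Z k (n + 1) * φ (k + 1) n) / h ^ 2
        = gridFlux m u z c d t₀ T n K φ := by
      simp only [hZ, gridFlux, gX_zero, gX_last, ← hh, ← hδ]
    rw [hflux] at pair
    have hsumφ : ∑ k ∈ Finset.range K, ∑ i ∈ Finset.range n, φ (k + 1) (i + 1) ≤ K * (n * P) := by
      calc _ ≤ ∑ k ∈ Finset.range K, ∑ i ∈ Finset.range n, P := by
            refine Finset.sum_le_sum fun k hk => Finset.sum_le_sum fun i hi => ?_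
            have hk := Finset.mem_range.1 hk
            have hi := Finset.mem_range.1 hi
            exact (le_abs_self _).trans (hφP _ (by omega) _ (by omega))
        _ = _ := by simp
    have err : h * (δ * ∑ k ∈ Finset.range K, ∑ i ∈ Finset.range n,
        ((ν * ν ^ (1 / (m - 1)) + Λ * ω) * |lap h (φ (k + 1)) i| + ε₁ * φ (k + 1) (i + 1))) ≤
        (ν * ν ^ (1 / (m - 1)) + Λ * ω) * (D' / ν) + ε₁ * ((T - t₀) * (d - c) * P) := by
      simp only [Finset.sum_add_distrib, ← Finset.mul_sum]
      have a1 := mul_le_mul_of_nonneg_left sumlap'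
        (by positivity : 0 ≤ ν * ν ^ (1 / (m - 1)) + Λ * ω)
      have a2 := mul_le_mul_of_nonneg_left hsumφ (by positivity : 0 ≤ h * δ * ε₁)
      have a3 : h * δ * ε₁ * (K * (n * P)) ≤ ε₁ * ((T - t₀) * (d - c) * P) := by
        calc _ = ε₁ * ((K * δ) * (n * h) * P) := by ring
          _ ≤ _ := by rw [hKδ]; gcongr
      linarith
    have b1 : (ν * ν ^ (1 / (m - 1)) + Λ * ω) * (D' / ν) =
        ν ^ (1 / (m - 1)) * D' + (Λ * D' / ν) * ω := by
      field_simp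
    have b2 : ε₁ * ((T - t₀) * (d - c) * P) ≤ ε / 4 := by
      rw [hε₁, div_mul_eq_mul_div, div_le_iff₀ (by positivity)]
      have : 0 ≤ (T - t₀) * (d - c) * P := by positivity
      nlinarith
    have b3 : (2 * (d - c) * P + Λ * D' / ν) * ω ≤ ε / 4 := by
      have hq : 0 ≤ 2 * (d - c) * P + Λ * D' / ν := by positivity
      calc (2 * (d - c) * P + Λ * D' / ν) * ω ≤ (2 * (d - c) * P + Λ * D' / ν)
            * (ε / (4 * (2 * (d - c) * P + Λ * D' / ν + 1))) := by
            gcongr; exact min_le_left _ _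
        _ ≤ _ := by
            rw [mul_div_assoc', div_le_iff₀ (by positivity)]
            nlinarith
    have pair' := mul_le_mul_of_nonneg_left pair hh0.le
    have hfin : h * ∑ i ∈ Finset.range n,
        (u (gX c d n (i + 1)) T - z (gX c d n (i + 1)) T) * g (gX c d n (i + 1)) =
        h * ∑ i ∈ Finset.range n,
        (u (gX c d n (i + 1)) T - z (gX c d n (i + 1)) T) * φ K (i + 1) := by
      simp only [hφK]
    rw [hfin]
    linarith [eK.1, e0.2]
  · refine (hinc k hk i hi).trans ?_
    refine mul_le_mul_of_nonneg_left ?_ hδ0.le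
    set x := gX c d n (i + 1) with hx
    set t := gT t₀ T K k with ht
    have r1 : |hatAvg (fun y => R y (u y t) - R y (z y t)) x h - (R x (u x t) - R x (z x t))|
        ≤ ε₁ / 3 := by
      refine abs_hatAvg_sub_le (cRw _) hh0.le fun y hy => ?_
      obtain ⟨b1, b2⟩ := hball i hi y hy
      exact H2 y b1 _ (hmemX i hi) _ (gT_mem D.t_lt.le hk.le) (b2.trans_lt hn2)
    have r2 : R x (u x t) - R x (z x t) = gridB R u z c d t₀ T n K k i * (u x t - z x t) := by
      unfold gridB coefB
      rw [← hx, ← ht]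
      rcases eq_or_ne (u x t - z x t) 0 with h0 | h0
      · rw [sub_eq_zero.1 h0]; simp
      · rw [div_mul_cancel₀ _ h0]
    have r3 : |gridB R u z c d t₀ T n K k i * (u x t - z x t - W k (i + 1))| ≤ ε₁ / 3 := by
      rw [abs_mul, abs_sub_comm]
      exact (mul_le_mul (S.B_le k hk i hi) (hWw k hk.le i hi) (abs_nonneg _) hL).trans hωε₁
    have r3 := (abs_le.1 r3).2
    have r1 := (abs_le.1 r1).2
    rw [mul_sub] at r3
    have : lap h (Z k) i = lap h (fun j => u (gX c d n j) t ^ m - z (gX c d n j) t ^ m) i := rfl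
    linarith
  · set x := gX c d n (i + 1) with hx
    set t := gT t₀ T K k with ht
    have m1 := D.u_mem x (hmemX i hi) t (gT_mem D.t_lt.le hk.le)
    have m2 := D.z_mem x (hmemX i hi) t (gT_mem D.t_lt.le hk.le)
    have r1 := abs_sub_coefA_mul_le hm hν m1.1 m2.1
    have hA : gridA m u z c d t₀ T ν n K k i = coefA m ν (u x t) (z x t) := rfl
    have r2 : |gridA m u z c d t₀ T ν n K k i * (u x t - z x t - W k (i + 1))| ≤ Λ * ω := by
      rw [abs_mul, abs_sub_comm (u x t - z x t),
        abs_of_pos (hν.trans_le (S.ν_le k hk i hi))]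
      exact mul_le_mul (S.le_Λ k hk i hi) (hWw k hk.le i hi) (abs_nonneg _) hΛ0.le
    rw [← hA] at r1
    have e : Z k (i + 1) - gridA m u z c d t₀ T ν n K k i * W k (i + 1) =
        (u x t ^ m - z x t ^ m - gridA m u z c d t₀ T ν n K k i * (u x t - z x t))
        + gridA m u z c d t₀ T ν n K k i * (u x t - z x t - W k (i + 1)) := by
      simp only [hZ]; ring
    rw [e]
    exact (abs_add_le _ _).trans (add_le_add r1 r2)

theorem tendsto_mesh (c d : ℝ) : Tendsto (fun n : ℕ => (d - c) / ((n : ℝ) + 1)) atTop (𝓝 0) := by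
  have := (tendsto_const_div_atTop_nhds_zero_nat (d - c)).comp (tendsto_add_atTop_nat 1)
  refine this.congr fun n => ?_
  simp

/-- Riemann sums of a nonnegative continuous function that is somewhere positive are bounded
below. -/
theorem exists_riemann_lower {F : ℝ → ℝ} {c d : ℝ} (hcd : c < d) (hF : Continuous F)
    (h0 : ∀ x ∈ Icc c d, 0 ≤ F x) (hFd : F d = 0) {y : ℝ} (hy : y ∈ Icc c d) (hFy : 0 < F y) :
    ∃ η > 0, ∀ᶠ n : ℕ in atTop,
      η ≤ (d - c) / (n + 1) * ∑ i ∈ Finset.range n, F (gX c d n (i + 1)) := by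
  set I := ∫ x in c..d, F x with hI
  have hIpos : 0 < I := by
    refine intervalIntegral.integral_pos hcd hF.continuousOn (fun x hx => h0 x ⟨hx.1.le, hx.2⟩)
      ⟨y, hy, hFy⟩
  have hd0 : 0 < d - c := sub_pos.2 hcd
  refine ⟨I / 2, by positivity, ?_⟩
  obtain ⟨ρ, hρ, H⟩ := Metric.uniformContinuousOn_iff.1
    (isCompact_Icc.uniformContinuousOn_of_continuous (s := Icc c d) hF.continuousOn)
    (I / (2 * (d - c))) (by positivity)
  filter_upwards [(tendsto_mesh c d).eventually (gt_mem_nhds hρ)] with n hn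
  set h := (d - c) / ((n : ℝ) + 1) with hh
  have hh0 : 0 < h := by positivity
  have hsum : ∑ i ∈ Finset.range (n + 1), ∫ x in gX c d n i..gX c d n (i + 1), F x = I := by
    rw [intervalIntegral.sum_integral_adjacent_intervals
      (fun k _ => hF.intervalIntegrable _ _), gX_zero, gX_last]
  have hterm : ∀ i ∈ Finset.range (n + 1), ∫ x in gX c d n i..gX c d n (i + 1), F x ≤
      h * (F (gX c d n (i + 1)) + I / (2 * (d - c))) := by
    intro i hi
    have hi := Finset.mem_range.1 hi
    have e1 : ∫ x in gX c d n i..gX c d n (i + 1), (F (gX c d n (i + 1)) + I / (2 * (d - c))) =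
        h * (F (gX c d n (i + 1)) + I / (2 * (d - c))) := by
      rw [intervalIntegral.integral_const, gX_succ, smul_eq_mul]; ring
    rw [← e1]
    have hle : gX c d n i ≤ gX c d n (i + 1) := gX_mono hcd.le n (Nat.le_succ i)
    refine intervalIntegral.integral_mono_on hle (hF.intervalIntegrable _ _)
      intervalIntegrable_const fun x hx => ?_
    have m1 := gX_mem hcd.le (show i ≤ n + 1 by omega)
    have m2 := gX_mem hcd.le (show i + 1 ≤ n + 1 by omega)
    have := H x ⟨m1.1.trans hx.1, hx.2.trans m2.2⟩ _ m2 (by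
      rw [Real.dist_eq, abs_lt]
      have := gX_succ c d n i
      constructor <;> linarith [hx.1, hx.2])
    rw [Real.dist_eq] at this
    linarith [(abs_lt.1 this).2]
  have := Finset.sum_le_sum hterm
  rw [hsum, ← Finset.mul_sum, Finset.sum_add_distrib, Finset.sum_const, Finset.card_range,
    Finset.sum_range_succ, gX_last, hFd] at this
  have e2 : h * ((n + 1 : ℕ) • (I / (2 * (d - c)))) = I / 2 := by
    rw [nsmul_eq_mul, hh]; push_cast; field_simp
  rw [mul_add, e2] at this
  linarith

theorem gridDual_nonneg {m L : ℝ} {R u z : ℝ → ℝ → ℝ} {c d t₀ T : ℝ} (hcd : c ≤ d)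
    {ν Λ : ℝ} {n K : ℕ} (S : SchemeBounds n K ((d - c) / (n + 1)) ((T - t₀) / K)
      (gridA m u z c d t₀ T ν n K) (gridB R u z c d t₀ T n K) ν Λ L)
    {g : ℝ → ℝ} (hgc : g c = 0) (hgd : g d = 0) (hg0 : ∀ x ∈ Icc c d, 0 ≤ g x) :
    ∀ k ≤ K, ∀ i ≤ n + 1, 0 ≤ gridDual m R u z c d t₀ T ν n K g k i :=
  (gridDual_scheme m R u z c d t₀ T ν n K hgc hgd).nonneg S fun i hi => by
    rw [gridDual_last]; exact hg0 _ (gX_mem hcd hi)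

/-- A smooth bump at `y` supported in a prescribed open set. -/
theorem exists_bump {U : Set ℝ} (hU : IsOpen U) {y : ℝ} (hy : y ∈ U) :
    ∃ g : ℝ → ℝ, ContDiff ℝ (⊤ : ℕ∞) g ∧ (∀ x, 0 ≤ g x) ∧ (∀ x, g x ≤ 1) ∧ g y = 1 ∧
      (∀ x, x ∉ U → g x = 0) := by
  obtain ⟨r, hr, hrU⟩ := Metric.isOpen_iff.1 hU y hy
  let f : ContDiffBump y := ⟨r / 2, r, by positivity, by linarith⟩
  refine ⟨f, f.contDiff, f.nonneg', fun _ => f.le_one, f.one_of_mem_closedBall (by simp [f.rIn_pos.le]),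
    fun x hx => ?_⟩
  have : x ∉ Function.support f := by
    rw [f.support_eq]; exact fun h => hx (hrU h)
  simpa using this

theorem CompData.comparison {m M L : ℝ} {R u z : ℝ → ℝ → ℝ} {c d t₀ T : ℝ}
    (D : CompData m M L R u z c d t₀ T) (hu : AvgSol 1 m R u c d t₀ T)
    (hz : AvgSol (-1) m R z c d t₀ T) (h0 : ∀ x ∈ Icc c d, u x t₀ ≤ z x t₀)
    (hc : ∀ t ∈ Icc t₀ T, u c t ≤ z c t) (hd : ∀ t ∈ Icc t₀ T, u d t ≤ z d t) :
    ∀ x ∈ Icc c d, u x T ≤ z x T := by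
  by_contra! hcon
  obtain ⟨y, hy, hyw⟩ := hcon
  have hcd := D.c_lt
  have htT := D.t_lt
  have hm := D.one_lt
  have cont : Continuous fun x => u x T - z x T :=
    (D.contu.sub D.contz).comp (by fun_prop : Continuous fun y : ℝ => (y, T))
  have hyc : c < y := hy.1.lt_of_ne fun h => by
    have := hc T (right_mem_Icc.2 htT.le); rw [h] at this; linarith
  have hyd : y < d := hy.2.lt_of_ne fun h => by
    have := hd T (right_mem_Icc.2 htT.le); rw [← h] at this; linarith
  have hopen : IsOpen (Ioo c d ∩ {x | 0 < u x T - z x T}) :=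
    isOpen_Ioo.inter (isOpen_lt continuous_const cont)
  obtain ⟨g, hgs, hg0, -, hgy, hgout⟩ := exists_bump hopen (y := y) ⟨⟨hyc, hyd⟩, sub_pos.2 hyw⟩
  have hgc : g c = 0 := hgout _ fun h => lt_irrefl _ h.1.1
  have hgd : g d = 0 := hgout _ fun h => lt_irrefl _ h.1.2
  obtain ⟨η, hη, hsum⟩ := exists_riemann_lower (F := fun x => (u x T - z x T) * g x) hcd
    (cont.mul hgs.continuous) (fun x _ => by
      by_cases hx : x ∈ Ioo c d ∩ {x | 0 < u x T - z x T}
      · exact mul_nonneg (le_of_lt hx.2) (hg0 x)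
      · rw [hgout x hx, mul_zero]) (by rw [hgd, mul_zero]) hy (by rw [hgy]; linarith)
  obtain ⟨ν, n, K, ⟨h1, hnK, hK, S⟩, h2⟩ := (((D.master hu hz (hgs.of_le (by norm_cast))
    hgc hgd (fun x _ => hg0 x) (by positivity : 0 < η / 2)).and D.evGrid_bounds).and
    (evGrid_of_n hsum)).exists
  have hφ := gridDual_nonneg hcd.le S hgc hgd (fun x _ => hg0 x)
  have hs : ∑ i ∈ Finset.range n, (u (gX c d n (i + 1)) t₀ - z (gX c d n (i + 1)) t₀) *
      gridDual m R u z c d t₀ T ν n K g 0 (i + 1) ≤ 0 := by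
    refine Finset.sum_nonpos fun i hi => ?_
    have hi := Finset.mem_range.1 hi
    have := h0 _ (gX_mem hcd.le (show i + 1 ≤ n + 1 by omega))
    exact mul_nonpos_of_nonpos_of_nonneg (by linarith) (hφ 0 (Nat.zero_le _) _ (by omega))
  have hpow : ∀ x ∈ Icc c d, ∀ t ∈ Icc t₀ T, u x t ≤ z x t → u x t ^ m - z x t ^ m ≤ 0 :=
    fun x hx t ht h => by
      have := Real.rpow_le_rpow (D.u_mem x hx t ht).1 h (by linarith : 0 ≤ m)
      linarith
  have hf : gridFlux m u z c d t₀ T n K (gridDual m R u z c d t₀ T ν n K g) ≤ 0 := by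
    unfold gridFlux
    refine mul_nonpos_of_nonneg_of_nonpos (div_nonneg (by linarith) (Nat.cast_nonneg _))
      (Finset.sum_nonpos fun k hk => div_nonpos_of_nonpos_of_nonneg ?_ (sq_nonneg _))
    have hk := Finset.mem_range.1 hk
    have hmem := gT_mem htT.le (show k ≤ K by omega)
    have a1 := hpow c (left_mem_Icc.2 hcd.le) _ hmem (hc _ hmem)
    have a2 := hpow d (right_mem_Icc.2 hcd.le) _ hmem (hd _ hmem)
    have a3 := mul_nonpos_of_nonpos_of_nonneg a1 (hφ (k + 1) (by omega) 1 (by omega))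
    have a4 := mul_nonpos_of_nonpos_of_nonneg a2 (hφ (k + 1) (by omega) n (by omega))
    linarith
  have hmesh : 0 ≤ (d - c) / ((n : ℝ) + 1) := div_nonneg (by linarith) (by positivity)
  have := mul_nonpos_of_nonneg_of_nonpos hmesh (add_nonpos hs hf)
  linarith

/-- The sign of the cross products of two dual solutions at the first and last inner nodes. -/
theorem DualScheme.minor_lateral {n K : ℕ} {h δ : ℝ} {A B φ ψ : ℕ → ℕ → ℝ} {ν Λ L : ℝ}
    (H : DualScheme n K h δ A B φ) (H' : DualScheme n K h δ A B ψ)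
    (S : SchemeBounds n K h δ A B ν Λ L)
    (hT : ∀ i j, i ≤ j → j ≤ n + 1 → φ K j * ψ K i ≤ φ K i * ψ K j) {k j : ℕ} (hk : k ≤ K)
    (hj : j ≤ n + 1) :
    φ 0 j * ψ k 1 ≤ φ k 1 * ψ 0 j ∧ φ k n * ψ 0 j ≤ φ 0 j * ψ k n := by
  have hmin := H.minor H' S hT k hk
  have h1 := ((H.restrict hk).combine (H'.restrict hk) (-ψ k 1) (φ k 1)).nonneg (S.restrict hk)
    (fun i hi => by
      rcases i with _ | i
      · simp [H.left k hk, H'.left k hk]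
      · have := hmin 1 (i + 1) (by omega) hi
        linarith) 0 (Nat.zero_le _) j hj
  have h2 := ((H.restrict hk).combine (H'.restrict hk) (ψ k n) (-φ k n)).nonneg (S.restrict hk)
    (fun i hi => by
      rcases Nat.lt_or_ge i (n + 1) with hi' | hi'
      · have := hmin i n (by omega) (by omega)
        linarith
      · obtain rfl : i = n + 1 := by omega
        simp [H.right k hk, H'.right k hk]) 0 (Nat.zero_le _) j hj
  constructor <;> linarith

/-- Data for two exact solutions whose difference has a single crossing initially and signs
`+`, `-` on the lateral boundaries. -/
structure CrossData (m M L : ℝ) (R u z : ℝ → ℝ → ℝ) (c d t₀ T X : ℝ) : Prop extends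
    CompData m M L R u z c d t₀ T where
  sub_u : AvgSol 1 m R u c d t₀ T
  super_u : AvgSol (-1) m R u c d t₀ T
  sub_z : AvgSol 1 m R z c d t₀ T
  super_z : AvgSol (-1) m R z c d t₀ T
  left_le : ∀ t ∈ Icc t₀ T, z c t ≤ u c t
  right_le : ∀ t ∈ Icc t₀ T, u d t ≤ z d t
  init_left : ∀ x ∈ Icc c d, x ≤ X → z x t₀ ≤ u x t₀
  init_right : ∀ x ∈ Icc c d, X ≤ x → u x t₀ ≤ z x t₀

theorem CrossData.crossing {m M L : ℝ} {R u z : ℝ → ℝ → ℝ} {c d t₀ T X : ℝ}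
    (D : CrossData m M L R u z c d t₀ T X) {g₁ g₂ : ℝ → ℝ} (hg₁ : ContDiff ℝ 2 g₁)
    (hg₂ : ContDiff ℝ 2 g₂) (hc₁ : g₁ c = 0) (hc₂ : g₂ c = 0) (hd₁ : g₁ d = 0) (hd₂ : g₂ d = 0)
    (h₁ : ∀ x ∈ Icc c d, 0 ≤ g₁ x) (h₂ : ∀ x ∈ Icc c d, 0 ≤ g₂ x)
    (hord : ∀ x ∈ Icc c d, ∀ y ∈ Icc c d, x ≤ y → g₁ y * g₂ x ≤ g₁ x * g₂ y) {ε : ℝ}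
    (hε : 0 < ε) :
    EvGrid fun ν n K => ∀ j ≤ n + 1, gX c d n j ≤ X → X ≤ gX c d n (j + 1) →
      (∀ i < n, 0 ≤ (u (gX c d n (i + 1)) t₀ - z (gX c d n (i + 1)) t₀) *
        (gridDual m R u z c d t₀ T ν n K g₁ 0 (i + 1) * gridDual m R u z c d t₀ T ν n K g₂ 0 j
          - gridDual m R u z c d t₀ T ν n K g₂ 0 (i + 1) * gridDual m R u z c d t₀ T ν n K g₁ 0 j))
      ∧ (d - c) / (n + 1) * ∑ i ∈ Finset.range n,
          (u (gX c d n (i + 1)) t₀ - z (gX c d n (i + 1)) t₀) *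
        (gridDual m R u z c d t₀ T ν n K g₁ 0 (i + 1) * gridDual m R u z c d t₀ T ν n K g₂ 0 j
          - gridDual m R u z c d t₀ T ν n K g₂ 0 (i + 1) * gridDual m R u z c d t₀ T ν n K g₁ 0 j)
      ≤ ((d - c) / (n + 1) * ∑ i ∈ Finset.range n,
          (u (gX c d n (i + 1)) T - z (gX c d n (i + 1)) T) * g₁ (gX c d n (i + 1)) + ε) *
          gridDual m R u z c d t₀ T ν n K g₂ 0 j
        - ((d - c) / (n + 1) * ∑ i ∈ Finset.range n,
          (u (gX c d n (i + 1)) T - z (gX c d n (i + 1)) T) * g₂ (gX c d n (i + 1)) - ε) *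
          gridDual m R u z c d t₀ T ν n K g₁ 0 j := by
  have hcd := D.c_lt
  have htT := D.t_lt
  have hm := D.one_lt
  have m1 := D.toCompData.symm.master D.sub_z D.super_u hg₁ hc₁ hd₁ h₁ hε
  have m2 := D.toCompData.master D.sub_u D.super_z hg₂ hc₂ hd₂ h₂ hε
  have hall := (m1.and m2).and D.toCompData.evGrid_bounds
  unfold EvGrid at hall ⊢
  filter_upwards [hall] with ν h
  filter_upwards [h] with n h
  filter_upwards [h] with K h j hj hjX hXj
  obtain ⟨⟨b1, b2⟩, hnK, hK, S⟩ := h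
  rw [gridDual_comm, gridFlux_swap] at b1
  have s1 := gridDual_scheme m R u z c d t₀ T ν n K hc₁ hd₁
  have s2 := gridDual_scheme m R u z c d t₀ T ν n K hc₂ hd₂
  have n1 := gridDual_nonneg hcd.le S hc₁ hd₁ h₁
  have n2 := gridDual_nonneg hcd.le S hc₂ hd₂ h₂
  have hord' : ∀ i j, i ≤ j → j ≤ n + 1 → gridDual m R u z c d t₀ T ν n K g₁ K j *
      gridDual m R u z c d t₀ T ν n K g₂ K i ≤ gridDual m R u z c d t₀ T ν n K g₁ K i *
      gridDual m R u z c d t₀ T ν n K g₂ K j := by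
    intro i j hij hj
    simp only [gridDual_last]
    exact hord _ (gX_mem hcd.le (by omega)) _ (gX_mem hcd.le hj) (gX_mono hcd.le n hij)
  set φ := gridDual m R u z c d t₀ T ν n K g₁ with hφ
  set ψ := gridDual m R u z c d t₀ T ν n K g₂ with hψ
  have min0 := s1.minor s2 S hord' 0 (Nat.zero_le _)
  have hpow : ∀ x ∈ Icc c d, ∀ t ∈ Icc t₀ T, u x t ≤ z x t → u x t ^ m ≤ z x t ^ m :=
    fun x hx t ht h => Real.rpow_le_rpow (D.u_mem x hx t ht).1 h (by linarith : 0 ≤ m)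
  have hpow' : ∀ x ∈ Icc c d, ∀ t ∈ Icc t₀ T, z x t ≤ u x t → z x t ^ m ≤ u x t ^ m :=
    fun x hx t ht h => Real.rpow_le_rpow (D.z_mem x hx t ht).1 h (by linarith : 0 ≤ m)
  refine ⟨fun i hi => ?_, ?_⟩
  · have hmem := gX_mem hcd.le (show i + 1 ≤ n + 1 by omega)
    rcases Nat.lt_or_ge j (i + 1) with hji | hij
    · have e1 := D.init_right _ hmem (hXj.trans (gX_mono hcd.le n hji))
      have e2 := min0 j (i + 1) (by omega) (by omega)
      exact mul_nonneg_of_nonpos_of_nonpos (by linarith) (by linarith)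
    · have e1 := D.init_left _ hmem ((gX_mono hcd.le n hij).trans hjX)
      have e2 := min0 (i + 1) j hij hj
      exact mul_nonneg (by linarith) (by linarith)
  have hflux : 0 ≤ gridFlux m u z c d t₀ T n K φ * ψ 0 j - gridFlux m u z c d t₀ T n K ψ * φ 0 j := by
    unfold gridFlux
    rw [mul_assoc, mul_assoc, ← mul_sub, Finset.sum_mul, Finset.sum_mul, ← Finset.sum_sub_distrib]
    refine mul_nonneg (div_nonneg (by linarith) (Nat.cast_nonneg _))
      (Finset.sum_nonneg fun k hk => ?_)
    have hk := Finset.mem_range.1 hk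
    have hmem := gT_mem htT.le (show k ≤ K by omega)
    have a1 := hpow' c (left_mem_Icc.2 hcd.le) _ hmem (D.left_le _ hmem)
    have a2 := hpow d (right_mem_Icc.2 hcd.le) _ hmem (D.right_le _ hmem)
    obtain ⟨c1, c2⟩ := s1.minor_lateral s2 S hord' (show k + 1 ≤ K by omega) hj
    rw [div_mul_eq_mul_div, div_mul_eq_mul_div, ← sub_div]
    refine div_nonneg ?_ (sq_nonneg _)
    have e1 := mul_nonneg (sub_nonneg.2 a1) (sub_nonneg.2 c1)
    have e2 := mul_nonneg (sub_nonneg.2 a2) (sub_nonneg.2 c2)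
    linarith
  have hmesh : 0 ≤ (d - c) / ((n : ℝ) + 1) := div_nonneg (by linarith) (by positivity)
  have p1 := mul_le_mul_of_nonneg_right b1 (n2 0 (Nat.zero_le _) j hj)
  have p2 := mul_le_mul_of_nonneg_right b2 (n1 0 (Nat.zero_le _) j hj)
  have p3 := mul_nonneg hmesh hflux
  have q1 : ∑ i ∈ Finset.range n, (z (gX c d n (i + 1)) T - u (gX c d n (i + 1)) T) *
      g₁ (gX c d n (i + 1)) = - ∑ i ∈ Finset.range n,
      (u (gX c d n (i + 1)) T - z (gX c d n (i + 1)) T) * g₁ (gX c d n (i + 1)) := by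
    rw [← Finset.sum_neg_distrib]
    exact Finset.sum_congr rfl fun i _ => by ring
  have q2 : ∑ i ∈ Finset.range n, (z (gX c d n (i + 1)) t₀ - u (gX c d n (i + 1)) t₀) *
      φ 0 (i + 1) = - ∑ i ∈ Finset.range n,
      (u (gX c d n (i + 1)) t₀ - z (gX c d n (i + 1)) t₀) * φ 0 (i + 1) := by
    rw [← Finset.sum_neg_distrib]
    exact Finset.sum_congr rfl fun i _ => by ring
  have q3 : ∑ i ∈ Finset.range n, (u (gX c d n (i + 1)) t₀ - z (gX c d n (i + 1)) t₀) *
      (φ 0 (i + 1) * ψ 0 j - ψ 0 (i + 1) * φ 0 j) =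
      (∑ i ∈ Finset.range n, (u (gX c d n (i + 1)) t₀ - z (gX c d n (i + 1)) t₀) * φ 0 (i + 1))
        * ψ 0 j - (∑ i ∈ Finset.range n,
      (u (gX c d n (i + 1)) t₀ - z (gX c d n (i + 1)) t₀) * ψ 0 (i + 1)) * φ 0 j := by
    rw [Finset.sum_mul, Finset.sum_mul, ← Finset.sum_sub_distrib]
    exact Finset.sum_congr rfl fun i _ => by ring
  rw [q1, q2] at p1
  rw [q3]
  linarith

theorem exists_node {c d X : ℝ} (hX : X ∈ Icc c d) (n : ℕ) :
    ∃ j ≤ n, gX c d n j ≤ X ∧ X ≤ gX c d n (j + 1) ∧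
      (0 < n → c + (d - c) / (n + 1) ≤ X → 0 < j) := by
  classical
  have h0 : gX c d n 0 ≤ X := by rw [gX_zero]; exact hX.1
  refine ⟨Nat.findGreatest (fun j => gX c d n j ≤ X) n, Nat.findGreatest_le n,
    Nat.findGreatest_spec (P := fun j => gX c d n j ≤ X) (Nat.zero_le n) h0, ?_, fun hn hc => ?_⟩
  · rcases (Nat.findGreatest_le (P := fun j => gX c d n j ≤ X) n).eq_or_lt with h | h
    · rw [h, gX_last]; exact hX.2
    · exact le_of_not_ge (Nat.findGreatest_is_greatest (P := fun j => gX c d n j ≤ X)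
        (Nat.lt_succ_self _) h)
  · refine Nat.le_findGreatest (P := fun j => gX c d n j ≤ X) hn ?_
    have := gX_succ c d n 0
    rw [gX_zero] at this
    exact this.le.trans hc

theorem CrossData.no_reverse {m M L : ℝ} {R u z : ℝ → ℝ → ℝ} {c d t₀ T X : ℝ}
    (D : CrossData m M L R u z c d t₀ T X) (hX : X ∈ Ioo c d) {p y : ℝ} (hp : p ∈ Icc c d)
    (hy : y ∈ Icc c d) (hpy : p < y) (hup : u p T < z p T) : u y T ≤ z y T := by
  by_contra! huy
  have hcd := D.c_lt
  have htT := D.t_lt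
  have cont : Continuous fun x => u x T - z x T :=
    (D.contu.sub D.contz).comp (by fun_prop : Continuous fun y : ℝ => (y, T))
  have hTm := right_mem_Icc.2 htT.le
  have hpc : c < p := hp.1.lt_of_ne fun h => by
    have := D.left_le T hTm; rw [h] at this; linarith
  have hyd : y < d := hy.2.lt_of_ne fun h => by
    have := D.right_le T hTm; rw [← h] at this; linarith
  obtain ⟨μ, hpμ, hμy⟩ := exists_between hpy
  have o1 : IsOpen (Ioo c μ ∩ {x | u x T - z x T < 0}) :=
    isOpen_Ioo.inter (isOpen_lt cont continuous_const)
  have o2 : IsOpen (Ioo μ d ∩ {x | 0 < u x T - z x T}) :=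
    isOpen_Ioo.inter (isOpen_lt continuous_const cont)
  obtain ⟨g₁, hg₁, h₁, -, hg₁p, out₁⟩ := exists_bump o1 (y := p)
    ⟨⟨hpc, hpμ⟩, by simp only [mem_ofPred_eq]; linarith⟩
  obtain ⟨g₂, hg₂, h₂, -, hg₂y, out₂⟩ := exists_bump o2 (y := y)
    ⟨⟨hμy, hyd⟩, by simp only [mem_ofPred_eq]; linarith⟩
  have hc₁ : g₁ c = 0 := out₁ _ fun h => lt_irrefl _ h.1.1
  have hd₁ : g₁ d = 0 := out₁ _ fun h => by linarith [h.1.2]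
  have hc₂ : g₂ c = 0 := out₂ _ fun h => by linarith [h.1.1]
  have hd₂ : g₂ d = 0 := out₂ _ fun h => lt_irrefl _ h.1.2
  have hord : ∀ x ∈ Icc c d, ∀ y ∈ Icc c d, x ≤ y → g₁ y * g₂ x ≤ g₁ x * g₂ y := by
    intro a _ b _ hab
    have : g₁ b * g₂ a = 0 := by
      by_contra hne
      have hb : b ∈ Ioo c μ ∩ {x | u x T - z x T < 0} := by
        by_contra h; exact hne (by rw [out₁ _ h, zero_mul])
      have ha : a ∈ Ioo μ d ∩ {x | 0 < u x T - z x T} := by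
        by_contra h; exact hne (by rw [out₂ _ h, mul_zero])
      linarith [hb.1.2, ha.1.1]
    rw [this]
    exact mul_nonneg (h₁ _) (h₂ _)
  obtain ⟨η₁, hη₁, sum₁⟩ := exists_riemann_lower (F := fun x => -((u x T - z x T) * g₁ x)) hcd
    (cont.mul hg₁.continuous).neg (fun x _ => by
      by_cases hx : x ∈ Ioo c μ ∩ {x | u x T - z x T < 0}
      · exact neg_nonneg.2 (mul_nonpos_of_nonpos_of_nonneg (le_of_lt hx.2) (h₁ x))
      · rw [out₁ x hx, mul_zero, neg_zero]) (by rw [hd₁, mul_zero, neg_zero]) hp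
      (by rw [hg₁p]; linarith)
  obtain ⟨η₂, hη₂, sum₂⟩ := exists_riemann_lower (F := fun x => (u x T - z x T) * g₂ x) hcd
    (cont.mul hg₂.continuous) (fun x _ => by
      by_cases hx : x ∈ Ioo μ d ∩ {x | 0 < u x T - z x T}
      · exact mul_nonneg (le_of_lt hx.2) (h₂ x)
      · rw [out₂ x hx, mul_zero]) (by rw [hd₂, mul_zero]) hy (by rw [hg₂y]; linarith)
  have hη : 0 < min η₁ η₂ := lt_min hη₁ hη₂
  obtain ⟨η₃, hη₃, sum₃⟩ := exists_riemann_lower (F := g₁) hcd hg₁.continuous (fun x _ => h₁ x) hd₁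
    hp (by rw [hg₁p]; norm_num)
  have hmesh := (tendsto_mesh c d).eventually (ge_mem_nhds (sub_pos.2 hX.1))
  obtain ⟨ν, n, K, ⟨⟨hcr, hnK, hK, S⟩, s1, s2, s3, hn, hme⟩⟩ :=
    (((D.crossing (hg₁.of_le (by norm_cast)) (hg₂.of_le (by norm_cast)) hc₁ hc₂ hd₁ hd₂
      (fun x _ => h₁ x) (fun x _ => h₂ x) hord (by positivity : 0 < min η₁ η₂ / 2)).and
      D.toCompData.evGrid_bounds).and
      (evGrid_of_n (sum₁.and (sum₂.and (sum₃.and ((eventually_gt_atTop 0).and hmesh)))))).exists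
  obtain ⟨j, hjn, hjX, hXj, hj0⟩ := exists_node (Ioo_subset_Icc_self hX) n
  have hj0 := hj0 hn (by linarith)
  obtain ⟨pos, ineq⟩ := hcr j (by omega) hjX hXj
  have hφ := gridDual_nonneg hcd.le S hc₁ hd₁ (fun x _ => h₁ x) 0 (Nat.zero_le _) j (by omega)
  have hψ := gridDual_nonneg hcd.le S hc₂ hd₂ (fun x _ => h₂ x) 0 (Nat.zero_le _) j (by omega)
  have hφpos : 0 < gridDual m R u z c d t₀ T ν n K g₁ 0 j := by
    obtain ⟨i, hi, hgi⟩ : ∃ i < n, 0 < g₁ (gX c d n (i + 1)) := by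
      by_contra! hall
      have : ∑ i ∈ Finset.range n, g₁ (gX c d n (i + 1)) ≤ 0 :=
        Finset.sum_nonpos fun i hi => hall i (Finset.mem_range.1 hi)
      have hmesh0 : 0 ≤ (d - c) / ((n : ℝ) + 1) := div_nonneg (by linarith) (by positivity)
      have := mul_nonpos_of_nonneg_of_nonpos hmesh0 this
      linarith
    obtain ⟨j, rfl⟩ : ∃ j', j = j' + 1 := ⟨j - 1, by omega⟩
    exact (gridDual_scheme m R u z c d t₀ T ν n K hc₁ hd₁).pos S
      (fun i _ => by rw [gridDual_last]; exact h₁ _) hi (by rw [gridDual_last]; exact hgi) hnK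
      (by omega)
  have hlow := mul_nonneg (div_nonneg (by linarith) (by positivity) :
    0 ≤ (d - c) / ((n : ℝ) + 1)) (Finset.sum_nonneg fun i hi => pos i (Finset.mem_range.1 hi))
  rw [Finset.sum_neg_distrib, mul_neg] at s1
  set A₁ := (d - c) / (n + 1) * ∑ i ∈ Finset.range n,
          (u (gX c d n (i + 1)) T - z (gX c d n (i + 1)) T) * g₁ (gX c d n (i + 1))
  set A₂ := (d - c) / (n + 1) * ∑ i ∈ Finset.range n,
          (u (gX c d n (i + 1)) T - z (gX c d n (i + 1)) T) * g₂ (gX c d n (i + 1))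
  have e1 : A₁ + min η₁ η₂ / 2 ≤ -(min η₁ η₂ / 2) := by linarith [min_le_left η₁ η₂]
  have e2 : min η₁ η₂ / 2 ≤ A₂ - min η₁ η₂ / 2 := by linarith [min_le_right η₁ η₂]
  have f1 := mul_le_mul_of_nonneg_right e1 hψ
  have f2 := mul_le_mul_of_nonneg_right e2 hφ
  have f3 := mul_pos (half_pos hη) hφpos
  have f4 := mul_nonneg (half_pos hη).le hψ
  linarith

theorem exists_lap_grid_bound {g : ℝ → ℝ} (hg : ContDiff ℝ 2 g) {c d : ℝ} (hcd : c < d) :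
    ∃ C, 0 ≤ C ∧ ∀ n : ℕ, ∀ i < n, |lap ((d - c) / (n + 1)) (fun j => g (gX c d n j)) i| ≤ C := by
  have hg' : ContDiff ℝ 1 (deriv g) := ((contDiff_succ_iff_deriv (n := 1)).1 (by rwa [one_add_one_eq_two])).2.2
  have hc : Continuous (deriv (deriv g)) := hg'.continuous_deriv le_rfl
  obtain ⟨C, hC0, hC⟩ := exists_bound_Icc hc c d
  refine ⟨C, hC0, fun n i hi => ?_⟩
  have hh : 0 < (d - c) / ((n : ℝ) + 1) := div_pos (by linarith) (by positivity)
  have e := lap_grid g c ((d - c) / ((n : ℝ) + 1)) i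
  unfold gX
  rw [e, sd_eq_hatAvg (fun x => (hg.differentiable (by norm_num) x).hasDerivAt)
    (fun x => (hg'.differentiable one_ne_zero x).hasDerivAt) hc _ hh.ne']
  have e2 : c + ((i + 1 : ℕ) : ℝ) * ((d - c) / (n + 1)) = gX c d n (i + 1) := rfl
  rw [e2]
  have := abs_hatAvg_sub_le (x := gX c d n (i + 1)) (a := 0) (ε := C) hc hh.le fun y hy => by
    rw [sub_zero]
    have b1 := (gX_mem hcd.le (show i ≤ n + 1 by omega)).1
    have b2 := (gX_mem hcd.le (show i + 2 ≤ n + 1 by omega)).2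
    have b3 := gX_succ c d n i
    have b4 := gX_succ c d n (i + 1)
    exact hC y ⟨by linarith [hy.1], by linarith [hy.2]⟩
  rwa [sub_zero] at this

/-- For short times the dual solution stays close to its terminal values, uniformly in the grid. -/
theorem gridDual_close (m Λ L : ℝ) (R u z : ℝ → ℝ → ℝ) {c d T : ℝ} (hcd : c < d) {g : ℝ → ℝ}
    (hg : ContDiff ℝ 2 g) (hgc : g c = 0) (hgd : g d = 0) {e : ℝ} (he : 0 < e) :
    ∃ δ₀ > 0, ∀ t' ∈ Ioo (T - δ₀) T, ∀ (ν : ℝ) (n K : ℕ), 0 < K →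
      SchemeBounds n K ((d - c) / (n + 1)) ((T - t') / K)
        (gridA m u z c d t' T ν n K) (gridB R u z c d t' T n K) ν Λ L →
      ∀ k ≤ K, ∀ i ≤ n + 1, |gridDual m R u z c d t' T ν n K g k i - g (gX c d n i)| ≤ e := by
  obtain ⟨C, hC0, hC⟩ := exists_lap_grid_bound hg hcd
  obtain ⟨Φ, hΦ0, hΦ⟩ := exists_bound_Icc hg.continuous c d
  have hE : Continuous fun δ : ℝ => Real.exp (δ * L) * ((Λ * C + L * Φ) * δ) := by fun_prop
  have hE0 := hE.tendsto 0
  simp only [mul_zero] at hE0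
  obtain ⟨δ₀, hδ₀, hb⟩ := Metric.eventually_nhds_iff.1 (hE0.eventually (gt_mem_nhds he))
  refine ⟨δ₀, hδ₀, fun t' ht' ν n K hK S k hk i hi => ?_⟩
  have hlast := gridDual_last m R u z c d t' T ν n K g
  have hscheme := gridDual_scheme m R u z c d t' T ν n K hgc hgd
  have := hscheme.close S hC0 hΦ0 (fun i hi => by rw [hlast]; exact hΦ _ (gX_mem hcd.le hi))
    (fun i hi => by
      have : gridDual m R u z c d t' T ν n K g K = fun j => g (gX c d n j) := funext hlast
      rw [this]; exact hC n i hi) k hk i hi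
  rw [hlast] at this
  have hKδ : K * ((T - t') / K) = T - t' := by
    have : (K : ℝ) ≠ 0 := by positivity
    field_simp
  rw [hKδ] at this
  refine this.trans (hb ?_).le
  rw [Real.dist_eq, sub_zero, abs_of_pos (by linarith [ht'.2])]
  linarith [ht'.1]

theorem cross_product_close {a b A B p q e D : ℝ} (he1 : e ≤ 1) (hp : p ∈ Icc 0 D)
    (hq : q ∈ Icc 0 D) (ha : |a - 1| ≤ e) (hA : |A - 1| ≤ e) (hb : |b - p| ≤ e)
    (hB : |B - q| ≤ e) : |a * B - b * A - (q - p)| ≤ e * (4 + 2 * D) := by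
  have e1 : a * B - b * A - (q - p) =
      (a * (B - q) + q * (a - 1)) - (A * (b - p) + p * (A - 1)) := by ring
  have h2 : |a| ≤ 2 := abs_le.2 ⟨by linarith [(abs_le.1 ha).1], by linarith [(abs_le.1 ha).2]⟩
  have h3 : |A| ≤ 2 := abs_le.2 ⟨by linarith [(abs_le.1 hA).1], by linarith [(abs_le.1 hA).2]⟩
  have h4 : |q| ≤ D := abs_le.2 ⟨by linarith [hq.1, hq.2], hq.2⟩
  have h5 : |p| ≤ D := abs_le.2 ⟨by linarith [hp.1, hp.2], hp.2⟩
  have hD : 0 ≤ D := hp.1.trans hp.2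
  rw [e1]
  refine (abs_sub _ _).trans ((add_le_add (abs_add_le _ _) (abs_add_le _ _)).trans ?_)
  simp only [abs_mul]
  have k1 : |a| * |B - q| ≤ 2 * e := by gcongr
  have k2 : |q| * |a - 1| ≤ D * e := by gcongr
  have k3 : |A| * |b - p| ≤ 2 * e := by gcongr
  have k4 : |p| * |A - 1| ≤ D * e := by gcongr
  linarith

/-- If the two solutions agree at time `T` on an interval, then shortly before they agree there
at distance `s` from the crossing point. -/
theorem crossing_rigidity {m M L : ℝ} {R u z : ℝ → ℝ → ℝ} {c d T y ρ s : ℝ} (hρ : 0 < ρ)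
    (hs : 0 < s) (hc : c ≤ y - ρ) (hd : y + ρ ≤ d)
    (hw : ∀ x ∈ Icc (y - ρ) (y + ρ), u x T = z x T) :
    ∃ δ₀ > 0, ∀ t' ∈ Ioo (T - δ₀) T, ∀ X, |X - y| ≤ ρ / 4 →
      CrossData m M L R u z c d t' T X → ∀ x, |x - y| ≤ ρ / 4 → s ≤ |x - X| → u x t' = z x t' := by
  have hcd : c < d := by linarith
  let g : ContDiffBump y := ⟨ρ / 2, ρ, by positivity, by linarith⟩
  have gs : ContDiff ℝ 2 g := g.contDiff
  have g2s : ContDiff ℝ 2 fun x => (x - c) * g x := by fun_prop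
  have g0 : ∀ x, 0 ≤ g x := fun x => g.nonneg
  have gout : ∀ x, ρ ≤ |x - y| → g x = 0 := fun x hx =>
    g.zero_of_le_dist (by rw [Real.dist_eq]; exact hx)
  have gone : ∀ x, |x - y| ≤ ρ / 2 → g x = 1 := fun x hx =>
    g.one_of_mem_closedBall (by rw [Metric.mem_closedBall, Real.dist_eq]; exact hx)
  have gc : g c = 0 := gout c (by rw [abs_of_nonpos] <;> linarith)
  have gd : g d = 0 := gout d (by rw [abs_of_nonneg] <;> linarith)
  have hD0 : 0 < d - c := by linarith
  set e := min 1 (s / (8 * (4 + 2 * (d - c)))) with he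
  have he0 : 0 < e := by positivity
  have he1 : e ≤ 1 := min_le_left _ _
  have he2 : e * (4 + 2 * (d - c)) ≤ s / 8 := by
    have : e ≤ s / (8 * (4 + 2 * (d - c))) := min_le_right _ _
    calc e * (4 + 2 * (d - c)) ≤ s / (8 * (4 + 2 * (d - c))) * (4 + 2 * (d - c)) := by gcongr
      _ = s / 8 := by field_simp
  obtain ⟨δ₁, hδ₁, H1⟩ := gridDual_close m (m * M ^ (m - 1) + 1) L R u z (T := T) hcd gs gc gd he0
  obtain ⟨δ₂, hδ₂, H2⟩ := gridDual_close m (m * M ^ (m - 1) + 1) L R u z (T := T) hcd g2s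
    (by simp) (by simp [gd]) he0
  refine ⟨min δ₁ δ₂, lt_min hδ₁ hδ₂, fun t' ht' X hX D x hx hxX => ?_⟩
  have H1 := H1 t' ⟨by linarith [ht'.1, min_le_left δ₁ δ₂], ht'.2⟩
  have H2 := H2 t' ⟨by linarith [ht'.1, min_le_right δ₁ δ₂], ht'.2⟩
  by_contra hne
  have hxab := abs_le.1 hx
  have hXab := abs_le.1 hX
  have cont : Continuous fun x => |u x t' - z x t'| :=
    ((D.contu.sub D.contz).comp (by fun_prop : Continuous fun y : ℝ => (y, t'))).abs
  have hopen : IsOpen (Ioo (x - min (ρ / 4) (s / 4)) (x + min (ρ / 4) (s / 4))) := isOpen_Ioo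
  have hmin : 0 < min (ρ / 4) (s / 4) := by positivity
  obtain ⟨ℓ, hℓs, hℓ0, hℓ1, hℓx, hℓout⟩ := exists_bump hopen (y := x)
    ⟨by linarith, by linarith⟩
  obtain ⟨η, hη, hsum⟩ := exists_riemann_lower (F := fun x => |u x t' - z x t'| * ℓ x) hcd
    (cont.mul hℓs.continuous) (fun x _ => mul_nonneg (abs_nonneg _) (hℓ0 x))
    (by rw [hℓout d (fun h => by linarith [h.2, min_le_left (ρ / 4) (s / 4)]), mul_zero])
    (y := x) ⟨by linarith, by linarith⟩ (by rw [hℓx, mul_one]; exact abs_pos.2 (sub_ne_zero.2 hne))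
  have hmesh1 := (tendsto_mesh c d).eventually (gt_mem_nhds (by positivity : 0 < ρ / 4))
  have hmesh2 := (tendsto_mesh c d).eventually (gt_mem_nhds (by positivity : 0 < s / 4))
  have hord : ∀ a ∈ Icc c d, ∀ b ∈ Icc c d, a ≤ b →
      g b * ((a - c) * g a) ≤ g a * ((b - c) * g b) := by
    intro a _ b _ hab
    have := mul_nonneg (sub_nonneg.2 hab) (mul_nonneg (g0 a) (g0 b))
    linarith
  obtain ⟨ν, n, K, ⟨⟨hcr, hnK, hK, S⟩, s1, h1, h2⟩⟩ :=
    (((D.crossing gs g2s gc (by simp) gd (by simp [gd]) (fun x _ => g0 x)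
      (fun x hx => mul_nonneg (sub_nonneg.2 hx.1) (g0 x)) hord
      (by positivity : 0 < s * η / (8 * (d - c + 3)))).and D.toCompData.evGrid_bounds).and
      (evGrid_of_n (hsum.and (hmesh1.and hmesh2)))).exists
  obtain ⟨j, hjn, hjX, hXj, -⟩ := exists_node (c := c) (d := d) (X := X) ⟨by linarith, by linarith⟩ n
  obtain ⟨pos, ineq⟩ := hcr j (by omega) hjX hXj
  have H1 := fun i hi => H1 ν n K hK S 0 (Nat.zero_le _) i hi
  have H2 := fun i hi => H2 ν n K hK S 0 (Nat.zero_le _) i hi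
  set φ := gridDual m R u z c d t' T ν n K g
  set ψ := gridDual m R u z c d t' T ν n K (fun x => (x - c) * g x)
  have hA1 : ∀ G : ℝ → ℝ, (∀ x, ρ ≤ |x - y| → G x = 0) → ∑ i ∈ Finset.range n,
      (u (gX c d n (i + 1)) T - z (gX c d n (i + 1)) T) * G (gX c d n (i + 1)) = 0 := by
    intro G hG
    refine Finset.sum_eq_zero fun i _ => ?_
    rcases le_or_gt ρ |gX c d n (i + 1) - y| with h | h
    · rw [hG _ h, mul_zero]
    · have := abs_lt.1 h
      rw [hw _ ⟨by linarith, by linarith⟩, sub_self, zero_mul]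
  rw [hA1 g gout, hA1 (fun x => (x - c) * g x) (fun x hx => by simp [gout x hx])] at ineq
  rw [gX_succ] at hXj
  have hxj : |gX c d n j - y| ≤ ρ / 2 := abs_le.2 ⟨by linarith, by linarith⟩
  have j1 := H1 j (by omega)
  have j2 := H2 j (by omega)
  rw [gone _ hxj] at j1 j2
  rw [mul_one] at j2
  have hjc := gX_mem hcd.le (show j ≤ n + 1 by omega)
  have j1' := abs_le.1 j1
  have j2' := abs_le.1 j2
  have hterm : ∀ i ∈ Finset.range n, s / 4 * (|u (gX c d n (i + 1)) t' - z (gX c d n (i + 1)) t'|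
      * ℓ (gX c d n (i + 1))) ≤ (u (gX c d n (i + 1)) t' - z (gX c d n (i + 1)) t') *
        (φ 0 (i + 1) * ψ 0 j - ψ 0 (i + 1) * φ 0 j) := by
    intro i hi
    have hi := Finset.mem_range.1 hi
    have hp := pos i hi
    by_cases hmem : gX c d n (i + 1) ∈
        Ioo (x - min (ρ / 4) (s / 4)) (x + min (ρ / 4) (s / 4))
    · have b1 := min_le_left (ρ / 4) (s / 4)
      have b2 := min_le_right (ρ / 4) (s / 4)
      have i1 := H1 (i + 1) (by omega)
      have i2 := H2 (i + 1) (by omega)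
      rw [gone _ (abs_le.2 ⟨by linarith [hmem.1], by linarith [hmem.2]⟩)] at i1 i2
      rw [mul_one] at i2
      have hic := gX_mem hcd.le (show i + 1 ≤ n + 1 by omega)
      have hxij : s / 2 ≤ |gX c d n j - gX c d n (i + 1)| := by
        have t1 : |x - X| ≤ |x - gX c d n (i + 1)| + |gX c d n (i + 1) - gX c d n j|
            + |gX c d n j - X| := by
          calc |x - X| = |x - gX c d n (i + 1) + (gX c d n (i + 1) - gX c d n j)
                + (gX c d n j - X)| := by congr 1; ring
            _ ≤ _ := abs_add_three _ _ _
        have t2 : |x - gX c d n (i + 1)| ≤ s / 4 :=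
          abs_le.2 ⟨by linarith [hmem.2], by linarith [hmem.1]⟩
        have t3 : |gX c d n j - X| ≤ s / 4 := abs_le.2 ⟨by linarith, by linarith⟩
        rw [abs_sub_comm (gX c d n j)]
        linarith
      have key := cross_product_close he1 ⟨sub_nonneg.2 hic.1, sub_le_sub_right hic.2 c⟩
        ⟨sub_nonneg.2 hjc.1, sub_le_sub_right hjc.2 c⟩ i1 j1 i2 j2
      rw [sub_sub_sub_cancel_right] at key
      have hχ : s / 4 ≤ |φ 0 (i + 1) * ψ 0 j - ψ 0 (i + 1) * φ 0 j| := by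
        have := abs_sub_abs_le_abs_sub (gX c d n j - gX c d n (i + 1))
          (φ 0 (i + 1) * ψ 0 j - ψ 0 (i + 1) * φ 0 j)
        rw [abs_sub_comm] at key
        linarith
      rw [← abs_of_nonneg hp, abs_mul]
      calc _ = |u (gX c d n (i + 1)) t' - z (gX c d n (i + 1)) t'| * (s / 4 *
            ℓ (gX c d n (i + 1))) := by ring
        _ ≤ _ := by
          gcongr
          exact (mul_le_of_le_one_right (by positivity) (hℓ1 _)).trans hχ
    · rw [hℓout _ hmem, mul_zero, mul_zero]
      exact hp
  have hsm := Finset.sum_le_sum hterm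
  rw [← Finset.mul_sum] at hsm
  have hm0 : 0 ≤ (d - c) / ((n : ℝ) + 1) := div_nonneg (by linarith) (by positivity)
  have hsm' := mul_le_mul_of_nonneg_left hsm hm0
  have s2 := mul_le_mul_of_nonneg_left s1 (by positivity : 0 ≤ s / 4)
  have hfin : s * η / (8 * (d - c + 3)) * (ψ 0 j + φ 0 j) ≤ s * η / 8 := by
    calc _ ≤ s * η / (8 * (d - c + 3)) * (d - c + 3) := by
          refine mul_le_mul_of_nonneg_left ?_ (by positivity)
          linarith [hjc.2, j1'.2, j2'.2]
      _ = _ := by field_simp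
  have hpos : 0 < s * η := by positivity
  simp only [mul_zero, zero_add, zero_sub] at ineq
  rw [mul_left_comm] at hsm'
  have hchain := (s2.trans hsm').trans (ineq.trans_eq (by ring :
    _ = s * η / (8 * (d - c + 3)) * (ψ 0 j + φ 0 j)))
  linarith

theorem integral_swap_compact {F : ℝ → ℝ → ℝ} (hF : Continuous (Function.uncurry F)) {a b : ℝ}
    {K : Set ℝ} (hK : IsCompact K) (hout : ∀ t ∈ uIcc a b, ∀ y, y ∉ K → F t y = 0) :
    ∫ t in a..b, ∫ y, F t y = ∫ y, ∫ t in a..b, F t y := by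
  refine intervalIntegral_integral_swap ?_
  have e : (volume.restrict (uIoc a b)).prod (volume : Measure ℝ) =
      volume.restrict (uIoc a b ×ˢ univ) := by
    rw [Measure.volume_eq_prod, ← Measure.prod_restrict, Measure.restrict_univ]
  rw [e]
  refine (hF.continuousOn.integrableOn_compact ((isCompact_uIcc (a := a) (b := b)).prod hK)).of_forall_sdiff_eq_zero
    (measurableSet_uIoc.prod MeasurableSet.univ) ?_
  rintro ⟨t, y⟩ ⟨⟨ht, -⟩, hn⟩
  exact hout t (uIoc_subset_uIcc ht) y fun h => hn ⟨uIoc_subset_uIcc ht, h⟩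

/-- An antiderivative of a smooth function is smooth. -/
theorem exists_smooth_antideriv {g : ℝ → ℝ} (hg : ContDiff ℝ (⊤ : ℕ∞) g) :
    ∃ G : ℝ → ℝ, ContDiff ℝ (⊤ : ℕ∞) G ∧ ∀ x, HasDerivAt G (g x) x := by
  have hd : ∀ x, HasDerivAt (fun y => ∫ s in (0 : ℝ)..y, g s) (g x) x := fun x =>
    intervalIntegral.integral_hasDerivAt_right (hg.continuous.intervalIntegrable _ _)
      (hg.continuous.stronglyMeasurableAtFilter _ _) hg.continuous.continuousAt
  refine ⟨_, ?_, hd⟩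
  refine contDiff_infty_iff_deriv.2 ⟨fun x => (hd x).differentiableAt, ?_⟩
  rw [show deriv _ = g from funext fun x => (hd x).deriv]
  exact hg

theorem HasDerivAt.sd {g g' : ℝ → ℝ} (hg : ∀ x, HasDerivAt g (g' x) x) (h x : ℝ) :
    HasDerivAt (fun y => sd g y h) (sd g' x h) x := by
  have h1 : HasDerivAt (fun y => g (y + h)) (g' (x + h)) x := (hg _).comp_add_const x h
  have h2 : HasDerivAt (fun y => g (y - h)) (g' (x - h)) x := (hg _).comp_sub_const x h
  exact ((h1.sub ((hg x).const_mul 2)).add h2).div_const _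

theorem integral_mul_sd {g : ℝ → ℝ} (hg : Continuous g) (hgs : HasCompactSupport g) {F : ℝ → ℝ}
    (hF : Continuous F) (h : ℝ) : ∫ x, F x * sd g x h = ∫ x, g x * sd F x h := by
  have hi : ∀ G : ℝ → ℝ, Continuous G → Integrable fun x => g x * G x := fun G hG =>
    (hg.mul hG).integrable_of_hasCompactSupport hgs.mul_right
  have s1 : ∀ a : ℝ, Integrable (fun x => F x * g (x + a)) ∧
      ∫ x, F x * g (x + a) = ∫ x, g x * F (x - a) := fun a => by
    have e : (fun x => F x * g (x + a)) = fun x => (fun y => g y * F (y - a)) (x + a) := by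
      ext x; simp [mul_comm]
    have hh := hi (fun y => F (y - a)) (by fun_prop)
    rw [e]
    exact ⟨hh.comp_add_right a, integral_add_right_eq_self (μ := volume)
      (fun y => g y * F (y - a)) a⟩
  have i1 := s1 h
  have i0 := s1 0
  have i2 := s1 (-h)
  simp only [add_zero, sub_zero, ← sub_eq_add_neg, sub_neg_eq_add] at i0 i2
  have l : ∀ x, F x * sd g x h = (F x * g (x + h) - 2 * (F x * g x) + F x * g (x - h)) / h ^ 2 :=
    fun x => by unfold sd; ring
  have r : ∀ x, g x * sd F x h = (g x * F (x - h) - 2 * (g x * F x) + g x * F (x + h)) / h ^ 2 :=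
    fun x => by unfold sd; ring
  simp only [l, r, integral_div]
  have e1 := integral_add (i1.1.sub (i0.1.const_mul 2)) i2.1
  have e2 := integral_sub i1.1 (i0.1.const_mul 2)
  have j1 := hi (fun x => F (x - h)) (by fun_prop)
  have j2 := hi (fun x => F (x + h)) (by fun_prop)
  have e3 := integral_add (j1.sub ((hi _ hF).const_mul 2)) j2
  have e4 := integral_sub j1 ((hi _ hF).const_mul 2)
  simp only [Pi.sub_apply, integral_const_mul] at e1 e2 e3 e4
  rw [e1, e2, e3, e4, i1.2, i2.2, i0.2]

theorem exists_bound_of_hasCompactSupport {g : ℝ → ℝ} (hgs : HasCompactSupport g) :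
    ∃ A, ∀ y, A < |y| → g y = 0 := by
  obtain ⟨A, hA⟩ := hgs.isCompact.isBounded.subset_closedBall 0
  refine ⟨A, fun y hy => image_eq_zero_of_notMem_tsupport fun h => ?_⟩
  have := hA h
  rw [Metric.mem_closedBall, dist_zero_right, Real.norm_eq_abs] at this
  linarith

theorem integral_mul_hatAvg {g : ℝ → ℝ} (hg : Continuous g) (hgs : HasCompactSupport g) {F : ℝ → ℝ}
    (hF : Continuous F) (h : ℝ) : ∫ x, F x * hatAvg g x h = ∫ x, g x * hatAvg F x h := by
  have hs : ∀ s, ∫ x, F x * g (x + h * s) = ∫ x, g x * F (x - h * s) := fun s => by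
    have e : (fun x => F x * g (x + h * s)) = fun x => (fun y => g y * F (y - h * s)) (x + h * s) := by
      ext x; simp [mul_comm]
    rw [e]
    exact integral_add_right_eq_self (μ := volume) (fun y => g y * F (y - h * s)) (h * s)
  obtain ⟨A, hout⟩ := exists_bound_of_hasCompactSupport hgs
  unfold hatAvg
  have e1 := integral_swap_compact (F := fun s x => F x * ((1 - |s|) * g (x + h * s))) (a := -1)
    (b := 1) (by simp only [Function.uncurry_def]; fun_prop)
    (isCompact_Icc (a := -(A + |h|)) (b := A + |h|)) (fun s hs y hy => by
      rw [uIcc_of_le (by norm_num)] at hs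
      rw [hout, mul_zero, mul_zero]
      by_contra! hc
      have h1 : |h * s| ≤ |h| := by
        rw [abs_mul]; exact mul_le_of_le_one_right (abs_nonneg _) (abs_le.2 hs)
      have h2 := abs_le.1 hc
      have h3 := abs_le.1 h1
      exact hy ⟨by linarith, by linarith⟩)
  have e2 := integral_swap_compact (F := fun s x => g x * ((1 - |s|) * F (x - h * s))) (a := -1)
    (b := 1) (by simp only [Function.uncurry_def]; fun_prop) hgs.isCompact (fun s _ y hy => by
      rw [image_eq_zero_of_notMem_tsupport hy, zero_mul])
  simp only [intervalIntegral.integral_const_mul] at e1 e2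
  rw [← e1]
  have e3 : ∀ x, ∫ s in (-1 : ℝ)..1, (1 - |s|) * F (x + h * s) =
      ∫ s in (-1 : ℝ)..1, (1 - |s|) * F (x - h * s) := fun x => by
    have := intervalIntegral.integral_comp_neg (a := -1) (b := 1)
      fun s => (1 - |s|) * F (x + h * s)
    simpa [sub_eq_add_neg] using this.symm
  simp only [e3]
  rw [← e2]
  refine intervalIntegral.integral_congr fun s _ => ?_
  simp only [mul_left_comm _ (1 - |s|), integral_const_mul, hs]

theorem hasCompactSupport_hatAvg {g : ℝ → ℝ} (hgs : HasCompactSupport g) (h : ℝ) :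
    HasCompactSupport fun y => hatAvg g y h := by
  obtain ⟨A, hout⟩ := exists_bound_of_hasCompactSupport hgs
  refine HasCompactSupport.intro (isCompact_Icc (a := -(A + |h|)) (b := A + |h|)) fun y hy => ?_
  unfold hatAvg
  rw [intervalIntegral.integral_congr (g := fun _ => 0) fun s hs => ?_]
  · simp
  · rw [uIcc_of_le (by norm_num)] at hs
    simp only
    rw [hout, mul_zero]
    by_contra! hc
    have h1 : |h * s| ≤ |h| := by
      rw [abs_mul]; exact mul_le_of_le_one_right (abs_nonneg _) (abs_le.2 hs)
    have h2 := abs_le.1 hc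
    have h3 := abs_le.1 h1
    exact hy ⟨by linarith, by linarith⟩

/-- Weak solutions satisfy the equation averaged against hat functions. -/
theorem avg_identity {m t₁ τ : ℝ} (hm : 0 ≤ m) {R u : ℝ → ℝ → ℝ}
    (hR : Continuous (Function.uncurry R)) (hu : Continuous (Function.uncurry u))
    (H : ∀ e : ℝ → ℝ, ContDiff ℝ (⊤ : ℕ∞) e → HasCompactSupport e →
      ∫ x, u x τ * e x = (∫ x, u x t₁ * e x) +
        (∫ t in t₁..τ, ∫ x, R x (u x t) * e x) + ∫ t in t₁..τ, ∫ x, u x t ^ m * deriv (deriv e) x)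
    (x : ℝ) {h : ℝ} (hh : 0 < h) :
    hatAvg (fun y => u y τ) x h = hatAvg (fun y => u y t₁) x h + ∫ t in t₁..τ,
      (sd (fun y => u y t ^ m) x h + hatAvg (fun y => R y (u y t)) x h) := by
  have hRu := continuous_reac hR hu
  have hut : ∀ t, Continuous fun y => u y t := fun t => hu.comp (by fun_prop :
    Continuous fun y : ℝ => (y, t))
  have hUt : ∀ t, Continuous fun y => u y t ^ m := fun t => (hut t).rpow_const fun _ => Or.inr hm
  have hRt : ∀ t, Continuous fun y => R y (u y t) := fun t => hRu.comp (by fun_prop :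
    Continuous fun y : ℝ => (y, t))
  have hA : ∀ F : ℝ → ℝ → ℝ, Continuous (Function.uncurry F) →
      Continuous fun q : ℝ × ℝ => hatAvg (fun y => F y q.1) q.2 h := fun F hF => by
    have : Continuous (Function.uncurry fun (y : ℝ) (q : ℝ × ℝ) => F (y + q.2) q.1) :=
      hF.comp (by fun_prop : Continuous fun p : ℝ × ℝ × ℝ => (p.1 + p.2.2, p.2.1))
    have := continuous_hatAvg this 0 h
    refine this.congr fun q => ?_
    unfold hatAvg
    refine intervalIntegral.integral_congr fun s _ => ?_
    simp only [zero_add, add_comm (h * s)]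
  have hU : Continuous fun q : ℝ × ℝ => u q.1 q.2 ^ m :=
    Continuous.rpow_const (f := fun q : ℝ × ℝ => u q.1 q.2) hu fun _ => Or.inr hm
  have hS : Continuous fun q : ℝ × ℝ => sd (fun y => u y q.1 ^ m) q.2 h := by
    unfold sd
    have h1 := hU.comp (by fun_prop : Continuous fun q : ℝ × ℝ => (q.2 + h, q.1))
    have h2 := hU.comp (by fun_prop : Continuous fun q : ℝ × ℝ => (q.2, q.1))
    have h3 := hU.comp (by fun_prop : Continuous fun q : ℝ × ℝ => (q.2 - h, q.1))
    exact ((h1.sub (h2.const_mul 2)).add h3).div_const _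
  have hQ := hA _ hRu
  have hpar : ∀ G : ℝ × ℝ → ℝ, Continuous G → Continuous fun x => ∫ t in t₁..τ, G (t, x) :=
    fun G hG => intervalIntegral.continuous_parametric_intervalIntegral_of_continuous'
      (f := fun x t => G (t, x)) (hG.comp (by fun_prop : Continuous fun q : ℝ × ℝ => (q.2, q.1))) _ _
  have hSi := hpar _ hS
  have hQi := hpar _ hQ
  have hH : ∀ t, Continuous fun x => hatAvg (fun y => u y t) x h := fun t =>
    (hA u hu).comp (by fun_prop : Continuous fun x : ℝ => (t, x))
  have hF : Continuous fun x => hatAvg (fun y => u y τ) x h - hatAvg (fun y => u y t₁) x h -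
      (∫ t in t₁..τ, hatAvg (fun y => R y (u y t)) x h) -
      ∫ t in t₁..τ, sd (fun y => u y t ^ m) x h := (((hH τ).sub (hH t₁)).sub hQi).sub hSi
  have key := ae_eq_zero_of_integral_contDiff_smul_eq_zero
    (hF.locallyIntegrable (μ := volume)) fun g hg hgs => by
      obtain ⟨Y1, hY1s, hY1⟩ := exists_smooth_antideriv hg
      obtain ⟨Y, hYs, hY⟩ := exists_smooth_antideriv hY1s
      have he : (fun y => hatAvg g y h) = fun y => sd Y y h := funext fun y =>
        (sd_eq_hatAvg hY hY1 hg.continuous y hh.ne').symm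
      have hes : ContDiff ℝ (⊤ : ℕ∞) fun y => hatAvg g y h := by
        rw [he]; unfold sd; fun_prop
      have hd : deriv (deriv fun y => hatAvg g y h) = fun y => sd g y h := by
        rw [he, show deriv (fun y => sd Y y h) = fun y => sd Y1 y h from
          funext fun y => (HasDerivAt.sd hY h y).deriv]
        exact funext fun y => (HasDerivAt.sd hY1 h y).deriv
      have e := H _ hes (hasCompactSupport_hatAvg hgs h)
      simp only [hd, integral_mul_hatAvg hg.continuous hgs (hut _),
        integral_mul_hatAvg hg.continuous hgs (hRt _), integral_mul_sd hg.continuous hgs (hUt _)] at e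
      rw [integral_swap_compact (F := fun t x => g x * hatAvg (fun y => R y (u y t)) x h)
        ((hg.continuous.comp continuous_snd).mul hQ) hgs.isCompact (fun t _ y hy => by
          rw [image_eq_zero_of_notMem_tsupport hy, zero_mul]),
        integral_swap_compact (F := fun t x => g x * sd (fun y => u y t ^ m) x h)
        ((hg.continuous.comp continuous_snd).mul hS) hgs.isCompact (fun t _ y hy => by
          rw [image_eq_zero_of_notMem_tsupport hy, zero_mul])] at e
      simp only [intervalIntegral.integral_const_mul] at e
      simp only [smul_eq_mul, mul_sub]
      have hgi : ∀ G : ℝ → ℝ, Continuous G → Integrable fun x => g x * G x := fun G hG =>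
        (hg.continuous.mul hG).integrable_of_hasCompactSupport hgs.mul_right
      have f1 := integral_sub (hgi _ (hH τ)) (hgi _ (hH t₁))
      have f2 := integral_sub ((hgi _ (hH τ)).sub (hgi _ (hH t₁))) (hgi _ hQi)
      have f3 := integral_sub (((hgi _ (hH τ)).sub (hgi _ (hH t₁))).sub (hgi _ hQi)) (hgi _ hSi)
      simp only [Pi.sub_apply] at f1 f2 f3
      rw [f3, f2, f1, e]
      ring
  have key := congrFun ((hF.ae_eq_iff_eq volume continuous_const (f := _) (g := fun _ => (0 : ℝ))).1
    key) x
  have i1 : Continuous fun t => sd (fun y => u y t ^ m) x h :=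
    hS.comp (by fun_prop : Continuous fun t : ℝ => (t, x))
  have i2 : Continuous fun t => hatAvg (fun y => R y (u y t)) x h :=
    hQ.comp (by fun_prop : Continuous fun t : ℝ => (t, x))
  rw [intervalIntegral.integral_add (i1.intervalIntegrable _ _) (i2.intervalIntegrable _ _)]
  linarith

/-- An integrated averaged identity yields the Dini formulation. -/
theorem avgSol_of_identity {σ m t₁ T c d : ℝ} (hσ : |σ| ≤ 1) (hm : 0 ≤ m) {R u : ℝ → ℝ → ℝ}
    (hR : Continuous (Function.uncurry R)) (hu : Continuous (Function.uncurry u))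
    (H : ∀ x h, 0 < h → ∀ τ ∈ Icc t₁ T,
      hatAvg (fun y => u y τ) x h = hatAvg (fun y => u y t₁) x h + ∫ t in t₁..τ,
        (sd (fun y => u y t ^ m) x h + hatAvg (fun y => R y (u y t)) x h)) :
    AvgSol σ m R u c d t₁ T := by
  intro x h hh _ _ s hs ε hε
  have hc : Continuous fun t => sd (fun y => u y t ^ m) x h + hatAvg (fun y => R y (u y t)) x h :=
    (continuous_sd hu hm x h).add (continuous_hatAvg (continuous_reac hR hu) x h)
  set P := fun t => sd (fun y => u y t ^ m) x h + hatAvg (fun y => R y (u y t)) x h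
  have hev : ∀ᶠ t in 𝓝 s, |P t - P s| < ε := by
    have := Metric.tendsto_nhds.1 (hc.continuousAt (x := s)) ε hε
    simpa only [Real.dist_eq] using this
  obtain ⟨ρ, hρ, hρ'⟩ := Metric.eventually_nhds_iff.1 hev
  filter_upwards [Ioo_mem_nhdsGT (lt_min hs.2 (lt_add_of_pos_right s hρ))] with t ht
  have htT := ht.2.trans_le (min_le_left _ _)
  have htρ := ht.2.trans_le (min_le_right _ _)
  have hi := fun a b => hc.intervalIntegrable (μ := volume) a b
  have e : hatAvg (fun y => u y t) x h - hatAvg (fun y => u y s) x h = ∫ r in s..t, P r := by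
    rw [H x h hh t ⟨hs.1.trans ht.1.le, htT.le⟩, H x h hh s ⟨hs.1, hs.2.le⟩,
      ← intervalIntegral.integral_add_adjacent_intervals (hi t₁ s) (hi s t)]
    ring
  have e2 : (∫ r in s..t, P r) - (t - s) * P s = ∫ r in s..t, (P r - P s) := by
    rw [intervalIntegral.integral_sub (hi _ _) (by simp), intervalIntegral.integral_const,
      smul_eq_mul]
  have b := intervalIntegral.norm_integral_le_of_norm_le_const (a := s) (b := t) (C := ε)
    (f := fun r => P r - P s) fun r hr => by
      rw [uIoc_of_le ht.1.le] at hr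
      refine (hρ' ?_).le
      rw [Real.dist_eq, abs_of_nonneg (by linarith [hr.1])]
      linarith [hr.2]
  rw [← e2, Real.norm_eq_abs, abs_of_pos (sub_pos.2 ht.1)] at b
  have : |σ * ((∫ r in s..t, P r) - (t - s) * P s)| ≤ ε * (t - s) := by
    rw [abs_mul]
    exact (mul_le_of_le_one_left (abs_nonneg _) hσ).trans b
  rw [e]
  have := (abs_le.1 this).2
  linarith

theorem VeryWeakSol.test {m τ : ℝ} {f : ℝ → ℝ → ℝ} {κ u₀ : ℝ → ℝ} {u : ℝ → ℝ → ℝ}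
    (H : VeryWeakSol m f κ τ u₀ u) (hτ : 0 ≤ τ) {e : ℝ → ℝ} (he : ContDiff ℝ (⊤ : ℕ∞) e)
    (hes : HasCompactSupport e) :
    ∫ x, u x τ * e x = (∫ x, u₀ x * e x)
      + (∫ t in 0..τ, ∫ x, f x (u x t) * (κ x - u x t) * e x)
      + ∫ t in 0..τ, ∫ x, u x t ^ m * deriv (deriv e) x := by
  let χ : ContDiffBump (0 : ℝ) := ⟨τ + 1, τ + 2, by linarith, by linarith⟩
  have hχ : ∀ t, |t| ≤ τ + 1 → χ t = 1 := fun t ht => χ.one_of_mem_closedBall (by simpa using ht)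
  have h := H.2.2 (fun x t => e x * χ t)
    ((he.comp contDiff_fst).mul (χ.contDiff.comp contDiff_snd))
    (by
      refine HasCompactSupport.intro (hes.isCompact.prod χ.hasCompactSupport.isCompact) ?_
      rintro ⟨x, t⟩ hxt
      simp only [Function.uncurry_apply_pair]
      by_contra hne
      rw [mul_eq_zero, not_or] at hne
      exact hxt ⟨by_contra fun h => hne.1 (image_eq_zero_of_notMem_tsupport h),
        by_contra fun h => hne.2 (image_eq_zero_of_notMem_tsupport h)⟩)
  have hχd : ∀ t ∈ Ioo 0 τ, deriv χ t = 0 := fun t ht => by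
    have : χ =ᶠ[𝓝 t] fun _ => (1 : ℝ) := by
      filter_upwards [Ioo_mem_nhds ht.1 ht.2] with s hs
      exact hχ s (abs_le.2 ⟨by linarith [hs.1], by linarith [hs.2]⟩)
    rw [this.deriv_eq, deriv_const]
  rw [intervalIntegral.integral_of_le hτ, intervalIntegral.integral_of_le hτ,
    integral_Ioc_eq_integral_Ioo, integral_Ioc_eq_integral_Ioo]
  rw [hχ τ (abs_le.2 ⟨by linarith, by linarith⟩), hχ 0 (by simp; linarith)] at h
  simp only [mul_one] at h
  rw [h]
  congr 1
  · congr 1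
    refine setIntegral_congr_fun measurableSet_Ioo fun t ht => ?_
    simp only [hχ t (abs_le.2 ⟨by linarith [ht.1], by linarith [ht.2]⟩), mul_one]
  · refine setIntegral_congr_fun measurableSet_Ioo fun t ht => ?_
    have h1 : χ t = 1 := hχ t (abs_le.2 ⟨by linarith [ht.1], by linarith [ht.2]⟩)
    simp only [h1, mul_one, deriv_const_mul_field', hχd t ht, mul_zero, zero_add]

/-- A continuously vanishing reaction term with the Lipschitz bounds used in comparisons. -/
structure Reac (R : ℝ → ℝ → ℝ) : Prop where
  cont : Continuous (Function.uncurry R)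
  zero : ∀ x, R x 0 = 0
  lip : ∀ B M : ℝ, ∃ L, 0 ≤ L ∧
    (∀ x ∈ Icc (-B) B, ∀ a ∈ Icc 0 M, ∀ b ∈ Icc 0 M, |R x a - R x b| ≤ L * |a - b|) ∧
    ∀ x ∈ Icc (-B) B, ∀ x' ∈ Icc (-B) B, ∀ a ∈ Icc 0 M, |R x a - R x' a| ≤ L * |x - x'| * a

theorem ContDiff.exists_lipschitz_of_isCompact {E : Type*} [NormedAddCommGroup E] [NormedSpace ℝ E]
    {P : E → ℝ} (hP : ContDiff ℝ 1 P) {K : Set E} (hK : IsCompact K) (hc : Convex ℝ K) :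
    ∃ C, 0 ≤ C ∧ ∀ p ∈ K, ∀ q ∈ K, |P p - P q| ≤ C * ‖p - q‖ := by
  obtain ⟨C, hC⟩ := hK.exists_bound_of_continuousOn (f := fderiv ℝ P)
    (hP.continuous_fderiv one_ne_zero).continuousOn
  refine ⟨max C 0, le_max_right _ _, fun p hp q hq => ?_⟩
  exact hc.norm_image_sub_le_of_norm_fderiv_le
    (fun x _ => (hP.differentiable one_ne_zero).differentiableAt)
    (fun x hx => (hC x hx).trans (le_max_left _ _)) hq hp

theorem reac_of_contDiff {R : ℝ → ℝ → ℝ} (hR : ContDiff ℝ 2 (Function.uncurry R))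
    (h0 : ∀ x, R x 0 = 0) : Reac R := by
  refine ⟨hR.continuous, h0, fun B M => ?_⟩
  have hK : IsCompact (Icc (-B) B ×ˢ Icc 0 M) := isCompact_Icc.prod isCompact_Icc
  have hKc : Convex ℝ (Icc (-B) B ×ˢ Icc 0 M) := (convex_Icc _ _).prod (convex_Icc _ _)
  obtain ⟨C, hC0, hC⟩ := (hR.of_le one_le_two).exists_lipschitz_of_isCompact hK hKc
  set P : ℝ × ℝ → ℝ := fun q => fderiv ℝ (Function.uncurry R) q (1, 0) with hPdef
  have hP : ContDiff ℝ 1 P :=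
    (hR.fderiv_right (m := 1) (by norm_num)).clm_apply contDiff_const
  have hPd : ∀ x a, HasDerivAt (fun y => R y a) (P (x, a)) x := fun x a => by
    have h1 : HasFDerivAt (Function.uncurry R) (fderiv ℝ (Function.uncurry R) (x, a)) (x, a) :=
      ((hR.differentiable two_ne_zero).differentiableAt).hasFDerivAt
    exact h1.comp_hasDerivAt (f := fun y => (y, a)) x ((hasDerivAt_id x).prodMk (hasDerivAt_const x a))
  have hP0 : ∀ x, P (x, 0) = 0 := fun x => by
    have h1 := hPd x 0
    simp only [h0] at h1
    exact h1.unique (hasDerivAt_const x 0)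
  obtain ⟨K, hK0, hK'⟩ := hP.exists_lipschitz_of_isCompact hK hKc
  refine ⟨max C K, hC0.trans (le_max_left _ _), fun x hx a ha b hb => ?_, fun x hx x' hx' a ha => ?_⟩
  · have := hC (x, a) ⟨hx, ha⟩ (x, b) ⟨hx, hb⟩
    simp only [Function.uncurry_apply_pair, Prod.mk_sub_mk, sub_self, Prod.norm_mk, norm_zero,
      Real.norm_eq_abs, abs_nonneg, sup_of_le_right] at this
    exact this.trans (by gcongr; exact le_max_left _ _)
  · have hb : ∀ y ∈ Icc (-B) B, ‖P (y, a)‖ ≤ K * a := fun y hy => by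
      have := hK' (y, a) ⟨hy, ha⟩ (y, 0) ⟨hy, ⟨le_rfl, ha.1.trans ha.2⟩⟩
      simpa only [hP0, sub_zero, Prod.mk_sub_mk, sub_self, Prod.norm_mk, norm_zero,
        Real.norm_eq_abs, abs_of_nonneg ha.1, ha.1, sup_of_le_right] using this
    have := (convex_Icc (-B) B).norm_image_sub_le_of_norm_hasDerivWithin_le
      (fun y _ => (hPd y a).hasDerivWithinAt) hb hx' hx
    rw [Real.norm_eq_abs, Real.norm_eq_abs] at this
    calc _ ≤ _ := this
      _ = K * (|x - x'| * a) := by ring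
      _ ≤ max C K * (|x - x'| * a) := mul_le_mul_of_nonneg_right (le_max_right _ _)
          (mul_nonneg (abs_nonneg _) ha.1)
      _ = _ := by ring

theorem CondF1.reac {f : ℝ → ℝ → ℝ} {κ : ℝ → ℝ} {θ : ℝ} (H : CondF1 f κ θ) :
    Reac fun x a => f x a * (κ x - a) := by
  obtain ⟨hf, hκ, -, -, h0, -⟩ := H
  refine reac_of_contDiff ?_ fun x => by simp [h0]
  exact hf.mul ((hκ.comp contDiff_fst).sub contDiff_snd)

theorem derivWithin_Iic_nonpos {g : ℝ → ℝ} {r : ℝ} (hg : ∀ x < r, g r ≤ g x) :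
    derivWithin g (Iic r) r ≤ 0 := by
  by_cases hd : DifferentiableWithinAt ℝ g (Iic r) r
  · have h1 := (hasDerivWithinAt_iff_tendsto_slope' (s := Iio r) (x := r) (by simp)).1
      (hd.hasDerivWithinAt.mono Iio_subset_Iic_self)
    refine le_of_tendsto h1 (eventually_mem_nhdsWithin.mono fun x hx => ?_)
    rw [slope_def_field]
    exact div_nonpos_of_nonneg_of_nonpos (sub_nonneg.2 (hg x hx)) (sub_nonpos.2 (le_of_lt hx))
  · rw [derivWithin_zero_of_not_differentiableWithinAt hd]

theorem derivWithin_Ici_nonneg {g : ℝ → ℝ} {l : ℝ} (hg : ∀ x, l < x → g l ≤ g x) :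
    0 ≤ derivWithin g (Ici l) l := by
  by_cases hd : DifferentiableWithinAt ℝ g (Ici l) l
  · have h1 := (hasDerivWithinAt_iff_tendsto_slope' (s := Ioi l) (x := l) (by simp)).1
      (hd.hasDerivWithinAt.mono Ioi_subset_Ici_self)
    refine ge_of_tendsto h1 (eventually_mem_nhdsWithin.mono fun x hx => ?_)
    rw [slope_def_field]
    exact div_nonneg (sub_nonneg.2 (hg x hx)) (sub_nonneg.2 (le_of_lt hx))
  · rw [derivWithin_zero_of_not_differentiableWithinAt hd]

/-- The averaged integral form of the equation on `[t₁, T]`. -/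
def IdSol (m : ℝ) (R u : ℝ → ℝ → ℝ) (t₁ T : ℝ) : Prop :=
  ∀ x h, 0 < h → ∀ τ ∈ Icc t₁ T,
    hatAvg (fun y => u y τ) x h = hatAvg (fun y => u y t₁) x h + ∫ t in t₁..τ,
      (sd (fun y => u y t ^ m) x h + hatAvg (fun y => R y (u y t)) x h)

/-- A function frozen in time outside `[t₁, T]`. -/
def clampT (t₁ T : ℝ) (u : ℝ → ℝ → ℝ) (x t : ℝ) : ℝ := u x (max t₁ (min t T))

theorem clampT_of_mem {t₁ T t : ℝ} (ht : t ∈ Icc t₁ T) (u : ℝ → ℝ → ℝ) (x : ℝ) :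
    clampT t₁ T u x t = u x t := by
  rw [clampT, min_eq_left ht.2, max_eq_right ht.1]

theorem continuous_clampT {t₁ T t₂ : ℝ} (h : t₁ ≤ T) (hT : T < t₂) {u : ℝ → ℝ → ℝ}
    (hu : ContinuousOn (fun q : ℝ × ℝ => u q.1 q.2) (univ ×ˢ Ico t₁ t₂)) :
    Continuous (Function.uncurry (clampT t₁ T u)) :=
  hu.comp_continuous (f := fun q : ℝ × ℝ => (q.1, max t₁ (min q.2 T))) (by fun_prop) fun q =>
    ⟨trivial, le_max_left _ _, (max_le h (min_le_right _ _)).trans_lt hT⟩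

theorem idSol_clampT {m t₁ T : ℝ} (hm : 0 ≤ m) {f u : ℝ → ℝ → ℝ} {κ : ℝ → ℝ}
    (hR : Continuous (Function.uncurry fun x a => f x a * (κ x - a)))
    (hu : Continuous (Function.uncurry (clampT t₁ T u)))
    (H : ∀ τ ∈ Ioc t₁ T, VeryWeakSol m f κ (τ - t₁) (fun x => u x t₁) fun x t => u x (t + t₁)) :
    IdSol m (fun x a => f x a * (κ x - a)) (clampT t₁ T u) t₁ T := by
  intro x h hh τ hτ
  rcases hτ.1.eq_or_lt with rfl | h1
  · simp
  refine avg_identity hm hR hu (fun e he hes => ?_) x hh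
  have key := (H τ ⟨h1, hτ.2⟩).test (by linarith) he hes
  simp only [sub_add_cancel] at key
  have e1 := intervalIntegral.integral_comp_add_right (a := 0) (b := τ - t₁)
    (fun t => ∫ x, f x (u x t) * (κ x - u x t) * e x) t₁
  have e2 := intervalIntegral.integral_comp_add_right (a := 0) (b := τ - t₁)
    (fun t => ∫ x, u x t ^ m * deriv (deriv e) x) t₁
  rw [e1, e2, zero_add, sub_add_cancel] at key
  have hc : ∀ t ∈ uIcc t₁ τ, ∀ x, clampT t₁ T u x t = u x t := fun t ht x => by
    rw [uIcc_of_le hτ.1] at ht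
    exact clampT_of_mem ⟨ht.1, ht.2.trans hτ.2⟩ u x
  have i1 : ∫ t in t₁..τ, ∫ x, f x (clampT t₁ T u x t) * (κ x - clampT t₁ T u x t) * e x =
      ∫ t in t₁..τ, ∫ x, f x (u x t) * (κ x - u x t) * e x :=
    intervalIntegral.integral_congr fun t ht => by simp only [hc t ht]
  have i2 : ∫ t in t₁..τ, ∫ x, clampT t₁ T u x t ^ m * deriv (deriv e) x =
      ∫ t in t₁..τ, ∫ x, u x t ^ m * deriv (deriv e) x :=
    intervalIntegral.integral_congr fun t ht => by simp only [hc t ht]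
  rw [i1, i2]
  simp only [hc τ right_mem_uIcc, hc t₁ left_mem_uIcc]
  exact key

/-- A solution supported on a left half line together with a compactly supported one. -/
structure Sys (m : ℝ) (R u₁ u₃ : ℝ → ℝ → ℝ) (r₁ l₃ r₃ : ℝ → ℝ) (t₁ T : ℝ) : Prop where
  one_lt : 1 < m
  reac : Reac R
  cont₁ : Continuous (Function.uncurry u₁)
  cont₃ : Continuous (Function.uncurry u₃)
  contr₁ : ContinuousOn r₁ (Icc t₁ T)
  contl₃ : ContinuousOn l₃ (Icc t₁ T)
  contr₃ : ContinuousOn r₃ (Icc t₁ T)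
  pos₁ : ∀ t ∈ Icc t₁ T, ∀ x < r₁ t, 0 < u₁ x t
  zero₁ : ∀ t ∈ Icc t₁ T, ∀ x, r₁ t ≤ x → u₁ x t = 0
  pos₃ : ∀ t ∈ Icc t₁ T, ∀ x ∈ Ioo (l₃ t) (r₃ t), 0 < u₃ x t
  zero₃l : ∀ t ∈ Icc t₁ T, ∀ x ≤ l₃ t, u₃ x t = 0
  zero₃r : ∀ t ∈ Icc t₁ T, ∀ x, r₃ t ≤ x → u₃ x t = 0
  lt₃ : ∀ t ∈ Icc t₁ T, l₃ t < r₃ t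
  mono₁ : MonotoneOn r₁ (Icc t₁ T)
  antil₃ : AntitoneOn l₃ (Icc t₁ T)
  mono₃ : MonotoneOn r₃ (Icc t₁ T)
  id₁ : IdSol m R u₁ t₁ T
  id₃ : IdSol m R u₃ t₁ T

theorem continuousOn_pressureDensity {m : ℝ} (hm : 1 < m) {v : ℝ → ℝ → ℝ} {S : Set (ℝ × ℝ)}
    (hv : ContinuousOn (fun q : ℝ × ℝ => v q.1 q.2) S) :
    ContinuousOn (fun q : ℝ × ℝ => PressureDensity m v q.1 q.2) S := by
  have : 0 ≤ 1 / (m - 1) := by have : 0 < m - 1 := by linarith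
                               positivity
  exact ((hv.const_mul _).div_const _).rpow_const fun q _ => Or.inr this

theorem pressureDensity_lt_iff {m : ℝ} (hm : 1 < m) {v w : ℝ → ℝ → ℝ} {x t : ℝ} (hv : 0 ≤ v x t)
    (hw : 0 ≤ w x t) : PressureDensity m v x t < PressureDensity m w x t ↔ v x t < w x t := by
  have h1 : 0 < m - 1 := by linarith
  have h2 : 0 < m := by linarith
  unfold PressureDensity
  rw [Real.rpow_lt_rpow_iff (by positivity) (by positivity) (by positivity),
    div_lt_div_iff_of_pos_right h2, mul_lt_mul_iff_of_pos_left h1]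

theorem pressureDensity_pos {m : ℝ} (hm : 1 < m) {v : ℝ → ℝ → ℝ} {x t : ℝ} (hv : 0 < v x t) :
    0 < PressureDensity m v x t := by
  have h1 : 0 < m - 1 := by linarith
  unfold PressureDensity
  positivity

theorem pressureDensity_eq_zero {m : ℝ} (hm : 1 < m) {v : ℝ → ℝ → ℝ} {x t : ℝ} (hv : v x t = 0) :
    PressureDensity m v x t = 0 := by
  have h1 : 0 < m - 1 := by linarith
  unfold PressureDensity
  rw [hv, mul_zero, zero_div, Real.zero_rpow (by positivity)]

theorem monotoneOn_Icc_of_darcy {r D : ℝ → ℝ} {t₁ t₂ T : ℝ} (hT : T < t₂)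
    (hc : ContinuousOn r (Ico t₁ t₂))
    (hd : ∀ t ∈ Ioo t₁ t₂, DifferentiableAt ℝ r t ∧ deriv r t = -D t) (hD : ∀ t ∈ Ioo t₁ t₂, D t ≤ 0) :
    MonotoneOn r (Icc t₁ T) := by
  refine monotoneOn_of_deriv_nonneg (convex_Icc _ _) (hc.mono (Icc_subset_Ico_right hT))
    (fun t ht => ?_) fun t ht => ?_
  all_goals
    rw [interior_Icc] at ht
    have ht' : t ∈ Ioo t₁ t₂ := ⟨ht.1, ht.2.trans hT⟩
  · exact (hd t ht').1.differentiableWithinAt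
  · rw [(hd t ht').2]; linarith [hD t ht']

theorem sys_of_pressureSol {m : ℝ} (hm : 1 < m) {f : ℝ → ℝ → ℝ} {κ : ℝ → ℝ} {θ : ℝ}
    (hF : CondF1 f κ θ) {t₁ t₂ T : ℝ} (ht : t₁ ≤ T) (hT : T < t₂) {v₁ v₃ : ℝ → ℝ → ℝ}
    {r₁ l₃ r₃ : ℝ → ℝ} (h₁ : PressureSolLeftInf m f κ t₁ t₂ v₁ r₁)
    (h₃ : PressureSolBdd m f κ t₁ t₂ v₃ l₃ r₃) :
    Sys m (fun x a => f x a * (κ x - a)) (clampT t₁ T (PressureDensity m v₁))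
      (clampT t₁ T (PressureDensity m v₃)) r₁ l₃ r₃ t₁ T := by
  obtain ⟨hv₁, hr₁, -, hs₁, -, hw₁, hD₁⟩ := h₁
  obtain ⟨hv₃, hl₃, hr₃, -, hlr, hs₃, -, hw₃, hD₃⟩ := h₃
  have hsub : Icc t₁ T ⊆ Ico t₁ t₂ := Icc_subset_Ico_right hT
  have hc₁ := continuous_clampT ht hT (continuousOn_pressureDensity hm hv₁)
  have hc₃ := continuous_clampT ht hT (continuousOn_pressureDensity hm hv₃)
  have hm0 : 0 ≤ m := by linarith
  have nn₃ : ∀ t ∈ Ioo t₁ t₂, ∀ x, 0 ≤ v₃ x t := fun t ht x => by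
    obtain ⟨a, b, c⟩ := hs₃ t (Ioo_subset_Ico_self ht) x
    rcases le_or_gt x (l₃ t) with h | h
    · rw [b h]
    · rcases le_or_gt (r₃ t) x with h' | h'
      · rw [c h']
      · exact (a h h').le
  have hmul := monotoneOn_Icc_of_darcy (r := fun t => -l₃ t)
    (D := fun t => -derivWithin (fun y => v₃ y t) (Ici (l₃ t)) (l₃ t)) hT hl₃.neg
    (fun t ht => by
      refine ⟨(hD₃ t ht).1.neg, ?_⟩
      rw [deriv.fun_neg, (hD₃ t ht).2.2.1])
    (fun t ht => neg_nonpos.2 <| derivWithin_Ici_nonneg fun x _ => by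
      rw [(hs₃ t (Ioo_subset_Ico_self ht) (l₃ t)).2.1 le_rfl]
      exact nn₃ t ht x)
  exact
  { one_lt := hm
    reac := hF.reac
    cont₁ := hc₁
    cont₃ := hc₃
    contr₁ := hr₁.mono hsub
    contl₃ := hl₃.mono hsub
    contr₃ := hr₃.mono hsub
    pos₁ := fun t ht x hx => by
      rw [clampT_of_mem ht]
      exact pressureDensity_pos hm ((hs₁ t (hsub ht) x).1 hx)
    zero₁ := fun t ht x hx => by
      rw [clampT_of_mem ht]
      exact pressureDensity_eq_zero hm ((hs₁ t (hsub ht) x).2 hx)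
    pos₃ := fun t ht x hx => by
      rw [clampT_of_mem ht]
      exact pressureDensity_pos hm ((hs₃ t (hsub ht) x).1 hx.1 hx.2)
    zero₃l := fun t ht x hx => by
      rw [clampT_of_mem ht]
      exact pressureDensity_eq_zero hm ((hs₃ t (hsub ht) x).2.1 hx)
    zero₃r := fun t ht x hx => by
      rw [clampT_of_mem ht]
      exact pressureDensity_eq_zero hm ((hs₃ t (hsub ht) x).2.2 hx)
    lt₃ := fun t ht => hlr t (hsub ht)
    mono₁ := monotoneOn_Icc_of_darcy hT hr₁ hD₁ fun t ht => derivWithin_Iic_nonpos fun x hx => by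
      rw [(hs₁ t (Ioo_subset_Ico_self ht) (r₁ t)).2 le_rfl]
      exact ((hs₁ t (Ioo_subset_Ico_self ht) x).1 hx).le
    antil₃ := fun a ha b hb hab => neg_le_neg_iff.1 (hmul ha hb hab)
    mono₃ := monotoneOn_Icc_of_darcy hT hr₃ (fun t ht => ⟨(hD₃ t ht).2.1, (hD₃ t ht).2.2.2⟩)
      fun t ht => derivWithin_Iic_nonpos fun x hx => by
        rw [(hs₃ t (Ioo_subset_Ico_self ht) (r₃ t)).2.2 le_rfl]
        exact nn₃ t ht x
    id₁ := idSol_clampT hm0 hF.reac.cont hc₁ fun τ hτ => hw₁ τ ⟨hτ.1, hτ.2.trans_lt hT⟩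
    id₃ := idSol_clampT hm0 hF.reac.cont hc₃ fun τ hτ => hw₃ τ ⟨hτ.1, hτ.2.trans_lt hT⟩ }

theorem exists_upper_bound_Icc {u : ℝ → ℝ → ℝ} (hu : Continuous (Function.uncurry u))
    (c d t₀ T : ℝ) : ∃ M, 0 ≤ M ∧ ∀ x ∈ Icc c d, ∀ t ∈ Icc t₀ T, u x t ≤ M := by
  obtain ⟨M, hM⟩ := (isCompact_Icc.prod isCompact_Icc).exists_bound_of_continuousOn
    (s := Icc c d ×ˢ Icc t₀ T) hu.continuousOn
  exact ⟨max M 0, le_max_right _ _, fun x hx t ht =>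
    (le_abs_self _).trans ((hM (x, t) ⟨hx, ht⟩).trans (le_max_left _ _))⟩

theorem Icc_subset_Icc_abs (c d : ℝ) : Icc c d ⊆ Icc (-(max |c| |d|)) (max |c| |d|) :=
  Icc_subset_Icc (by linarith [neg_abs_le c, le_max_left |c| |d|])
    ((le_abs_self d).trans (le_max_right _ _))

theorem Reac.exists_compData {m : ℝ} (hm : 1 < m) {R u z : ℝ → ℝ → ℝ} (hR : Reac R)
    {c d t₀ T : ℝ} (hcd : c < d) (ht : t₀ < T) (hu : Continuous (Function.uncurry u))
    (hz : Continuous (Function.uncurry z)) (hu0 : ∀ x ∈ Icc c d, ∀ t ∈ Icc t₀ T, 0 ≤ u x t)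
    (hz0 : ∀ x ∈ Icc c d, ∀ t ∈ Icc t₀ T, 0 ≤ z x t) :
    ∃ M L, CompData m M L R u z c d t₀ T := by
  obtain ⟨M₁, -, h₁⟩ := exists_upper_bound_Icc hu c d t₀ T
  obtain ⟨M₂, -, h₂⟩ := exists_upper_bound_Icc hz c d t₀ T
  obtain ⟨L, hL, hl, -⟩ := hR.lip (max |c| |d|) (max M₁ M₂)
  exact ⟨max M₁ M₂, L, hm, hL, hcd, ht, hR.cont, hu, hz,
    fun x hx t ht => ⟨hu0 x hx t ht, (h₁ x hx t ht).trans (le_max_left _ _)⟩,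
    fun x hx t ht => ⟨hz0 x hx t ht, (h₂ x hx t ht).trans (le_max_right _ _)⟩,
    fun x hx => hl x (Icc_subset_Icc_abs c d hx)⟩

theorem Reac.comparison {m : ℝ} (hm : 1 < m) {R u z : ℝ → ℝ → ℝ} (hR : Reac R)
    {c d t₀ T : ℝ} (hcd : c < d) (ht : t₀ ≤ T) (hu : Continuous (Function.uncurry u))
    (hz : Continuous (Function.uncurry z)) (hu0 : ∀ x ∈ Icc c d, ∀ t ∈ Icc t₀ T, 0 ≤ u x t)
    (hz0 : ∀ x ∈ Icc c d, ∀ t ∈ Icc t₀ T, 0 ≤ z x t) (hus : AvgSol 1 m R u c d t₀ T)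
    (hzs : AvgSol (-1) m R z c d t₀ T) (h0 : ∀ x ∈ Icc c d, u x t₀ ≤ z x t₀)
    (hc : ∀ t ∈ Icc t₀ T, u c t ≤ z c t) (hd : ∀ t ∈ Icc t₀ T, u d t ≤ z d t) :
    ∀ x ∈ Icc c d, u x T ≤ z x T := by
  rcases ht.eq_or_lt with rfl | ht
  · exact h0
  obtain ⟨M, L, D⟩ := hR.exists_compData hm hcd ht hu hz hu0 hz0
  exact D.comparison hus hzs h0 hc hd

theorem IdSol.avgSol {m : ℝ} (hm : 0 ≤ m) {R u : ℝ → ℝ → ℝ} (hR : Continuous (Function.uncurry R))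
    (hu : Continuous (Function.uncurry u)) {t₁ T : ℝ} (H : IdSol m R u t₁ T) {σ : ℝ} (hσ : |σ| ≤ 1)
    {c d t₀ t : ℝ} (ht₀ : t₁ ≤ t₀) (ht : t ≤ T) : AvgSol σ m R u c d t₀ t :=
  (avgSol_of_identity hσ hm hR hu H).mono le_rfl le_rfl ht₀ ht

theorem IdSol.hasDerivWithinAt {m : ℝ} (hm : 0 ≤ m) {R u : ℝ → ℝ → ℝ}
    (hR : Continuous (Function.uncurry R)) (hu : Continuous (Function.uncurry u)) {t₁ T : ℝ}
    (H : IdSol m R u t₁ T) (x : ℝ) {h : ℝ} (hh : 0 < h) {s : ℝ} (hs : s ∈ Ico t₁ T) :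
    HasDerivWithinAt (fun t => hatAvg (fun y => u y t) x h)
      (sd (fun y => u y s ^ m) x h + hatAvg (fun y => R y (u y s)) x h) (Ici s) s := by
  have hc : Continuous fun t => sd (fun y => u y t ^ m) x h + hatAvg (fun y => R y (u y t)) x h :=
    (continuous_sd hu hm x h).add (continuous_hatAvg (continuous_reac hR hu) x h)
  have h1 := ((intervalIntegral.integral_hasDerivAt_right (hc.intervalIntegrable t₁ s)
    (hc.stronglyMeasurableAtFilter _ _) hc.continuousAt).const_add
    (hatAvg (fun y => u y t₁) x h)).hasDerivWithinAt (s := Ici s)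
  refine h1.congr_of_eventuallyEq ?_ (H x h hh s ⟨hs.1, hs.2.le⟩)
  filter_upwards [Icc_mem_nhdsGE hs.2] with t ht
  exact H x h hh t ⟨hs.1.trans ht.1, ht.2⟩

theorem avgSol_of_hasDerivWithinAt {σ m : ℝ} {R u : ℝ → ℝ → ℝ} {c d t₀ T : ℝ}
    (H : ∀ x h, 0 < h → c ≤ x - h → x + h ≤ d → ∀ s ∈ Ico t₀ T, ∃ D,
      HasDerivWithinAt (fun t => hatAvg (fun y => u y t) x h) D (Ici s) s ∧
      σ * D ≤ σ * (sd (fun y => u y s ^ m) x h + hatAvg (fun y => R y (u y s)) x h)) :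
    AvgSol σ m R u c d t₀ T := by
  intro x h hh hc hd s hs ε hε
  obtain ⟨D, hD, hle⟩ := H x h hh hc hd s hs
  have h1 := (hasDerivWithinAt_iff_tendsto_slope' (s := Ioi s) (x := s) (by simp)).1
    ((hD.const_mul σ).mono Ioi_subset_Ici_self)
  filter_upwards [h1.eventually (gt_mem_nhds (show σ * D < σ * D + ε by linarith)),
    self_mem_nhdsWithin] with t h2 ht
  rw [mem_Ioi] at ht
  rw [slope_def_field, div_lt_iff₀ (sub_pos.2 ht)] at h2
  rw [mul_sub]
  nlinarith [sub_pos.2 ht]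

/-- The exponential perturbation of the time speed. -/
def growY (θ γ s₀ t : ℝ) : ℝ := θ * Real.exp (γ * (t - s₀))

/-- The perturbed time. -/
def warp (θ γ s₀ t : ℝ) : ℝ := t + θ / γ * (Real.exp (γ * (t - s₀)) - 1)

/-- The amplitude matching the perturbed time. -/
def ampl (m θ γ s₀ t : ℝ) : ℝ := (1 + growY θ γ s₀ t) ^ (1 / (m - 1))

/-- The solution `u` rescaled, translated and run with the perturbed time. -/
def rescaled (m θ γ s₀ ξ : ℝ) (u : ℝ → ℝ → ℝ) (x t : ℝ) : ℝ :=
  ampl m θ γ s₀ t * u (x - ξ) (warp θ γ s₀ t)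

theorem growY_pos {θ : ℝ} (hθ : 0 < θ) (γ s₀ t : ℝ) : 0 < growY θ γ s₀ t :=
  mul_pos hθ (Real.exp_pos _)

theorem hasDerivAt_growY (θ γ s₀ t : ℝ) :
    HasDerivAt (growY θ γ s₀) (γ * growY θ γ s₀ t) t := by
  have := ((((hasDerivAt_id t).sub_const s₀).const_mul γ).exp).const_mul θ
  refine this.congr_deriv ?_
  simp only [growY, id]; ring

theorem hasDerivAt_warp {γ : ℝ} (hγ : γ ≠ 0) (θ s₀ t : ℝ) :
    HasDerivAt (warp θ γ s₀) (1 + growY θ γ s₀ t) t := by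
  have := (hasDerivAt_id t).add
    (((((hasDerivAt_id t).sub_const s₀).const_mul γ).exp.sub_const 1).const_mul (θ / γ))
  refine this.congr_deriv ?_
  simp only [growY, id]; field_simp

theorem warp_self (θ γ s₀ : ℝ) : warp θ γ s₀ s₀ = s₀ := by simp [warp]

theorem strictMono_warp {θ γ : ℝ} (hθ : 0 < θ) (hγ : γ ≠ 0) (s₀ : ℝ) :
    StrictMono (warp θ γ s₀) :=
  strictMono_of_hasDerivAt_pos (hasDerivAt_warp hγ θ s₀) fun t => by
    linarith [growY_pos hθ γ s₀ t]

theorem hasDerivAt_ampl (m : ℝ) {θ : ℝ} (hθ : 0 < θ) (γ s₀ t : ℝ) :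
    HasDerivAt (ampl m θ γ s₀)
      (γ * growY θ γ s₀ t * (1 / (m - 1)) * ampl m θ γ s₀ t / (1 + growY θ γ s₀ t)) t := by
  have h0 := growY_pos hθ γ s₀ t
  have := ((hasDerivAt_growY θ γ s₀ t).const_add 1).rpow_const (p := 1 / (m - 1))
    (Or.inl (by linarith))
  refine this.congr_deriv ?_
  rw [ampl, Real.rpow_sub_one (by linarith)]
  ring

theorem one_le_ampl {m : ℝ} (hm : 1 < m) {θ : ℝ} (hθ : 0 < θ) (γ s₀ t : ℝ) :
    1 ≤ ampl m θ γ s₀ t :=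
  Real.one_le_rpow (by linarith [growY_pos hθ γ s₀ t])
    (one_div_nonneg.2 (by linarith))

theorem ampl_rpow {m : ℝ} (hm : 1 < m) {θ : ℝ} (hθ : 0 < θ) (γ s₀ t : ℝ) :
    ampl m θ γ s₀ t ^ m = ampl m θ γ s₀ t * (1 + growY θ γ s₀ t) := by
  have h1 := one_le_ampl hm hθ γ s₀ t
  have h0 := growY_pos hθ γ s₀ t
  have h2 : ampl m θ γ s₀ t ^ (m - 1) = 1 + growY θ γ s₀ t := by
    rw [ampl, ← Real.rpow_mul (by linarith), one_div_mul_cancel (by linarith), Real.rpow_one]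
  rw [← h2, mul_comm, ← Real.rpow_add_one (by linarith), sub_add_cancel]

theorem ampl_le {m : ℝ} (hm : 1 < m) {θ γ s₀ t : ℝ} (hθ : 0 < θ) (hy : growY θ γ s₀ t ≤ 1) :
    ampl m θ γ s₀ t ≤ 1 + 1 / (m - 1) * Real.exp (1 / (m - 1)) * growY θ γ s₀ t := by
  set y := growY θ γ s₀ t with hyd
  have h0 : 0 < y := growY_pos hθ γ s₀ t
  set p := 1 / (m - 1) with hp
  have hp0 : 0 < p := one_div_pos.2 (by linarith)
  have h1 : ampl m θ γ s₀ t ≤ Real.exp (p * y) := by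
    rw [ampl, ← hyd, ← hp, mul_comm p, Real.exp_mul]
    exact Real.rpow_le_rpow (by linarith) (by linarith [Real.add_one_le_exp y]) hp0.le
  have h2 : 1 - p * y ≤ Real.exp (-(p * y)) := by linarith [Real.add_one_le_exp (-(p * y))]
  have h3 : Real.exp (p * y) * Real.exp (-(p * y)) = 1 := by rw [← Real.exp_add]; simp
  have h4 : Real.exp (p * y) ≤ Real.exp p := Real.exp_le_exp.2 (by nlinarith)
  have h5 := Real.exp_pos (p * y)
  have h6 : Real.exp (p * y) * (1 - p * y) ≤ 1 :=
    (mul_le_mul_of_nonneg_left h2 h5.le).trans h3.le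
  have h7 : p * y * Real.exp (p * y) ≤ p * y * Real.exp p :=
    mul_le_mul_of_nonneg_left h4 (by positivity)
  nlinarith

theorem hatAvg_comp_sub (g : ℝ → ℝ) (ξ x h : ℝ) :
    hatAvg (fun y => g (y - ξ)) x h = hatAvg g (x - ξ) h := by
  unfold hatAvg
  refine intervalIntegral.integral_congr fun s _ => ?_
  simp only
  rw [show x + h * s - ξ = x - ξ + h * s by ring]

theorem sd_comp_sub (g : ℝ → ℝ) (ξ x h : ℝ) :
    sd (fun y => g (y - ξ)) x h = sd g (x - ξ) h := by
  simp only [sd]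
  rw [show x + h - ξ = x - ξ + h by ring, show x - h - ξ = x - ξ - h by ring]

theorem sd_const_mul (a : ℝ) (g : ℝ → ℝ) (x h : ℝ) :
    sd (fun y => a * g y) x h = a * sd g x h := by
  unfold sd; ring

theorem continuous_rescaled (m : ℝ) {θ : ℝ} (hθ : 0 < θ) {γ : ℝ} (hγ : γ ≠ 0)
    (s₀ ξ : ℝ) {u : ℝ → ℝ → ℝ} (hu : Continuous (Function.uncurry u)) :
    Continuous (Function.uncurry (rescaled m θ γ s₀ ξ u)) := by
  have h1 : Continuous (ampl m θ γ s₀) :=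
    continuous_iff_continuousAt.2 fun t => (hasDerivAt_ampl m hθ γ s₀ t).continuousAt
  have h2 : Continuous (warp θ γ s₀) :=
    continuous_iff_continuousAt.2 fun t => (hasDerivAt_warp hγ θ s₀ t).continuousAt
  exact (h1.comp continuous_snd).mul (hu.comp (f := fun q : ℝ × ℝ => (q.1 - ξ, warp θ γ s₀ q.2))
    ((continuous_fst.sub continuous_const).prodMk (h2.comp continuous_snd)))

/-- The rescaled function is a sub- or supersolution as soon as a pointwise inequality holds. -/
theorem avgSol_rescaled {σ m : ℝ} (hm : 1 < m) {R u : ℝ → ℝ → ℝ}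
    (hR : Continuous (Function.uncurry R)) (hu : Continuous (Function.uncurry u)) {t₁ T : ℝ}
    (hid : IdSol m R u t₁ T) (hu0 : ∀ t ∈ Icc t₁ T, ∀ x, 0 ≤ u x t) {θ γ s₀ ξ c d s₁ : ℝ}
    (hθ : 0 < θ) (hγ : γ ≠ 0) (h₀ : t₁ ≤ s₀) (h₁ : warp θ γ s₀ s₁ ≤ T)
    (H : ∀ t ∈ Ico s₀ s₁, ∀ y ∈ Icc c d,
      σ * (γ * growY θ γ s₀ t * (1 / (m - 1)) * ampl m θ γ s₀ t / (1 + growY θ γ s₀ t) *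
        u (y - ξ) (warp θ γ s₀ t) + ampl m θ γ s₀ t * (1 + growY θ γ s₀ t) *
          R (y - ξ) (u (y - ξ) (warp θ γ s₀ t))) ≤
      σ * R y (ampl m θ γ s₀ t * u (y - ξ) (warp θ γ s₀ t))) :
    AvgSol σ m R (rescaled m θ γ s₀ ξ u) c d s₀ s₁ := by
  have hm0 : 0 ≤ m := by linarith
  have hmono := strictMono_warp hθ hγ s₀
  refine avgSol_of_hasDerivWithinAt fun x h hh hc hd s hs => ?_
  have hw : warp θ γ s₀ s ∈ Ico t₁ T :=
    ⟨h₀.trans ((warp_self θ γ s₀).symm.le.trans (hmono.monotone hs.1)), (hmono hs.2).trans_le h₁⟩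
  have d1 := hid.hasDerivWithinAt hm0 hR hu (x - ξ) hh hw
  have d2 := HasDerivWithinAt.comp s d1 (hasDerivAt_warp hγ θ s₀ s).hasDerivWithinAt
    (fun t (ht : s ≤ t) => hmono.monotone ht)
  have d3 := (hasDerivAt_ampl m hθ γ s₀ s).hasDerivWithinAt (s := Ici s) |>.mul d2
  have e1 : (fun t => hatAvg (fun y => rescaled m θ γ s₀ ξ u y t) x h) = fun t =>
      ampl m θ γ s₀ t * hatAvg (fun y => u y (warp θ γ s₀ t)) (x - ξ) h := by
    ext t
    simp only [rescaled]
    rw [hatAvg_const_mul, hatAvg_comp_sub (fun y => u y (warp θ γ s₀ t))]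
  rw [e1]
  refine ⟨_, d3, ?_⟩
  set A := ampl m θ γ s₀ s
  set w := warp θ γ s₀ s
  set Y := growY θ γ s₀ s
  have hA : A ^ m = A * (1 + Y) := ampl_rpow hm hθ γ s₀ s
  have hA1 : 1 ≤ A := one_le_ampl hm hθ γ s₀ s
  have e2 : (fun y => rescaled m θ γ s₀ ξ u y s ^ m) =
      fun y => A ^ m * (fun y => u y w ^ m) (y - ξ) := by
    ext y
    exact Real.mul_rpow (by linarith) (hu0 w ⟨hw.1, hw.2.le⟩ _)
  rw [e2, sd_const_mul, sd_comp_sub (fun y => u y w ^ m), hA, mul_add]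
  have hut : Continuous fun y => u (y - ξ) w := hu.comp (by fun_prop :
    Continuous fun y : ℝ => (y - ξ, w))
  have hRt : Continuous fun y => R (y - ξ) (u (y - ξ) w) := hR.comp (by fun_prop :
    Continuous fun y : ℝ => (y - ξ, u (y - ξ) w))
  have hRz : Continuous fun y => R y (A * u (y - ξ) w) := hR.comp (by fun_prop :
    Continuous fun y : ℝ => (y, A * u (y - ξ) w))
  set Q := γ * Y * (1 / (m - 1)) * A / (1 + Y)
  have key := hatAvg_mono (f := fun y => σ * (Q * u (y - ξ) w + A * (1 + Y) * R (y - ξ) (u (y - ξ) w)))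
    (g := fun y => σ * R y (A * u (y - ξ) w)) (by fun_prop) (by fun_prop) (x := x) hh.le
    (fun y hy => H s hs y ⟨hc.trans hy.1, hy.2.trans hd⟩)
  rw [hatAvg_const_mul, hatAvg_const_mul, hatAvg_add (by fun_prop) (by fun_prop), hatAvg_const_mul,
    hatAvg_const_mul, hatAvg_comp_sub (fun y => u y w), hatAvg_comp_sub (fun y => R y (u y w))] at key
  have e3 : (fun y => R y (rescaled m θ γ s₀ ξ u y s)) = fun y => R y (A * u (y - ξ) w) := rfl
  rw [e3]
  simp only [Function.comp_apply]
  nlinarith [key]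

theorem rescaled_slack {m L a C Y A ξ γ Rz Ra R' R'' : ℝ} (hm : 1 < m) (hL : 0 ≤ L) (ha : 0 ≤ a)
    (hY : 0 < Y) (hY1 : Y ≤ 1) (hA : 1 ≤ A) (hAC : A ≤ 1 + C * Y) (hC : 0 ≤ C) (hξ : |ξ| ≤ Y)
    (h1 : |Rz - R''| ≤ L * |A * a - a|) (h2 : |R'' - Ra| ≤ L * |ξ| * a) (h3 : |Ra| ≤ L * a)
    (hγ : 2 * (m - 1) * (L * (3 * C + 2)) ≤ γ) (hR' : R' = Ra) :
    |Rz - A * (1 + Y) * R'| ≤ γ * Y * (1 / (m - 1)) * A / (1 + Y) * a := by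
  subst hR'
  have hm1 : 0 < m - 1 := by linarith
  have e1 : |A * a - a| = (A - 1) * a := by
    rw [← sub_one_mul, abs_mul, abs_of_nonneg (by linarith), abs_of_nonneg ha]
  rw [e1] at h1
  have e2 : |R' - A * (1 + Y) * R'| ≤ (A * (1 + Y) - 1) * (L * a) := by
    rw [show R' - A * (1 + Y) * R' = -((A * (1 + Y) - 1) * R') by ring, abs_neg, abs_mul,
      abs_of_nonneg (by nlinarith)]
    exact mul_le_mul_of_nonneg_left h3 (by nlinarith)
  have t1 := abs_sub_le Rz R'' (A * (1 + Y) * R')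
  have t2 := abs_sub_le R'' R' (A * (1 + Y) * R')
  have hLa : 0 ≤ L * a := by positivity
  have b1 : L * ((A - 1) * a) ≤ C * Y * (L * a) := by nlinarith
  have b2 : L * |ξ| * a ≤ Y * (L * a) := by nlinarith
  have b3 : A * (1 + Y) - 1 ≤ (2 * C + 1) * Y := by nlinarith [mul_nonneg hC hY.le]
  have b4 : (A * (1 + Y) - 1) * (L * a) ≤ (2 * C + 1) * Y * (L * a) :=
    mul_le_mul_of_nonneg_right b3 hLa
  have b5 : |Rz - A * (1 + Y) * R'| ≤ L * (3 * C + 2) * Y * a := by nlinarith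
  refine b5.trans (mul_le_mul_of_nonneg_right ?_ ha)
  rw [le_div_iff₀ (by linarith)]
  have hg : L * (3 * C + 2) ≤ γ / 2 * (1 / (m - 1)) := by
    rw [mul_one_div, le_div_iff₀ hm1]; linarith
  have h0 : 0 ≤ L * (3 * C + 2) := by positivity
  calc _ ≤ L * (3 * C + 2) * Y * 2 := mul_le_mul_of_nonneg_left (by linarith) (by positivity)
    _ ≤ γ / 2 * (1 / (m - 1)) * Y * 2 := by gcongr
    _ = γ * Y * (1 / (m - 1)) * 1 := by ring
    _ ≤ _ := mul_le_mul_of_nonneg_left hA (by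
      have : 0 ≤ γ / 2 * (1 / (m - 1)) := h0.trans hg
      nlinarith)

/-- Sub- and supersolutions obtained by rescaling and translating. -/
theorem exists_rate_rescaled {m : ℝ} (hm : 1 < m) {R u : ℝ → ℝ → ℝ}
    (hR : Reac R) (hu : Continuous (Function.uncurry u)) {t₁ T : ℝ}
    (hid : IdSol m R u t₁ T) (hu0 : ∀ t ∈ Icc t₁ T, ∀ x, 0 ≤ u x t) (c d : ℝ) :
    ∃ Γ, 0 < Γ ∧ ∀ σ, |σ| = 1 → ∀ θ ξ s₀ s₁, 0 < θ → t₁ ≤ s₀ → warp θ (-(σ * Γ)) s₀ s₁ ≤ T →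
      (∀ t ∈ Ico s₀ s₁, growY θ (-(σ * Γ)) s₀ t ≤ 1 ∧ |ξ| ≤ growY θ (-(σ * Γ)) s₀ t) →
      AvgSol σ m R (rescaled m θ (-(σ * Γ)) s₀ ξ u) c d s₀ s₁ := by
  set C := 1 / (m - 1) * Real.exp (1 / (m - 1)) with hCd
  have hm1 : 0 < m - 1 := by linarith
  have hC : 0 ≤ C := by positivity
  set B := max |c - 1| |d + 1|
  have hB := Icc_subset_Icc_abs (c - 1) (d + 1)
  obtain ⟨M, hM0, hM⟩ := exists_upper_bound_Icc hu (c - 1) (d + 1) t₁ T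
  obtain ⟨L, hL, hl, hl'⟩ := hR.lip B ((1 + C) * M)
  set Γ := 2 * (m - 1) * (L * (3 * C + 2)) + 1 with hΓ
  have hΓ0 : 0 < Γ := by positivity
  refine ⟨Γ, hΓ0, fun σ hσ θ ξ s₀ s₁ hθ hs₀ hs₁ hcond => ?_⟩
  have hσ0 : σ ≠ 0 := fun h => by simp [h] at hσ
  have hγ : -(σ * Γ) ≠ 0 := neg_ne_zero.2 (mul_ne_zero hσ0 hΓ0.ne')
  refine avgSol_rescaled hm hR.cont hu hid hu0 hθ hγ hs₀ hs₁ fun t ht y hy => ?_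
  have hmono := strictMono_warp hθ hγ s₀
  have hw : warp θ (-(σ * Γ)) s₀ t ∈ Icc t₁ T :=
    ⟨hs₀.trans ((warp_self θ (-(σ * Γ)) s₀).symm.le.trans (hmono.monotone ht.1)),
      (hmono ht.2).le.trans hs₁⟩
  obtain ⟨hY1, hξ⟩ := hcond t ht
  have hY := growY_pos hθ (-(σ * Γ)) s₀ t
  have hA := one_le_ampl hm hθ (-(σ * Γ)) s₀ t
  have hAC := ampl_le hm hθ hY1
  rw [← hCd] at hAC
  set Y := growY θ (-(σ * Γ)) s₀ t
  set A := ampl m θ (-(σ * Γ)) s₀ t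
  set w := warp θ (-(σ * Γ)) s₀ t
  have hξ1 := abs_le.1 (hξ.trans hY1)
  have hyξ : y - ξ ∈ Icc (c - 1) (d + 1) := ⟨by linarith [hy.1], by linarith [hy.2]⟩
  have hy' : y ∈ Icc (c - 1) (d + 1) := ⟨by linarith [hy.1], by linarith [hy.2]⟩
  have ha := hu0 w hw (y - ξ)
  have haM := hM _ hyξ w hw
  set a := u (y - ξ) w
  have hAC' : A ≤ 1 + C := hAC.trans (by nlinarith)
  have hAa : A * a ∈ Icc 0 ((1 + C) * M) :=
    ⟨by positivity, mul_le_mul hAC' haM ha (by positivity)⟩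
  have ha' : a ∈ Icc 0 ((1 + C) * M) := ⟨ha, haM.trans (by nlinarith)⟩
  have k1 := hl y (hB hy') _ hAa _ ha'
  have k2 := hl' y (hB hy') (y - ξ) (hB hyξ) a ha'
  rw [sub_sub_cancel] at k2
  have k3 := hl (y - ξ) (hB hyξ) a ha' 0 ⟨le_rfl, by positivity⟩
  rw [hR.zero, sub_zero, sub_zero, abs_of_nonneg ha] at k3
  have key := rescaled_slack hm hL ha hY hY1 hA hAC hC hξ k1 k2 k3 (γ := Γ) (by linarith) rfl
  have hσ2 : σ * σ = 1 := by rw [← abs_mul_abs_self, hσ, one_mul]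
  have e : σ * (-(σ * Γ) * Y * (1 / (m - 1)) * A / (1 + Y) * a + A * (1 + Y) * R (y - ξ) a) =
      -(Γ * Y * (1 / (m - 1)) * A / (1 + Y) * a) * (σ * σ) + σ * (A * (1 + Y) * R (y - ξ) a) := by ring
  rw [e, hσ2, mul_one]
  have h5 := neg_abs_le (σ * (R y (A * a) - A * (1 + Y) * R (y - ξ) a))
  rw [abs_mul, hσ, one_mul] at h5
  linarith

theorem growY_le_of_pos {θ γ : ℝ} (hθ : 0 < θ) (hγ : 0 ≤ γ) {s₀ t T : ℝ} (ht : t ≤ T) :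
    growY θ γ s₀ t ≤ θ * Real.exp (γ * (T - s₀)) := by
  unfold growY
  gcongr

/-- One-sided time regularity of compactly supported solutions. -/
theorem IdSol.time_lower_bound {m : ℝ} (hm : 1 < m) {R u : ℝ → ℝ → ℝ}
    (hR : Reac R) (hu : Continuous (Function.uncurry u)) {t₁ T : ℝ}
    (hid : IdSol m R u t₁ T) (hu0 : ∀ t ∈ Icc t₁ T, ∀ x, 0 ≤ u x t) {B : ℝ}
    (hB : ∀ t ∈ Icc t₁ T, ∀ x, B ≤ |x| → u x t = 0) {η : ℝ} (hη : 0 < η) :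
    ∃ K δ, 0 ≤ K ∧ 0 < δ ∧ ∀ s ∈ Icc (t₁ + η) T, ∀ t ∈ Icc s T, t ≤ s + δ →
      ∀ x, (1 - K * (t - s)) * u x s ≤ u x t := by
  set B' := max B 1 with hB'
  have hB'1 : 1 ≤ B' := le_max_right _ _
  obtain ⟨Γ, hΓ, H⟩ := exists_rate_rescaled hm hR hu hid hu0 (-B') B'
  set E := Real.exp (Γ * (T - t₁)) with hE
  have hE0 : 0 < E := Real.exp_pos _
  set C := 1 / (m - 1) * Real.exp (1 / (m - 1)) with hCd
  have hm1 : 0 < m - 1 := by linarith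
  have hC : 0 ≤ C := by positivity
  refine ⟨C * (E / η), η / E, by positivity, by positivity, fun s hs t ht hts x => ?_⟩
  have hst1 : t₁ ≤ s := by linarith [hs.1]
  have hs' : s ∈ Icc t₁ T := ⟨hst1, hs.2⟩
  have ht' : t ∈ Icc t₁ T := ⟨hst1.trans ht.1, ht.2⟩
  rcases ht.1.eq_or_lt with rfl | hlt
  · simp
  rcases le_or_gt B |x| with hx | hx
  · rw [hB s hs' x hx, hB t ht' x hx, mul_zero]
  have hexp : 0 < Real.exp (Γ * (s - t₁)) - 1 := by
    have := Real.add_one_lt_exp (x := Γ * (s - t₁)) (by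
      have : 0 < s - t₁ := by linarith [hs.1]
      positivity)
    nlinarith [hs.1]
  have hexp' : Γ * η ≤ Real.exp (Γ * (s - t₁)) - 1 := by
    have := Real.add_one_le_exp (Γ * (s - t₁))
    nlinarith [hs.1]
  set θ := (t - s) * Γ / (Real.exp (Γ * (s - t₁)) - 1) with hθd
  have hθ : 0 < θ := div_pos (mul_pos (by linarith) hΓ) hexp
  have hθle : θ ≤ (t - s) / η := by
    rw [hθd, div_le_div_iff₀ hexp hη]
    nlinarith
  have hwarp : warp θ Γ t₁ s = t := by
    unfold warp
    rw [hθd]; field_simp; ring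
  have hY : ∀ τ ≤ s, growY θ Γ t₁ τ ≤ E / η * (t - s) := fun τ hτ =>
    (growY_le_of_pos hθ hΓ.le (hτ.trans hs.2)).trans (by
      calc θ * E ≤ (t - s) / η * E := by gcongr
        _ = _ := by ring)
  have hY1 : ∀ τ ≤ s, growY θ Γ t₁ τ ≤ 1 := fun τ hτ => (hY τ hτ).trans (by
    calc E / η * (t - s) ≤ E / η * (η / E) := by gcongr; linarith
      _ = 1 := by field_simp)
  have e0 : -((-1 : ℝ) * Γ) = Γ := by ring
  have hsuper := H (-1) (by simp) θ 0 t₁ s hθ le_rfl (by rw [e0, hwarp]; exact ht.2)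
    (fun τ hτ => by
      rw [e0, abs_zero]
      exact ⟨hY1 τ hτ.2.le, (growY_pos hθ _ _ _).le⟩)
  rw [e0] at hsuper
  have hmono := strictMono_warp hθ hΓ.ne' t₁
  have hw : ∀ τ ∈ Icc t₁ s, warp θ Γ t₁ τ ∈ Icc t₁ T := fun τ hτ =>
    ⟨(warp_self θ Γ t₁).symm.le.trans (hmono.monotone hτ.1),
      (hmono.monotone hτ.2).trans (hwarp.le.trans ht.2)⟩
  have hz0 : ∀ x, ∀ τ ∈ Icc t₁ s, 0 ≤ rescaled m θ Γ t₁ 0 u x τ := fun x τ hτ =>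
    mul_nonneg (by linarith [one_le_ampl hm hθ Γ t₁ τ]) (hu0 _ (hw τ hτ) _)
  have hsub : ∀ τ ∈ Icc t₁ s, τ ∈ Icc t₁ T := fun τ hτ => ⟨hτ.1, hτ.2.trans hs.2⟩
  have hlat : ∀ x, B ≤ |x| → ∀ τ ∈ Icc t₁ s, u x τ ≤ rescaled m θ Γ t₁ 0 u x τ :=
    fun x hx τ hτ => by rw [hB τ (hsub τ hτ) x hx]; exact hz0 x τ hτ
  have hcomp := hR.comparison hm (by linarith : -B' < B') hst1 hu
    (continuous_rescaled m hθ hΓ.ne' t₁ 0 hu) (fun x _ τ hτ => hu0 τ (hsub τ hτ) x)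
    (fun x _ τ hτ => hz0 x τ hτ)
    (hid.avgSol (by linarith) hR.cont hu (by simp) le_rfl hs.2) hsuper
    (fun x _ => by
      rw [rescaled, warp_self, sub_zero]
      exact le_mul_of_one_le_left (hu0 t₁ ⟨le_rfl, hst1.trans hs.2⟩ x) (one_le_ampl hm hθ Γ t₁ t₁))
    (hlat _ (by rw [abs_neg, abs_of_nonneg (by linarith)]; exact le_max_left _ _))
    (hlat _ (by rw [abs_of_nonneg (by linarith)]; exact le_max_left _ _)) x
    ⟨by linarith [(abs_lt.1 hx).1, le_max_left B 1], by linarith [(abs_lt.1 hx).2, le_max_left B 1]⟩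
  rw [rescaled, hwarp, sub_zero] at hcomp
  have hA := ampl_le hm hθ (hY1 s le_rfl)
  rw [← hCd] at hA
  have hA' : ampl m θ Γ t₁ s ≤ 1 + C * (E / η) * (t - s) := hA.trans (by
    rw [mul_assoc]
    have := mul_le_mul_of_nonneg_left (hY s le_rfl) hC
    linarith)
  have hut := hu0 t ht' x
  have hus := hu0 s hs' x
  set k := C * (E / η) * (t - s) with hk
  have hk0 : 0 ≤ k := by have : 0 ≤ t - s := by linarith
                         positivity
  have h1 : u x s ≤ (1 + k) * u x t := hcomp.trans (mul_le_mul_of_nonneg_right hA' hut)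
  rcases le_or_gt k 1 with hk1 | hk1
  · nlinarith [mul_le_mul_of_nonneg_left h1 (by linarith : 0 ≤ 1 - k), mul_nonneg (mul_nonneg hk0 hk0) hut]
  · nlinarith

/-- Strict ordering on the parabolic boundary can be improved by a translation. -/
theorem exists_translate_le {m : ℝ} (hm : 1 < m) {R ua ub : ℝ → ℝ → ℝ}
    (hR : Reac R) (hua : Continuous (Function.uncurry ua)) (hub : Continuous (Function.uncurry ub))
    {t₁ T : ℝ} (hida : IdSol m R ua t₁ T) (hidb : IdSol m R ub t₁ T)
    (hua0 : ∀ t ∈ Icc t₁ T, ∀ x, 0 ≤ ua x t) (hub0 : ∀ t ∈ Icc t₁ T, ∀ x, 0 ≤ ub x t)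
    {s₀ s y ρ' ρ D : ℝ} (hs₀ : t₁ ≤ s₀) (hs₀s : s₀ ≤ s) (hs : s ≤ T) (hρ : ρ' < ρ)
    (hD : ∀ t ∈ Icc t₁ T, ∀ x, D ≤ x → ua x t = 0) (hinit0 : ∀ x, ρ' ≤ x → ua x s₀ = 0)
    (hinit : ∀ x ∈ Icc y ρ, ua x s₀ < ub x s₀) (hlat : ∀ t ∈ Icc s₀ s, ua y t < ub y t) :
    ∃ ξ > 0, ∃ t ∈ Icc s₀ s, ∀ x, y ≤ x → ua (x - ξ) s ≤ ub x t := by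
  set d := max (max D ρ) y + 1 with hd
  have hdy : y < d := by linarith [le_max_right (max D ρ) y]
  have hdD : D + 1 ≤ d := by linarith [le_max_left (max D ρ) y, le_max_left D ρ]
  have hdρ : ρ + 1 ≤ d := by linarith [le_max_left (max D ρ) y, le_max_right D ρ]
  obtain ⟨Γ, hΓ, H⟩ := exists_rate_rescaled hm hR hua hida hua0 y d
  set E := Real.exp (Γ * (T - t₁)) with hE
  have hE0 : 0 < E := Real.exp_pos _
  have hE1 : 1 ≤ E := Real.one_le_exp (mul_nonneg hΓ.le (by linarith))
  set C := 1 / (m - 1) * Real.exp (1 / (m - 1)) with hCd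
  have hm1 : 0 < m - 1 := by linarith
  have hC : 0 ≤ C := by positivity
  obtain ⟨M, hM0, hM⟩ := exists_upper_bound_Icc hua (y - 1) d t₁ T
  -- a uniform gap on the parabolic boundary
  set Kc : Set (ℝ × ℝ) := ({y} ×ˢ Icc s₀ s) ∪ (Icc y ρ ×ˢ {s₀}) with hKc
  have hKcomp : IsCompact Kc :=
    (isCompact_singleton.prod isCompact_Icc).union (isCompact_Icc.prod isCompact_singleton)
  have hgapc : Continuous fun q : ℝ × ℝ => ub q.1 q.2 - ua q.1 q.2 := hub.sub hua
  obtain ⟨q, hqK, hq⟩ := hKcomp.exists_isMinOn ⟨(y, s₀), Or.inl ⟨rfl, le_rfl, hs₀s⟩⟩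
    hgapc.continuousOn
  set μ := ub q.1 q.2 - ua q.1 q.2 with hμd
  have hμ : 0 < μ := by
    rcases hqK with ⟨h1, h2⟩ | ⟨h1, h2⟩
    · rw [mem_singleton_iff] at h1
      have := hlat q.2 h2
      rw [hμd, h1]; linarith
    · rw [mem_singleton_iff] at h2
      have := hinit q.1 h1
      rw [hμd, h2]; linarith
  have hgap : ∀ x t, (x, t) ∈ Kc → ua x t + μ ≤ ub x t := fun x t h => by
    have : μ ≤ ub x t - ua x t := hq h
    linarith
  have hunif := (isCompact_Icc (a := y - 1) (b := d)).prod (isCompact_Icc (a := t₁) (b := T))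
    |>.uniformContinuousOn_of_continuous hua.continuousOn
  obtain ⟨δ, hδ, hδ'⟩ := Metric.uniformContinuousOn_iff.1 hunif (μ / 2) (by positivity)
  -- choice of the parameters
  obtain ⟨θ, hθ, hθ1, hθρ, hθδ, hθΓ, hθM⟩ : ∃ θ, 0 < θ ∧ θ ≤ 1 ∧ θ < ρ - ρ' ∧ θ < δ ∧ θ / Γ < δ ∧
      C * θ * M ≤ μ / 2 := by
    have hpos : 0 < min 1 (min (ρ - ρ') (min δ (min (δ * Γ) (μ / 2 / (C * M + 1))))) := by
      have : 0 < C * M + 1 := by positivity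
      refine lt_min one_pos (lt_min (by linarith) (lt_min hδ (lt_min (by positivity) (by positivity))))
    obtain ⟨θ, h0, h1⟩ := exists_between hpos
    simp only [lt_min_iff] at h1
    obtain ⟨h1, h2, h3, h4, h5⟩ := h1
    refine ⟨θ, h0, h1.le, h2, h3, by rwa [div_lt_iff₀ hΓ], ?_⟩
    rw [lt_div_iff₀ (by positivity)] at h5
    nlinarith
  have e0 : -((1 : ℝ) * Γ) = -Γ := by ring
  have hγ : -Γ ≠ 0 := neg_ne_zero.2 hΓ.ne'
  set ξ := θ / E with hξd
  have hξ : 0 < ξ := by positivity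
  have hξθ : ξ ≤ θ := div_le_self hθ.le hE1
  have hYle : ∀ t, s₀ ≤ t → growY θ (-Γ) s₀ t ≤ θ := fun t ht => by
    unfold growY
    refine mul_le_of_le_one_right hθ.le (Real.exp_le_one_iff.2 ?_)
    nlinarith
  have hYge : ∀ t ≤ s, ξ ≤ growY θ (-Γ) s₀ t := fun t ht => by
    unfold growY
    rw [hξd, div_eq_mul_inv, hE, ← Real.exp_neg]
    gcongr
    nlinarith
  have hmono := strictMono_warp hθ hγ s₀
  have hcontw : Continuous (warp θ (-Γ) s₀) :=
    continuous_iff_continuousAt.2 fun t => (hasDerivAt_warp hγ θ s₀ t).continuousAt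
  have hwdiff : ∀ t, s₀ ≤ t → t ≤ warp θ (-Γ) s₀ t ∧ warp θ (-Γ) s₀ t - t ≤ θ / Γ := fun t ht => by
    have h1 : Real.exp (-Γ * (t - s₀)) ≤ 1 := Real.exp_le_one_iff.2 (by nlinarith)
    have h2 := Real.exp_pos (-Γ * (t - s₀))
    have h3 : 0 < θ / Γ := by positivity
    have h4 : warp θ (-Γ) s₀ t = t + θ / Γ * (1 - Real.exp (-Γ * (t - s₀))) := by
      unfold warp; rw [div_neg]; ring
    rw [h4]
    constructor <;> nlinarith
  obtain ⟨t', ht', hwt'⟩ : ∃ t ∈ Icc s₀ s, warp θ (-Γ) s₀ t = s := by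
    have := intermediate_value_Icc hs₀s hcontw.continuousOn
    rw [warp_self] at this
    exact this ⟨hs₀s, (hwdiff s hs₀s).1⟩
  refine ⟨ξ, hξ, t', ht', ?_⟩
  have hw : ∀ t ∈ Icc s₀ t', warp θ (-Γ) s₀ t ∈ Icc t₁ T := fun t ht =>
    ⟨hs₀.trans (ht.1.trans (hwdiff t ht.1).1), (hmono.monotone ht.2).trans (hwt'.le.trans hs)⟩
  have hsub := H 1 (by simp) θ ξ s₀ t' hθ hs₀ (by rw [e0, hwt']; exact hs) (fun t ht => by
    rw [e0, abs_of_pos hξ]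
    exact ⟨(hYle t ht.1).trans hθ1, hYge t (ht.2.le.trans ht'.2)⟩)
  rw [e0] at hsub
  have hres0 : ∀ x, ∀ t ∈ Icc s₀ t', 0 ≤ rescaled m θ (-Γ) s₀ ξ ua x t := fun x t ht =>
    mul_nonneg (by linarith [one_le_ampl hm hθ (-Γ) s₀ t]) (hua0 _ (hw t ht) _)
  have htT : ∀ t ∈ Icc s₀ t', t ∈ Icc t₁ T := fun t ht =>
    ⟨hs₀.trans ht.1, ht.2.trans (ht'.2.trans hs)⟩
  have hbd : ∀ x t, t ∈ Icc s₀ t' → x ∈ Icc y d → (x, t) ∈ Kc →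
      rescaled m θ (-Γ) s₀ ξ ua x t ≤ ub x t := fun x t ht hx hK => by
    have hxξ : x - ξ ∈ Icc (y - 1) d := ⟨by linarith [hx.1], by linarith [hx.2]⟩
    have hA := ampl_le hm hθ ((hYle t ht.1).trans hθ1)
    rw [← hCd] at hA
    have h1 : ampl m θ (-Γ) s₀ t ≤ 1 + C * θ :=
      hA.trans (by linarith [mul_le_mul_of_nonneg_left (hYle t ht.1) hC])
    have h2 := hM _ hxξ _ (hw t ht)
    have h3 := hua0 _ (hw t ht) (x - ξ)
    have h4 := hδ' (x - ξ, warp θ (-Γ) s₀ t) ⟨hxξ, hw t ht⟩ (x, t)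
      ⟨⟨by linarith [hx.1], hx.2⟩, htT t ht⟩ (by
        rw [Prod.dist_eq, max_lt_iff, Real.dist_eq, Real.dist_eq, sub_sub_cancel_left, abs_neg,
          abs_of_pos hξ, abs_of_nonneg (by linarith [(hwdiff t ht.1).1])]
        exact ⟨by linarith, (hwdiff t ht.1).2.trans_lt hθΓ⟩)
    rw [Real.dist_eq] at h4
    simp only [Function.uncurry_apply_pair] at h4
    have h5 := (abs_lt.1 h4).2
    have h6 := hgap x t hK
    have hCθ : 0 ≤ C * θ := by positivity
    calc _ ≤ (1 + C * θ) * ua (x - ξ) (warp θ (-Γ) s₀ t) := mul_le_mul_of_nonneg_right h1 h3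
      _ ≤ ub x t := by nlinarith
  have hcomp := hR.comparison hm hdy ht'.1 (continuous_rescaled m hθ hγ s₀ ξ hua) hub
    (fun x _ t ht => hres0 x t ht) (fun x _ t ht => hub0 t (htT t ht) x) hsub
    (hidb.avgSol (by linarith) hR.cont hub (by simp) hs₀ (ht'.2.trans hs))
    (fun x hx => by
      rcases le_or_gt x ρ with h | h
      · exact hbd x s₀ ⟨le_rfl, ht'.1⟩ hx (Or.inr ⟨⟨hx.1, h⟩, rfl⟩)
      · rw [rescaled, warp_self, hinit0 _ (by linarith), mul_zero]
        exact hub0 s₀ ⟨hs₀, hs₀s.trans hs⟩ x)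
    (fun t ht => hbd y t ht ⟨le_rfl, hdy.le⟩ (Or.inl ⟨rfl, ht.1, ht.2.trans ht'.2⟩))
    (fun t ht => by
      rw [rescaled, hD _ (hw t ht) _ (by linarith), mul_zero]
      exact hub0 t (htT t ht) d)
  intro x hx
  have hsT : s ∈ Icc t₁ T := ⟨hs₀.trans hs₀s, hs⟩
  rcases le_or_gt x d with h | h
  · have h1 := hcomp x ⟨hx, h⟩
    rw [rescaled, hwt'] at h1
    exact (le_mul_of_one_le_left (hua0 s hsT _) (one_le_ampl hm hθ (-Γ) s₀ t')).trans h1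
  · rw [hD s hsT _ (by linarith)]
    exact hub0 t' (htT t' ⟨ht'.1, le_rfl⟩) x

theorem hasDerivAt_posPart_pow (n : ℕ) (s : ℝ) :
    HasDerivAt (fun s : ℝ => max s 0 ^ (n + 2)) ((n + 2 : ℕ) * max s 0 ^ (n + 1)) s := by
  rcases lt_trichotomy s 0 with h | rfl | h
  · rw [max_eq_right h.le, zero_pow (by omega), mul_zero]
    refine (hasDerivAt_const s (0 : ℝ)).congr_of_eventuallyEq ?_
    filter_upwards [gt_mem_nhds h] with t ht
    rw [max_eq_right (le_of_lt ht), zero_pow (by omega)]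
  · rw [max_self, zero_pow (by omega), mul_zero, hasDerivAt_iff_isLittleO_nhds_zero]
    simp only [zero_add, max_self, smul_zero, sub_zero]
    rw [zero_pow (by omega)]
    simp only [sub_zero]
    refine (Asymptotics.IsBigO.of_bound 1 (Eventually.of_forall fun t => ?_)).trans_isLittleO
      (Asymptotics.isLittleO_pow_id (𝕜 := ℝ) (n := n + 2) (by omega))
    rw [one_mul, norm_pow, norm_pow, Real.norm_eq_abs, Real.norm_eq_abs]
    refine pow_le_pow_left₀ (abs_nonneg _) ?_ _
    rw [abs_of_nonneg (le_max_right _ _)]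
    exact max_le (le_abs_self t) (abs_nonneg t)
  · rw [max_eq_left h.le]
    refine (hasDerivAt_pow (n + 2) s).congr_of_eventuallyEq ?_
    filter_upwards [lt_mem_nhds h] with t ht
    rw [max_eq_left (le_of_lt ht)]

theorem barrier_ineq {S X V g g₀ g₁ C Λ r : ℝ} (hr : 0 < r) (hS : 0 < S) (hSX : S = r - X ^ 2)
    (hg₀ : 0 < g₀) (hg : g₀ ≤ g) (hg1 : g ≤ g₁) (hC : 0 ≤ C)
    (hΛ : g₀ * Λ = C + 9 * g₁ ^ 2 * V ^ 2 + 10 / r) :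
    g * (-Λ * S ^ 3 + 6 * S ^ 2 * (X * V)) + C * S ^ 3 ≤ 24 * S * X ^ 2 - 6 * S ^ 2 := by
  have hΛ0 : 0 ≤ Λ := by
    have h : 0 ≤ g₀ * Λ := by rw [hΛ]; positivity
    exact nonneg_of_mul_nonneg_right h hg₀
  have h1 : g₀ * Λ ≤ g * Λ := mul_le_mul_of_nonneg_right hg hΛ0
  have h2 : g ^ 2 * V ^ 2 ≤ g₁ ^ 2 * V ^ 2 := by
    have : 0 ≤ g := hg₀.le.trans hg
    gcongr
  have h3 : 0 ≤ 23 * X ^ 2 - 6 * S + 10 / r * S ^ 2 := by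
    have e : 23 * X ^ 2 - 6 * S + 10 / r * S ^ 2 = (23 * r ^ 2 - 29 * S * r + 10 * S ^ 2) / r := by
      rw [show X ^ 2 = r - S by linarith]; field_simp; ring
    rw [e]
    refine div_nonneg ?_ hr.le
    nlinarith [sq_nonneg (r - 29 / 46 * S), sq_nonneg S]
  have h4 := sq_nonneg (X - 3 * g * V * S)
  have hS2 : 0 ≤ S ^ 2 := sq_nonneg S
  have h5 : (C + 9 * g₁ ^ 2 * V ^ 2 + 10 / r) * S ^ 2 ≤ g * Λ * S ^ 2 :=
    mul_le_mul_of_nonneg_right (hΛ ▸ h1) hS2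
  have h6 : 9 * (g ^ 2 * V ^ 2) * S ^ 2 ≤ 9 * (g₁ ^ 2 * V ^ 2) * S ^ 2 :=
    mul_le_mul_of_nonneg_right (by linarith) hS2
  have key : 0 ≤ 24 * X ^ 2 - 6 * S + g * Λ * S ^ 2 - 6 * g * X * V * S - C * S ^ 2 := by nlinarith
  nlinarith [mul_nonneg hS.le key]

/-- A moving bump which is a subsolution of every linear parabolic equation with bounded
coefficients. -/
theorem exists_barrier {p q x₀ y t₀ T g₀ g₁ C r : ℝ} (hx₀ : x₀ ∈ Ioo p q) (hy : y ∈ Ioo p q)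
    (ht : t₀ < T) (hg₀ : 0 < g₀) (hC : 0 ≤ C) (hr : 0 < r) :
    ∃ η ηt ηx ηxx : ℝ → ℝ → ℝ, Continuous (Function.uncurry η) ∧ Continuous (Function.uncurry ηt) ∧
      Continuous (Function.uncurry ηxx) ∧ (∀ x t, HasDerivAt (fun t => η x t) (ηt x t) t) ∧
      (∀ x t, HasDerivAt (fun x => η x t) (ηx x t) x) ∧
      (∀ x t, HasDerivAt (fun x => ηx x t) (ηxx x t) x) ∧ (∀ x t, 0 ≤ η x t) ∧
      (∀ x, ∀ t ∈ Icc t₀ T, η x t ≤ 1) ∧ (∀ x, r ≤ |x - x₀| → η x t₀ = 0) ∧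
      (∀ t ∈ Icc t₀ T, η p t = 0 ∧ η q t = 0) ∧ 0 < η y T ∧
      ∀ x t, ∀ g ∈ Icc g₀ g₁, g * ηt x t + C * η x t ≤ ηxx x t := by
  obtain ⟨ρ, hρ0, hρ⟩ : ∃ ρ, 0 < ρ ∧ ρ ≤ 1 ∧ ρ ≤ r ∧ ρ ≤ x₀ - p ∧ ρ ≤ q - x₀ ∧ ρ ≤ y - p ∧
      ρ ≤ q - y := by
    have : 0 < min 1 (min r (min (x₀ - p) (min (q - x₀) (min (y - p) (q - y))))) := by
      simp only [lt_min_iff]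
      exact ⟨one_pos, hr, by linarith [hx₀.1], by linarith [hx₀.2], by linarith [hy.1],
        by linarith [hy.2]⟩
    refine ⟨_, this, ?_⟩
    simp only [min_le_iff, le_refl, true_or, or_true, and_self]
  obtain ⟨hρ1, hρr, h1, h2, h3, h4⟩ := hρ
  set V := (y - x₀) / (T - t₀) with hV
  have hTt : 0 < T - t₀ := by linarith
  set Λ := (C + 9 * g₁ ^ 2 * V ^ 2 + 10 / ρ ^ 2) / g₀ with hΛ
  have hΛ0 : 0 ≤ Λ := by positivity
  set X : ℝ → ℝ → ℝ := fun x t => x - (x₀ + (t - t₀) * V) with hX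
  set s : ℝ → ℝ → ℝ := fun x t => ρ ^ 2 - X x t ^ 2 with hs
  set E : ℝ → ℝ := fun t => Real.exp (-Λ * (t - t₀)) with hE
  have cX : Continuous (Function.uncurry X) := by
    simp only [hX, Function.uncurry_def]; fun_prop
  have cs : Continuous fun q : ℝ × ℝ => max (s q.1 q.2) 0 :=
    (continuous_const.sub (cX.pow 2)).max continuous_const
  have cE : Continuous fun q : ℝ × ℝ => E q.2 := by simp only [hE]; fun_prop
  have dXx : ∀ x t, HasDerivAt (fun x => X x t) 1 x := fun x t => (hasDerivAt_id x).sub_const _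
  have dXt : ∀ x t, HasDerivAt (fun t => X x t) (-V) t := fun x t => by
    have := ((((hasDerivAt_id t).sub_const t₀).mul_const V).const_add x₀).const_sub x
    refine this.congr_deriv ?_
    ring
  have dsx : ∀ x t, HasDerivAt (fun x => s x t) (-(2 * X x t)) x := fun x t => by
    refine (((dXx x t).pow 2).const_sub (ρ ^ 2)).congr_deriv ?_
    norm_num
  have dst : ∀ x t, HasDerivAt (fun t => s x t) (2 * X x t * V) t := fun x t => by
    refine (((dXt x t).pow 2).const_sub (ρ ^ 2)).congr_deriv ?_
    norm_num
  have dE : ∀ t, HasDerivAt E (-Λ * E t) t := fun t => by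
    have := (((hasDerivAt_id t).sub_const t₀).const_mul (-Λ)).exp
    refine this.congr_deriv ?_
    simp only [hE, id]; ring
  have hE1 : ∀ t, t₀ ≤ t → E t ≤ 1 := fun t ht => Real.exp_le_one_iff.2 (by nlinarith)
  have hE0 : ∀ t, 0 < E t := fun t => Real.exp_pos _
  have hzero : ∀ x t, ρ ≤ |X x t| → s x t ≤ 0 := fun x t h => by
    have : ρ ^ 2 ≤ |X x t| ^ 2 := pow_le_pow_left₀ hρ0.le h 2
    rw [sq_abs] at this
    simp only [hs]; linarith
  have hconv : ∀ t ∈ Icc t₀ T, p + ρ ≤ x₀ + (t - t₀) * V ∧ x₀ + (t - t₀) * V ≤ q - ρ := fun t ht => by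
    set l := (t - t₀) / (T - t₀) with hl
    have hl0 : 0 ≤ l := div_nonneg (by linarith [ht.1]) hTt.le
    have hl1 : l ≤ 1 := (div_le_one hTt).2 (by linarith [ht.2])
    have e : x₀ + (t - t₀) * V = (1 - l) * x₀ + l * y := by
      rw [hV, hl]; field_simp; ring
    rw [e]
    constructor <;> nlinarith
  refine ⟨fun x t => E t * max (s x t) 0 ^ 3,
    fun x t => E t * (-Λ * max (s x t) 0 ^ 3 + 6 * max (s x t) 0 ^ 2 * (X x t * V)),
    fun x t => E t * (-6 * max (s x t) 0 ^ 2 * X x t),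
    fun x t => E t * (24 * max (s x t) 0 * X x t ^ 2 - 6 * max (s x t) 0 ^ 2),
    ?_, ?_, ?_, fun x t => ?_, fun x t => ?_, fun x t => ?_, fun x t => ?_,
    fun x t ht => ?_, fun x hx => ?_, fun t ht => ?_, ?_, fun x t g hg => ?_⟩
  · exact cE.mul (cs.pow 3)
  · exact cE.mul ((continuous_const.mul (cs.pow 3)).add
      ((continuous_const.mul (cs.pow 2)).mul (cX.mul continuous_const)))
  · exact cE.mul (((continuous_const.mul cs).mul (cX.pow 2)).sub (continuous_const.mul (cs.pow 2)))
  · refine ((dE t).mul ((hasDerivAt_posPart_pow 1 (s x t)).comp t (dst x t))).congr_deriv ?_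
    simp only [Function.comp]; push_cast; ring
  · refine (((hasDerivAt_posPart_pow 1 (s x t)).comp x (dsx x t)).const_mul (E t)).congr_deriv ?_
    push_cast; ring
  · refine (((((hasDerivAt_posPart_pow 0 (s x t)).comp x (dsx x t)).const_mul (-6)).mul
      (dXx x t)).const_mul (E t)).congr_deriv ?_
    simp only [Function.comp]; push_cast; ring
  · have := (hE0 t).le
    have h0 : 0 ≤ max (s x t) 0 := le_max_right _ _
    positivity
  · have h0 : 0 ≤ max (s x t) 0 := le_max_right _ _
    have h5 : max (s x t) 0 ≤ 1 := max_le (by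
      simp only [hs]; nlinarith [sq_nonneg (X x t)]) zero_le_one
    exact mul_le_one₀ (hE1 t ht.1) (by positivity) (pow_le_one₀ h0 h5)
  · beta_reduce
    rw [max_eq_right (hzero x t₀ ?_)]
    · simp
    · simp only [hX, sub_self, zero_mul, add_zero]; linarith
  · obtain ⟨a, b⟩ := hconv t ht
    constructor <;> beta_reduce
    · rw [max_eq_right (hzero p t ?_)]
      · simp
      · rw [le_abs]; right; simp only [hX]; linarith
    · rw [max_eq_right (hzero q t ?_)]
      · simp
      · rw [le_abs]; left; simp only [hX]; linarith
  · have e : X y T = 0 := by simp only [hX, hV]; field_simp; ring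
    have e2 : s y T = ρ ^ 2 := by simp only [hs, e]; ring
    beta_reduce
    rw [e2, max_eq_left (by positivity)]
    have := hE0 T
    positivity
  · beta_reduce
    rcases le_or_gt (s x t) 0 with h | h
    · rw [max_eq_right h]; simp
    · rw [max_eq_left h.le]
      have hsx : s x t = ρ ^ 2 - X x t ^ 2 := by simp only [hs]
      have hΛ' : g₀ * Λ = C + 9 * g₁ ^ 2 * V ^ 2 + 10 / ρ ^ 2 := by
        rw [hΛ, mul_div_cancel₀ _ hg₀.ne']
      have hE0' := (hE0 t).le
      generalize s x t = S at h hsx ⊢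
      generalize X x t = X' at hsx ⊢
      generalize E t = e at hE0' ⊢
      clear_value Λ V
      have := mul_le_mul_of_nonneg_left
        (barrier_ineq (pow_pos hρ0 2) h hsx hg₀ hg.1 hg.2 hC hΛ') hE0'
      linarith

theorem hasDerivAt_root (m : ℝ) {v : ℝ} (hv : 0 < v) :
    HasDerivAt (fun v : ℝ => v ^ (1 / m)) (1 / m * v ^ (1 / m - 1)) v :=
  Real.hasDerivAt_rpow_const (Or.inl hv.ne')

/-- Bounds on the first and second differences of the `m`-th root. -/
theorem exists_root_bounds {m : ℝ} (hm : 1 < m) {w₀ W : ℝ} (hw₀ : 0 < w₀) (hW : w₀ ≤ W) :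
    ∃ g₀ g₁ C : ℝ, 0 < g₀ ∧ g₀ ≤ g₁ ∧ 0 ≤ C ∧
      (∀ a ∈ Icc w₀ W, ∀ b ∈ Icc w₀ W, a ≤ b → g₀ * (b - a) ≤ b ^ (1 / m) - a ^ (1 / m) ∧
        b ^ (1 / m) - a ^ (1 / m) ≤ g₁ * (b - a)) ∧
      ∀ σ : ℝ, σ = 1 ∨ σ = -1 → ∀ e, 0 ≤ e → ∀ w ∈ Icc w₀ W, ∀ w' ∈ Icc w₀ W,
        w + σ * e ∈ Icc w₀ W → w' + σ * e ∈ Icc w₀ W →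
        σ * ((w' + σ * e) ^ (1 / m) - w' ^ (1 / m)) - σ * ((w + σ * e) ^ (1 / m) - w ^ (1 / m)) ≤
          C * e * max (w - w') 0 := by
  have hW0 : 0 < W := hw₀.trans_le hW
  have hm0 : 0 < 1 / m := by positivity
  have hm1 : 1 / m - 1 ≤ 0 := by
    rw [sub_nonpos, div_le_one (by linarith)]; exact hm.le
  set G' : ℝ → ℝ := fun v => 1 / m * v ^ (1 / m - 1) with hG'
  have hd : ∀ v, 0 < v → HasDerivAt (fun v : ℝ => v ^ (1 / m)) (G' v) v := fun v hv =>
    hasDerivAt_root m hv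
  have hanti : ∀ a b, 0 < a → a ≤ b → G' b ≤ G' a := fun a b ha hab =>
    mul_le_mul_of_nonneg_left (Real.rpow_le_rpow_of_nonpos ha hab hm1) hm0.le
  have hsd : ∀ v, 0 < v → HasDerivAt G' (1 / m * ((1 / m - 1) * v ^ (1 / m - 1 - 1))) v := fun v hv =>
    (Real.hasDerivAt_rpow_const (Or.inl hv.ne')).const_mul _
  set C := 1 / m * (|1 / m - 1| * w₀ ^ (1 / m - 1 - 1)) with hC
  have hlip : ∀ a ∈ Icc w₀ W, ∀ b ∈ Icc w₀ W, |G' a - G' b| ≤ C * |a - b| := by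
    intro a ha b hb
    refine Convex.norm_image_sub_le_of_norm_hasDerivWithin_le (s := Icc w₀ W)
      (fun x hx => (hsd x (hw₀.trans_le hx.1)).hasDerivWithinAt) (fun x hx => ?_)
      (convex_Icc _ _) hb ha
    rw [Real.norm_eq_abs, abs_mul, abs_mul, abs_of_pos hm0,
      abs_of_nonneg (Real.rpow_nonneg (hw₀.le.trans hx.1) _)]
    have := Real.rpow_le_rpow_of_nonpos (z := 1 / m - 1 - 1) hw₀ hx.1 (by linarith)
    exact mul_le_mul_of_nonneg_left (mul_le_mul_of_nonneg_left this (abs_nonneg _)) hm0.le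
  refine ⟨G' W, G' w₀, C, by positivity, hanti _ _ hw₀ hW, by positivity, fun a ha b hb hab => ?_,
    fun σ hσ e he w hw w' hw' hwe hwe' => ?_⟩
  · rcases hab.eq_or_lt with rfl | hab
    · simp
    · obtain ⟨c, hc, hce⟩ := exists_hasDerivAt_eq_slope (fun v : ℝ => v ^ (1 / m)) G' hab
        (fun v hv => (hd v (hw₀.trans_le (ha.1.trans hv.1))).continuousAt.continuousWithinAt)
        (fun v hv => hd v (hw₀.trans_le (ha.1.trans hv.1.le)))
      have h0 : 0 < b - a := sub_pos.2 hab
      rw [eq_div_iff h0.ne'] at hce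
      rw [← hce]
      constructor
      · exact mul_le_mul_of_nonneg_right
          (hanti _ _ (hw₀.trans_le (ha.1.trans hc.1.le)) (hc.2.le.trans hb.2)) h0.le
      · exact mul_le_mul_of_nonneg_right (hanti _ _ hw₀ (ha.1.trans hc.1.le)) h0.le
  · have hdφ : ∀ v, 0 < v → 0 < v + σ * e →
        HasDerivAt (fun v : ℝ => (v + σ * e) ^ (1 / m) - v ^ (1 / m)) (G' (v + σ * e) - G' v) v :=
      fun v hv hv' => by
        have := ((hd _ hv').comp v ((hasDerivAt_id v).add_const (σ * e))).sub (hd v hv)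
        refine this.congr_deriv ?_
        rw [mul_one]
    have hmvt : ∀ a ∈ Icc w₀ W, ∀ b ∈ Icc w₀ W, a + σ * e ∈ Icc w₀ W → b + σ * e ∈ Icc w₀ W → a < b →
        ∃ c ∈ Icc w₀ W, c + σ * e ∈ Icc w₀ W ∧ (G' (c + σ * e) - G' c) * (b - a) =
          ((b + σ * e) ^ (1 / m) - b ^ (1 / m)) - ((a + σ * e) ^ (1 / m) - a ^ (1 / m)) := by
      intro a ha b hb hae hbe hab
      have hp : ∀ v ∈ Icc a b, 0 < v ∧ 0 < v + σ * e := fun v hv =>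
        ⟨hw₀.trans_le (ha.1.trans hv.1), by linarith [hae.1, hv.1]⟩
      obtain ⟨c, hc, hce⟩ := exists_hasDerivAt_eq_slope
        (fun v : ℝ => (v + σ * e) ^ (1 / m) - v ^ (1 / m)) (fun v => G' (v + σ * e) - G' v) hab
        (fun v hv => (hdφ v (hp v hv).1 (hp v hv).2).continuousAt.continuousWithinAt)
        (fun v hv => hdφ v (hp v ⟨hv.1.le, hv.2.le⟩).1 (hp v ⟨hv.1.le, hv.2.le⟩).2)
      rw [eq_div_iff (sub_pos.2 hab).ne'] at hce
      exact ⟨c, ⟨ha.1.trans hc.1.le, hc.2.le.trans hb.2⟩,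
        ⟨by linarith [hae.1, hc.1], by linarith [hbe.2, hc.2]⟩, hce⟩
    rw [← mul_sub]
    rcases lt_trichotomy w w' with h | rfl | h
    · obtain ⟨c, hc, hc', hce⟩ := hmvt w hw w' hw' hwe hwe' h
      rw [← hce, max_eq_right (by linarith), mul_zero, ← mul_assoc]
      refine mul_nonpos_of_nonpos_of_nonneg ?_ (by linarith)
      have hc0 := hw₀.trans_le hc.1
      have hc0' := hw₀.trans_le hc'.1
      rcases hσ with rfl | rfl
      · linarith [hanti c (c + 1 * e) hc0 (by linarith)]
      · linarith [hanti (c + -1 * e) c hc0' (by linarith)]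
    · simp
    · obtain ⟨c, hc, hc', hce⟩ := hmvt w' hw' w hw hwe' hwe h
      have h1 := hlip _ hc' _ hc
      have h2 : |c + σ * e - c| = e := by
        rw [add_sub_cancel_left, abs_mul, abs_of_nonneg he]
        rcases hσ with rfl | rfl <;> simp
      rw [h2] at h1
      rw [max_eq_left (by linarith), ← neg_sub, ← hce, mul_neg, ← neg_mul, ← mul_assoc]
      refine mul_le_mul_of_nonneg_right (le_trans (le_abs_self _) ?_) (by linarith)
      rw [abs_mul, abs_neg]
      rcases hσ with rfl | rfl <;> simpa using h1

/-- The forward increment of a `C¹` function, uniformly on compact sets of parameters. -/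
theorem eventually_sub_le_of_hasDerivAt {η ηt : ℝ → ℝ → ℝ} (hη : Continuous (Function.uncurry ηt))
    (hd : ∀ x t, HasDerivAt (fun t => η x t) (ηt x t) t) (p q s : ℝ) {ε : ℝ} (hε : 0 < ε) :
    ∀ᶠ t in 𝓝[>] s, ∀ x ∈ Icc p q, η x t - η x s ≤ (t - s) * (ηt x s + ε) := by
  have h1 : ∀ᶠ t in 𝓝 s, ∀ x ∈ Icc p q, ηt x t < ηt x s + ε := by
    refine isCompact_Icc.eventually_forall_of_forall_eventually fun x _ => ?_
    have c1 : Continuous fun z : ℝ × ℝ => ηt z.2 z.1 :=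
      hη.comp (by fun_prop : Continuous fun z : ℝ × ℝ => (z.2, z.1))
    have c2 : Continuous fun z : ℝ × ℝ => ηt z.2 s + ε :=
      (hη.comp (by fun_prop : Continuous fun z : ℝ × ℝ => (z.2, s))).add continuous_const
    exact c1.continuousAt.eventually_lt c2.continuousAt (by simpa using hε)
  obtain ⟨ρ, hρ, H⟩ := Metric.eventually_nhds_iff.1 h1
  filter_upwards [Ioo_mem_nhdsGT (show s < s + ρ by linarith)] with t ht x hx
  obtain ⟨c, hc, hce⟩ := exists_hasDerivAt_eq_slope (fun t => η x t) (fun t => ηt x t) ht.1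
    (fun v _ => (hd x v).continuousAt.continuousWithinAt) (fun v _ => hd x v)
  have h0 : 0 < t - s := sub_pos.2 ht.1
  rw [eq_div_iff h0.ne'] at hce
  have := H (y := c) (by rw [Real.dist_eq, abs_lt]; constructor <;> linarith [hc.1, hc.2, ht.2]) x hx
  rw [← hce, mul_comm]
  exact mul_le_mul_of_nonneg_left this.le h0.le

theorem rpow_sub_le_of_time_bound {m M K τ a a' : ℝ} (hm : 1 < m) (hK : 0 ≤ K) (hτ : 0 ≤ τ)
    (ha : a ∈ Icc 0 M) (ha' : a' ∈ Icc 0 M) (h : (1 - K * τ) * a ≤ a') :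
    max (a ^ m - a' ^ m) 0 ≤ m * M ^ (m - 1) * (K * M) * τ := by
  have hM0 : 0 ≤ M := ha.1.trans ha.2
  have h9 : 0 ≤ m * M ^ (m - 1) := mul_nonneg (by linarith) (Real.rpow_nonneg hM0 _)
  have hz : 0 ≤ m * M ^ (m - 1) * (K * M) * τ := by positivity
  refine max_le ?_ hz
  rcases le_total a a' with haa | haa
  · have := Real.rpow_le_rpow ha.1 haa (by linarith : 0 ≤ m)
    linarith
  · have h5 := (le_abs_self _).trans (abs_rpow_sub_rpow_le hm.le ha ha')
    rw [abs_of_nonneg (by linarith : 0 ≤ a - a')] at h5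
    have h7 : K * τ * a ≤ K * τ * M := mul_le_mul_of_nonneg_left ha.2 (by positivity)
    have h8 : a - a' ≤ K * M * τ := by linarith
    have := mul_le_mul_of_nonneg_left h8 h9
    linarith

theorem barrier_increment_arith {σ τ z z' y' a a' g g₁ ηt ηxx ε e Cm C₂ L D rz : ℝ} (hτ : 0 < τ)
    (hg : g ≤ g₁) (hg₁ : 0 < g₁) (hε : 0 < ε) (he : 0 ≤ e) (hC₂ : 0 ≤ C₂)
    (h1 : σ * (z' - y') ≤ τ * (g * (ηt + ε / (2 * g₁))))
    (h2 : σ * (y' - a') - σ * (z - a) ≤ C₂ * e * D) (hD : D ≤ Cm * τ)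
    (hin : g * ηt + (C₂ * Cm + L * g₁) * e ≤ ηxx) (hR : -(L * g₁ * e) ≤ σ * rz) :
    σ * (z' - z) ≤ σ * (a' - a) + τ * (ηxx + σ * rz + ε / 2) := by
  have h3 := mul_le_mul_of_nonneg_left hD (mul_nonneg hC₂ he)
  have hgε : g * (ε / (2 * g₁)) ≤ ε / 2 := by
    calc g * (ε / (2 * g₁)) ≤ g₁ * (ε / (2 * g₁)) := mul_le_mul_of_nonneg_right hg (by positivity)
      _ = ε / 2 := by field_simp
  have htot : g * (ηt + ε / (2 * g₁)) + C₂ * e * Cm ≤ ηxx + σ * rz + ε / 2 := by linarith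
  have := mul_le_mul_of_nonneg_left htot hτ.le
  linarith

/-- Averaging a pointwise comparison of increments. -/
theorem avg_increment_of_pointwise {m σ ε x h τ : ℝ} {z z' u u' ηs ηx ηxx Rz Ru : ℝ → ℝ}
    (hσσ : σ * σ = 1) (hh : 0 < h)
    (cz : Continuous z) (cz' : Continuous z') (cu : Continuous u) (cu' : Continuous u')
    (cxx : Continuous ηxx) (cRz : Continuous Rz) (cRu : Continuous Ru)
    (dx : ∀ y, HasDerivAt ηs (ηx y) y) (dxx : ∀ y, HasDerivAt ηx (ηxx y) y)
    (hpt : ∀ y ∈ Icc (x - h) (x + h), σ * (z' y - z y) ≤ σ * (u' y - u y) +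
      τ * (ηxx y + σ * (Rz y - Ru y) + ε / 2))
    (hzm : ∀ y ∈ Icc (x - h) (x + h), z y ^ m = u y ^ m + σ * ηs y)
    (hA : σ * (hatAvg u' x h - hatAvg u x h) ≤
      τ * (σ * (sd (fun y => u y ^ m) x h + hatAvg Ru x h) + ε / 2)) :
    σ * (hatAvg z' x h - hatAvg z x h) ≤
      τ * (σ * (sd (fun y => z y ^ m) x h + hatAvg Rz x h) + ε) := by
  have c1 : Continuous fun y => σ * (u' y - u y) := by fun_prop
  have c2 : Continuous fun y => ηxx y + σ * (Rz y - Ru y) := by fun_prop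
  have c3 : Continuous fun y => τ * (ηxx y + σ * (Rz y - Ru y) + ε / 2) := by fun_prop
  have c4 : Continuous fun y => σ * (Rz y - Ru y) := by fun_prop
  have c5 : Continuous fun y => σ * (u' y - u y) + τ * (ηxx y + σ * (Rz y - Ru y) + ε / 2) := by
    fun_prop
  have hav := hatAvg_mono (by fun_prop : Continuous fun y => σ * (z' y - z y)) c5 hh.le hpt
  rw [hatAvg_const_mul, hatAvg_sub cz' cz, hatAvg_add c1 c3, hatAvg_const_mul, hatAvg_sub cu' cu,
    hatAvg_const_mul, hatAvg_add c2 continuous_const, hatAvg_add cxx c4,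
    hatAvg_const_mul, hatAvg_sub cRz cRu, hatAvg_const,
    ← sd_eq_hatAvg dx dxx cxx x hh.ne'] at hav
  have hsd : sd (fun y => z y ^ m) x h = sd (fun y => u y ^ m) x h + σ * sd ηs x h := by
    unfold sd
    beta_reduce
    rw [hzm x ⟨by linarith, by linarith⟩, hzm (x + h) ⟨by linarith, le_rfl⟩,
      hzm (x - h) ⟨le_rfl, by linarith⟩]
    ring
  have e1 : σ * (sd (fun y => u y ^ m) x h + σ * sd ηs x h + hatAvg Rz x h) + ε =
      (σ * (sd (fun y => u y ^ m) x h + hatAvg Ru x h) + ε / 2) +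
      (sd ηs x h + σ * (hatAvg Rz x h - hatAvg Ru x h) + ε / 2) := by
    linear_combination sd ηs x h * hσσ
  rw [hsd, e1, mul_add]
  linarith

/-- Perturbing the `m`-th power of a positive solution by a barrier preserves the one-sided
equation. -/
theorem exists_avgSol_barrier {m : ℝ} (hm : 1 < m) {R u : ℝ → ℝ → ℝ} (hR : Reac R)
    (hu : Continuous (Function.uncurry u)) {p q t₀ T c₀ K δ σ : ℝ} (hσ : σ = 1 ∨ σ = -1)
    (hc₀ : 0 < c₀) (hK : 0 ≤ K) (hδ : 0 < δ)
    (hlow : ∀ x ∈ Icc p q, ∀ t ∈ Icc t₀ T, c₀ ≤ u x t)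
    (htime : ∀ s ∈ Icc t₀ T, ∀ t ∈ Icc s T, t ≤ s + δ → ∀ x, (1 - K * (t - s)) * u x s ≤ u x t)
    (hus : AvgSol σ m R u p q t₀ T) :
    ∃ g₀ g₁ C : ℝ, 0 < g₀ ∧ 0 ≤ C ∧ ∀ η ηt ηx ηxx : ℝ → ℝ → ℝ, Continuous (Function.uncurry η) →
      Continuous (Function.uncurry ηt) → Continuous (Function.uncurry ηxx) →
      (∀ x t, HasDerivAt (fun t => η x t) (ηt x t) t) →
      (∀ x t, HasDerivAt (fun x => η x t) (ηx x t) x) →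
      (∀ x t, HasDerivAt (fun x => ηx x t) (ηxx x t) x) → (∀ x t, 0 ≤ η x t) →
      (∀ x, ∀ t ∈ Icc t₀ T, η x t ≤ c₀ ^ m / 2) →
      (∀ x t, ∀ g ∈ Icc g₀ g₁, g * ηt x t + C * η x t ≤ ηxx x t) →
      AvgSol σ m R (fun x t => (u x t ^ m + σ * η x t) ^ (1 / m)) p q t₀ T := by
  have hm0 : 0 < m := by linarith
  obtain ⟨M, hM0, hM⟩ := exists_upper_bound_Icc hu p q t₀ T
  have hcm : 0 < c₀ ^ m := Real.rpow_pos_of_pos hc₀ m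
  have hMm : 0 ≤ M ^ m := Real.rpow_nonneg hM0 m
  set w₀ := c₀ ^ m / 2 with hw₀
  have hw₀0 : 0 < w₀ := by positivity
  set W := M ^ m + c₀ ^ m with hW
  have hw₀W : w₀ ≤ W := by linarith
  obtain ⟨g₀, g₁, C₂, hg₀, hg₀₁, hC₂, hG, hΓ⟩ := exists_root_bounds hm hw₀0 hw₀W
  obtain ⟨L, hL, hl, -⟩ := hR.lip (max |p| |q|) (W ^ (1 / m))
  have hM1 : 0 ≤ M ^ (m - 1) := Real.rpow_nonneg hM0 _
  have hg₁ : 0 < g₁ := hg₀.trans_le hg₀₁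
  set C := C₂ * (m * M ^ (m - 1) * (K * M)) + L * g₁ with hC
  refine ⟨g₀, g₁, C, hg₀, by positivity, fun η ηt ηx ηxx cη cηt cηxx dt dx dxx h0 hle hin => ?_⟩
  set z : ℝ → ℝ → ℝ := fun x t => (u x t ^ m + σ * η x t) ^ (1 / m) with hz
  have hσ1 : |σ| = 1 := by rcases hσ with rfl | rfl <;> simp
  have hσσ : σ * σ = 1 := by rcases hσ with rfl | rfl <;> norm_num
  have hσle : ∀ v, σ * v ≤ |v| := fun v => by
    have := le_abs_self (σ * v)
    rwa [abs_mul, hσ1, one_mul] at this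
  have hu0 : ∀ x ∈ Icc p q, ∀ t ∈ Icc t₀ T, 0 ≤ u x t := fun x hx t ht => hc₀.le.trans (hlow x hx t ht)
  have hwlo : ∀ x ∈ Icc p q, ∀ t ∈ Icc t₀ T, c₀ ^ m ≤ u x t ^ m := fun x hx t ht =>
    Real.rpow_le_rpow hc₀.le (hlow x hx t ht) hm0.le
  have hwhi : ∀ x ∈ Icc p q, ∀ t ∈ Icc t₀ T, u x t ^ m ≤ M ^ m := fun x hx t ht =>
    Real.rpow_le_rpow (hu0 x hx t ht) (hM x hx t ht) hm0.le
  have hw : ∀ x ∈ Icc p q, ∀ t ∈ Icc t₀ T, ∀ e ∈ Icc 0 w₀, u x t ^ m + σ * e ∈ Icc w₀ W := by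
    intro x hx t ht e he
    have h1 := hwlo x hx t ht
    have h2 := hwhi x hx t ht
    have h3 : |σ * e| ≤ w₀ := by rw [abs_mul, hσ1, one_mul, abs_of_nonneg he.1]; exact he.2
    have h4 := abs_le.1 h3
    constructor <;> linarith
  have hroot : ∀ x ∈ Icc p q, ∀ t ∈ Icc t₀ T, (u x t ^ m) ^ (1 / m) = u x t := fun x hx t ht => by
    rw [← Real.rpow_mul (hu0 x hx t ht), mul_one_div_cancel hm0.ne', Real.rpow_one]
  have hGlip : ∀ a ∈ Icc w₀ W, ∀ b ∈ Icc w₀ W, |a ^ (1 / m) - b ^ (1 / m)| ≤ g₁ * |a - b| := by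
    intro a ha b hb
    rcases le_total a b with hab | hab
    · rw [abs_sub_comm, abs_sub_comm a, abs_of_nonneg (by linarith : 0 ≤ b - a), abs_of_nonneg]
      · exact (hG a ha b hb hab).2
      · exact le_trans (mul_nonneg hg₀.le (by linarith)) (hG a ha b hb hab).1
    · rw [abs_of_nonneg (by linarith : 0 ≤ a - b), abs_of_nonneg]
      · exact (hG b hb a ha hab).2
      · exact le_trans (mul_nonneg hg₀.le (by linarith)) (hG b hb a ha hab).1
  have hwin : ∀ x ∈ Icc p q, ∀ t ∈ Icc t₀ T, u x t ^ m ∈ Icc w₀ W := fun x hx t ht => by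
    simpa using hw x hx t ht 0 ⟨le_rfl, hw₀0.le⟩
  have hηw : ∀ x, ∀ t ∈ Icc t₀ T, η x t ∈ Icc 0 w₀ := fun x t ht => ⟨h0 x t, hle x t ht⟩
  have hzR : ∀ x ∈ Icc p q, ∀ t ∈ Icc t₀ T,
      -(L * g₁ * η x t) ≤ σ * (R x (z x t) - R x (u x t)) := by
    intro x hx t ht
    have h1 : |z x t - u x t| ≤ g₁ * η x t := by
      have := hGlip _ (hw x hx t ht _ (hηw x t ht)) _ (hwin x hx t ht)
      rw [hroot x hx t ht, add_sub_cancel_left, abs_mul, hσ1, one_mul, abs_of_nonneg (h0 x t)] at this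
      exact this
    have h2 := hl x (Icc_subset_Icc_abs p q hx) (z x t)
      ⟨Real.rpow_nonneg (hw₀0.le.trans (hw x hx t ht _ (hηw x t ht)).1) _,
        Real.rpow_le_rpow (hw₀0.le.trans (hw x hx t ht _ (hηw x t ht)).1)
          (hw x hx t ht _ (hηw x t ht)).2 (by positivity)⟩
      (u x t) ⟨hu0 x hx t ht, by
        rw [← hroot x hx t ht]
        exact Real.rpow_le_rpow (Real.rpow_nonneg (hu0 x hx t ht) _) (hwin x hx t ht).2
          (by positivity)⟩
    have h3 := hσle (-(R x (z x t) - R x (u x t)))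
    rw [abs_neg] at h3
    nlinarith [mul_le_mul_of_nonneg_left h1 hL]
  have cz : Continuous (Function.uncurry z) := by
    have c1 : Continuous (Function.uncurry fun x t => u x t ^ m + σ * η x t) :=
      ((Real.continuous_rpow_const hm0.le).comp hu).add (continuous_const.mul cη)
    exact (Real.continuous_rpow_const (by positivity : (0 : ℝ) ≤ 1 / m)).comp c1
  intro x h hh hxp hxq s hs ε hε
  have hsI : s ∈ Icc t₀ T := ⟨hs.1, hs.2.le⟩
  have hε₁ : 0 < ε / (2 * g₁) := by positivity
  filter_upwards [hus x h hh hxp hxq s hs (ε / 2) (by linarith),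
    eventually_sub_le_of_hasDerivAt cηt dt p q s hε₁, Ioo_mem_nhdsGT hs.2,
    Ioo_mem_nhdsGT (show s < s + δ by linarith)] with t hA hB ht hts
  have htI : t ∈ Icc t₀ T := ⟨hs.1.trans ht.1.le, ht.2.le⟩
  have hτ : 0 < t - s := sub_pos.2 ht.1
  have hpt : ∀ y ∈ Icc (x - h) (x + h), σ * (z y t - z y s) ≤ σ * (u y t - u y s) +
      (t - s) * (ηxx y s + σ * (R y (z y s) - R y (u y s)) + ε / 2) := by
    intro y hy
    have hy' : y ∈ Icc p q := ⟨hxp.trans hy.1, hy.2.trans hxq⟩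
    set a := u y s with ha
    set a' := u y t with ha'
    set e := η y s with he
    set e' := η y t with he'
    have hw1 := hw y hy' t htI e (hηw y s hsI)
    have hw2 := hw y hy' t htI e' (hηw y t htI)
    obtain ⟨g, hg, hb1⟩ : ∃ g ∈ Icc g₀ g₁,
        σ * ((a' ^ m + σ * e') ^ (1 / m) - (a' ^ m + σ * e) ^ (1 / m)) ≤
          (t - s) * (g * (ηt y s + ε / (2 * g₁))) := by
      have hΔ := hB y hy'
      rcases le_total e e' with hee | hee
      · refine ⟨g₁, ⟨hg₀₁, le_rfl⟩, ?_⟩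
        refine (hσle _).trans ((hGlip _ hw2 _ hw1).trans ?_)
        rw [add_sub_add_left_eq_sub, ← mul_sub, abs_mul, hσ1, one_mul, abs_of_nonneg (by linarith)]
        nlinarith [mul_le_mul_of_nonneg_left hΔ hg₁.le]
      · have hlow' : σ * ((a' ^ m + σ * e') ^ (1 / m) - (a' ^ m + σ * e) ^ (1 / m)) ≤
            g₀ * (e' - e) := by
          rcases hσ with rfl | rfl
          · have := (hG _ hw2 _ hw1 (by linarith)).1
            linarith
          · have := (hG _ hw1 _ hw2 (by linarith)).1
            linarith
        refine ⟨g₀, ⟨le_rfl, hg₀₁⟩, hlow'.trans ?_⟩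
        nlinarith [mul_le_mul_of_nonneg_left hΔ hg₀.le]
    have hb2 := hΓ σ hσ e (h0 y s) _ (hwin y hy' s hsI) _ (hwin y hy' t htI)
      (hw y hy' s hsI e (hηw y s hsI)) hw1
    rw [hroot y hy' s hsI, hroot y hy' t htI, ← ha, ← ha'] at hb2
    exact barrier_increment_arith hτ hg.2 hg₁ hε (h0 y s) hC₂ hb1 hb2
      (rpow_sub_le_of_time_bound hm hK hτ.le ⟨hu0 y hy' s hsI, hM y hy' s hsI⟩
        ⟨hu0 y hy' t htI, hM y hy' t htI⟩ (htime s hsI t ⟨ht.1.le, ht.2.le⟩ hts.2.le y))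
      (hin y s g hg) (hzR y hy' s hsI)
  have czt : ∀ t, Continuous fun y => z y t := fun t =>
    cz.comp (by fun_prop : Continuous fun y : ℝ => (y, t))
  have cut : ∀ t, Continuous fun y => u y t := fun t =>
    hu.comp (by fun_prop : Continuous fun y : ℝ => (y, t))
  have cxx : Continuous fun y => ηxx y s :=
    cηxx.comp (by fun_prop : Continuous fun y : ℝ => (y, s))
  have cRz : Continuous fun y => R y (z y s) :=
    (continuous_reac hR.cont cz).comp (by fun_prop : Continuous fun y : ℝ => (y, s))
  have cRu : Continuous fun y => R y (u y s) :=
    (continuous_reac hR.cont hu).comp (by fun_prop : Continuous fun y : ℝ => (y, s))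
  have hzm : ∀ y ∈ Icc p q, z y s ^ m = u y s ^ m + σ * η y s := fun y hy => by
    rw [hz]
    beta_reduce
    rw [← Real.rpow_mul (hw₀0.le.trans (hw y hy s hsI _ (hηw y s hsI)).1),
      one_div_mul_cancel hm0.ne', Real.rpow_one]
  exact avg_increment_of_pointwise hσσ hh (czt s) (czt t) (cut s) (cut t) cxx cRz cRu
    (fun y => dx y s) (fun y => dxx y s) hpt
    (fun y hy => hzm y ⟨hxp.trans hy.1, hy.2.trans hxq⟩) hA

theorem sign_sub_root_nonneg {m σ b v : ℝ} (hm : 0 < m) (hσ : σ = 1 ∨ σ = -1) (hb : 0 ≤ b)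
    (hv : 0 ≤ v) (h : 0 ≤ σ * (b ^ m - v)) : 0 ≤ σ * (b - v ^ (1 / m)) := by
  have hr : (b ^ m) ^ (1 / m) = b := by
    rw [← Real.rpow_mul hb, mul_one_div_cancel hm.ne', Real.rpow_one]
  have hb' : 0 ≤ b ^ m := Real.rpow_nonneg hb _
  have hm' : 0 ≤ 1 / m := by positivity
  rcases hσ with rfl | rfl
  · have := Real.rpow_le_rpow hv (by linarith : v ≤ b ^ m) hm'
    linarith
  · have := Real.rpow_le_rpow hb' (by linarith : b ^ m ≤ v) hm'
    linarith

theorem sign_root_sub_pos {m σ a e : ℝ} (hm : 0 < m) (hσ : σ = 1 ∨ σ = -1) (ha : 0 ≤ a)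
    (he : 0 < e) (hv : 0 ≤ a ^ m + σ * e) : 0 < σ * ((a ^ m + σ * e) ^ (1 / m) - a) := by
  have hr : (a ^ m) ^ (1 / m) = a := by
    rw [← Real.rpow_mul ha, mul_one_div_cancel hm.ne', Real.rpow_one]
  have ha' : 0 ≤ a ^ m := Real.rpow_nonneg ha _
  have hm' : 0 < 1 / m := by positivity
  rcases hσ with rfl | rfl
  · have := Real.rpow_lt_rpow ha' (by linarith : a ^ m < a ^ m + 1 * e) hm'
    linarith
  · have := Real.rpow_lt_rpow hv (by linarith : a ^ m + -1 * e < a ^ m) hm'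
    linarith

/-- Strong maximum principle. -/
theorem strong_maximum {m : ℝ} (hm : 1 < m) {R ua ub : ℝ → ℝ → ℝ} (hR : Reac R)
    (hua : Continuous (Function.uncurry ua)) (hub : Continuous (Function.uncurry ub))
    {p q t₀ T c₀ K δ σ : ℝ} (hσ : σ = 1 ∨ σ = -1) (ht : t₀ < T)
    (hc₀ : 0 < c₀) (hK : 0 ≤ K) (hδ : 0 < δ)
    (hlow : ∀ x ∈ Icc p q, ∀ t ∈ Icc t₀ T, c₀ ≤ ua x t)
    (htime : ∀ s ∈ Icc t₀ T, ∀ t ∈ Icc s T, t ≤ s + δ → ∀ x, (1 - K * (t - s)) * ua x s ≤ ua x t)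
    (ha : ∀ σ : ℝ, |σ| ≤ 1 → AvgSol σ m R ua p q t₀ T)
    (hb : ∀ σ : ℝ, |σ| ≤ 1 → AvgSol σ m R ub p q t₀ T)
    (hub0 : ∀ x ∈ Icc p q, ∀ t ∈ Icc t₀ T, 0 ≤ ub x t)
    (hinit : ∀ x ∈ Icc p q, 0 ≤ σ * (ub x t₀ - ua x t₀))
    (hlp : ∀ t ∈ Icc t₀ T, 0 ≤ σ * (ub p t - ua p t))
    (hlq : ∀ t ∈ Icc t₀ T, 0 ≤ σ * (ub q t - ua q t))
    {x₀ y : ℝ} (hx₀ : x₀ ∈ Ioo p q) (hy : y ∈ Ioo p q) (hpos : 0 < σ * (ub x₀ t₀ - ua x₀ t₀)) :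
    0 < σ * (ub y T - ua y T) := by
  have hm0 : 0 < m := by linarith
  have hpq : p < q := hx₀.1.trans hx₀.2
  have hσ1 : |σ| = 1 := by rcases hσ with rfl | rfl <;> simp
  have hua0 : ∀ x ∈ Icc p q, ∀ t ∈ Icc t₀ T, 0 ≤ ua x t := fun x hx t ht =>
    hc₀.le.trans (hlow x hx t ht)
  have htI : t₀ ∈ Icc t₀ T := ⟨le_rfl, ht.le⟩
  have hTI : T ∈ Icc t₀ T := ⟨ht.le, le_rfl⟩
  have hord : ∀ x ∈ Icc p q, ∀ t ∈ Icc t₀ T, 0 ≤ σ * (ub x t - ua x t) →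
      0 ≤ σ * (ub x t ^ m - ua x t ^ m) := by
    intro x hx t ht h
    rcases hσ with rfl | rfl
    · have := Real.rpow_le_rpow (hua0 x hx t ht) (by linarith : ua x t ≤ ub x t) hm0.le
      linarith
    · have := Real.rpow_le_rpow (hub0 x hx t ht) (by linarith : ub x t ≤ ua x t) hm0.le
      linarith
  set F : ℝ → ℝ := fun x => σ * (ub x t₀ ^ m - ua x t₀ ^ m) with hF
  have cF : Continuous F := by
    have c : Continuous fun x : ℝ => (x, t₀) := by fun_prop
    exact continuous_const.mul (((Real.continuous_rpow_const hm0.le).comp (hub.comp c)).sub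
      ((Real.continuous_rpow_const hm0.le).comp (hua.comp c)))
  have hx₀I : x₀ ∈ Icc p q := ⟨hx₀.1.le, hx₀.2.le⟩
  have hF0 : 0 < F x₀ := by
    simp only [hF]
    rcases hσ with rfl | rfl
    · have := Real.rpow_lt_rpow (hua0 x₀ hx₀I t₀ htI) (by linarith : ua x₀ t₀ < ub x₀ t₀) hm0
      linarith
    · have := Real.rpow_lt_rpow (hub0 x₀ hx₀I t₀ htI) (by linarith : ub x₀ t₀ < ua x₀ t₀) hm0
      linarith
  obtain ⟨r, hr, hFr⟩ := Metric.eventually_nhds_iff.1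
    (cF.continuousAt.eventually (lt_mem_nhds (show F x₀ / 2 < F x₀ by linarith)))
  obtain ⟨g₀, g₁, C, hg₀, hC, H⟩ := exists_avgSol_barrier hm hR hua hσ hc₀ hK hδ hlow htime
    (ha σ hσ1.le)
  obtain ⟨η, ηt, ηx, ηxx, cη, cηt, cηxx, dt, dx, dxx, h0, h1, hfar, hside, hyT, hineq⟩ :=
    exists_barrier (g₁ := g₁) hx₀ hy ht hg₀ hC hr
  have hcm : 0 < c₀ ^ m := Real.rpow_pos_of_pos hc₀ m
  set ε := min (c₀ ^ m / 2) (F x₀ / 2) with hε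
  have hε0 : 0 < ε := lt_min (by positivity) (by positivity)
  have hle : ∀ x, ∀ t ∈ Icc t₀ T, ε * η x t ≤ ε := fun x t ht => by
    nlinarith [h1 x t ht]
  have hz := H (fun x t => ε * η x t) (fun x t => ε * ηt x t) (fun x t => ε * ηx x t)
    (fun x t => ε * ηxx x t) (continuous_const.mul cη) (continuous_const.mul cηt)
    (continuous_const.mul cηxx) (fun x t => (dt x t).const_mul ε) (fun x t => (dx x t).const_mul ε)
    (fun x t => (dxx x t).const_mul ε) (fun x t => mul_nonneg hε0.le (h0 x t))
    (fun x t ht => (hle x t ht).trans (min_le_left _ _))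
    (fun x t g hg => by nlinarith [mul_le_mul_of_nonneg_left (hineq x t g hg) hε0.le])
  set z : ℝ → ℝ → ℝ := fun x t => (ua x t ^ m + σ * (ε * η x t)) ^ (1 / m) with hzd
  have hv : ∀ x ∈ Icc p q, ∀ t ∈ Icc t₀ T, 0 ≤ ua x t ^ m + σ * (ε * η x t) := by
    intro x hx t ht
    have h2 := Real.rpow_le_rpow hc₀.le (hlow x hx t ht) hm0.le
    have h3 : |σ * (ε * η x t)| ≤ ε := by
      rw [abs_mul, hσ1, one_mul, abs_of_nonneg (mul_nonneg hε0.le (h0 x t))]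
      exact hle x t ht
    linarith [(abs_le.1 h3).1, min_le_left (c₀ ^ m / 2) (F x₀ / 2)]
  have hz0 : ∀ x ∈ Icc p q, ∀ t ∈ Icc t₀ T, 0 ≤ z x t := fun x hx t ht =>
    Real.rpow_nonneg (hv x hx t ht) _
  have cz : Continuous (Function.uncurry z) := by
    have c1 : Continuous (Function.uncurry fun x t => ua x t ^ m + σ * (ε * η x t)) :=
      ((Real.continuous_rpow_const hm0.le).comp hua).add
        (continuous_const.mul (continuous_const.mul cη))
    exact (Real.continuous_rpow_const (by positivity : (0 : ℝ) ≤ 1 / m)).comp c1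
  have hσσ : σ * σ = 1 := by rcases hσ with rfl | rfl <;> norm_num
  have hcmp : ∀ x ∈ Icc p q, ∀ t ∈ Icc t₀ T, ε * η x t ≤ σ * (ub x t ^ m - ua x t ^ m) →
      0 ≤ σ * (ub x t - z x t) := fun x hx t ht h => by
    refine sign_sub_root_nonneg hm0 hσ (hub0 x hx t ht) (hv x hx t ht) ?_
    have e : σ * (ub x t ^ m - (ua x t ^ m + σ * (ε * η x t))) =
        σ * (ub x t ^ m - ua x t ^ m) - σ * σ * (ε * η x t) := by ring
    rw [e, hσσ]
    linarith
  have hi : ∀ x ∈ Icc p q, 0 ≤ σ * (ub x t₀ - z x t₀) := fun x hx => by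
    refine hcmp x hx t₀ htI ?_
    rcases le_or_gt r |x - x₀| with h | h
    · rw [hfar x h, mul_zero]
      exact hord x hx t₀ htI (hinit x hx)
    · have h2 := hFr (y := x) (by rwa [Real.dist_eq])
      have h3 := hle x t₀ htI
      have h4 : ε ≤ F x₀ / 2 := min_le_right _ _
      exact (h3.trans h4).trans h2.le
  have hpI : p ∈ Icc p q := ⟨le_rfl, hpq.le⟩
  have hqI : q ∈ Icc p q := ⟨hpq.le, le_rfl⟩
  have hp' : ∀ t ∈ Icc t₀ T, 0 ≤ σ * (ub p t - z p t) := fun t ht => by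
    refine hcmp p hpI t ht ?_
    rw [(hside t ht).1, mul_zero]
    exact hord p hpI t ht (hlp t ht)
  have hq' : ∀ t ∈ Icc t₀ T, 0 ≤ σ * (ub q t - z q t) := fun t ht => by
    refine hcmp q hqI t ht ?_
    rw [(hside t ht).2, mul_zero]
    exact hord q hqI t ht (hlq t ht)
  have hyI : y ∈ Icc p q := ⟨hy.1.le, hy.2.le⟩
  have hfin : 0 ≤ σ * (ub y T - z y T) := by
    rcases hσ with rfl | rfl
    · have := hR.comparison hm hpq ht.le cz hub hz0 hub0 hz (hb (-1) (by simp))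
        (fun x hx => by linarith [hi x hx]) (fun t ht => by linarith [hp' t ht])
        (fun t ht => by linarith [hq' t ht]) y hyI
      linarith
    · have := hR.comparison hm hpq ht.le hub cz hub0 hz0 (hb 1 (by simp)) hz
        (fun x hx => by linarith [hi x hx]) (fun t ht => by linarith [hp' t ht])
        (fun t ht => by linarith [hq' t ht]) y hyI
      linarith
  have hpos' := sign_root_sub_pos (e := ε * η y T) hm0 hσ (hua0 y hyI T hTI) (mul_pos hε0 hyT)
    (hv y hyI T hTI)
  have e : z y T = (ua y T ^ m + σ * (ε * η y T)) ^ (1 / m) := rfl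
  rw [← e] at hpos'
  linarith

section

variable {m : ℝ} {R u₁ u₃ : ℝ → ℝ → ℝ} {r₁ l₃ r₃ : ℝ → ℝ} {t₁ T : ℝ}

theorem Sys.nonneg₁ (S : Sys m R u₁ u₃ r₁ l₃ r₃ t₁ T) {t : ℝ} (ht : t ∈ Icc t₁ T) (x : ℝ) :
    0 ≤ u₁ x t := by
  rcases lt_or_ge x (r₁ t) with h | h
  · exact (S.pos₁ t ht x h).le
  · exact (S.zero₁ t ht x h).ge

theorem Sys.nonneg₃ (S : Sys m R u₁ u₃ r₁ l₃ r₃ t₁ T) {t : ℝ} (ht : t ∈ Icc t₁ T) (x : ℝ) :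
    0 ≤ u₃ x t := by
  rcases le_or_gt x (l₃ t) with h | h
  · exact (S.zero₃l t ht x h).ge
  rcases le_or_gt (r₃ t) x with h' | h'
  · exact (S.zero₃r t ht x h').ge
  · exact (S.pos₃ t ht x ⟨h, h'⟩).le

theorem Sys.left_lt (S : Sys m R u₁ u₃ r₁ l₃ r₃ t₁ T) {t x : ℝ} (ht : t ∈ Icc t₁ T)
    (h : u₁ x t < u₃ x t) : l₃ t < x := by
  by_contra! h'
  linarith [S.zero₃l t ht x h', S.nonneg₁ ht x]

theorem Sys.lt_right (S : Sys m R u₁ u₃ r₁ l₃ r₃ t₁ T) {t x : ℝ} (ht : t ∈ Icc t₁ T)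
    (h : u₁ x t < u₃ x t) : x < r₃ t := by
  by_contra! h'
  linarith [S.zero₃r t ht x h', S.nonneg₁ ht x]

theorem Sys.cont_diff (S : Sys m R u₁ u₃ r₁ l₃ r₃ t₁ T) :
    Continuous fun q : ℝ × ℝ => u₁ q.1 q.2 - u₃ q.1 q.2 :=
  S.cont₁.sub S.cont₃

theorem Sys.cont_diff_space (S : Sys m R u₁ u₃ r₁ l₃ r₃ t₁ T) (t : ℝ) :
    Continuous fun x => u₁ x t - u₃ x t :=
  S.cont_diff.comp (by fun_prop : Continuous fun x : ℝ => (x, t))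

theorem Sys.cont_diff_time (S : Sys m R u₁ u₃ r₁ l₃ r₃ t₁ T) (x : ℝ) :
    Continuous fun t => u₁ x t - u₃ x t :=
  S.cont_diff.comp (by fun_prop : Continuous fun t : ℝ => (x, t))

theorem Sys.strong_maximum (S : Sys m R u₁ u₃ r₁ l₃ r₃ t₁ T) {p q t₀ s σ : ℝ}
    (hσ : σ = 1 ∨ σ = -1) (h0 : t₁ < t₀) (hs : t₀ < s) (hsT : s ≤ T) (hp : l₃ t₀ < p)
    (hq : q < r₃ t₀) (hinit : ∀ x ∈ Icc p q, 0 ≤ σ * (u₁ x t₀ - u₃ x t₀))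
    (hlp : ∀ t ∈ Icc t₀ s, 0 ≤ σ * (u₁ p t - u₃ p t))
    (hlq : ∀ t ∈ Icc t₀ s, 0 ≤ σ * (u₁ q t - u₃ q t)) {x₀ y : ℝ} (hx₀ : x₀ ∈ Ioo p q)
    (hy : y ∈ Ioo p q) (hpos : 0 < σ * (u₁ x₀ t₀ - u₃ x₀ t₀)) :
    0 < σ * (u₁ y s - u₃ y s) := by
  have hm0 : 0 ≤ m := by linarith [S.one_lt]
  have hpq : p < q := hx₀.1.trans hx₀.2
  have hI : ∀ t ∈ Icc t₀ s, t ∈ Icc t₁ T := fun t ht => ⟨h0.le.trans ht.1, ht.2.trans hsT⟩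
  have h0I : t₀ ∈ Icc t₁ T := hI _ ⟨le_rfl, hs.le⟩
  have hTI : T ∈ Icc t₁ T := ⟨h0I.1.trans h0I.2, le_rfl⟩
  obtain ⟨K, δ, hK, hδ, htime⟩ := S.id₃.time_lower_bound S.one_lt S.reac S.cont₃
    (fun t ht x => S.nonneg₃ ht x) (B := max |l₃ T| |r₃ T|)
    (by
      intro t ht x hx
      rcases le_or_gt x (l₃ T) with h | h
      · exact S.zero₃l t ht x (h.trans (S.antil₃ ht hTI ht.2))
      rcases le_or_gt (r₃ T) x with h' | h'
      · exact S.zero₃r t ht x ((S.mono₃ ht hTI ht.2).trans h')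
      · exact absurd hx (not_le.2 (abs_lt.2
          ⟨by linarith [neg_abs_le (l₃ T), le_max_left |l₃ T| |r₃ T|],
            by linarith [le_abs_self (r₃ T), le_max_right |l₃ T| |r₃ T|]⟩)))
    (sub_pos.2 h0)
  obtain ⟨z, hz, hmin⟩ := (isCompact_Icc.prod isCompact_Icc).exists_isMinOn
    (s := Icc p q ×ˢ Icc t₀ s) ⟨(p, t₀), ⟨le_rfl, hpq.le⟩, ⟨le_rfl, hs.le⟩⟩ S.cont₃.continuousOn
  have hz' := hI _ hz.2
  refine _root_.strong_maximum S.one_lt S.reac S.cont₃ S.cont₁ hσ hs (c₀ := u₃ z.1 z.2) ?_ hK hδ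
    ?_ ?_ (fun σ hσ => S.id₃.avgSol hm0 S.reac.cont S.cont₃ hσ h0.le hsT)
    (fun σ hσ => S.id₁.avgSol hm0 S.reac.cont S.cont₁ hσ h0.le hsT) ?_ hinit hlp hlq hx₀ hy hpos
  · exact S.pos₃ _ hz' _ ⟨by linarith [hz.1.1, S.antil₃ h0I hz' hz.2.1],
      by linarith [hz.1.2, S.mono₃ h0I hz' hz.2.1]⟩
  · intro x hx t ht
    exact hmin (⟨hx, ht⟩ : (x, t) ∈ Icc p q ×ˢ Icc t₀ s)
  · intro s' hs' t ht hts
    exact htime s' ⟨by linarith [hs'.1], hs'.2.trans hsT⟩ t ⟨ht.1, ht.2.trans hsT⟩ hts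
  · exact fun x _ t ht => S.nonneg₁ (hI t ht) x

theorem Sys.crossData (S : Sys m R u₁ u₃ r₁ l₃ r₃ t₁ T) {M L c d t' s X : ℝ}
    (D : CompData m M L R u₁ u₃ c d t₁ T) (ht' : t₁ ≤ t') (hs : t' < s) (hsT : s ≤ T)
    (hc : c ≤ l₃ T) (hd : r₁ T ≤ d) (hl : ∀ x ≤ X, u₃ x t' ≤ u₁ x t')
    (hr : ∀ x, X ≤ x → u₁ x t' ≤ u₃ x t') : CrossData m M L R u₁ u₃ c d t' s X := by
  have hm0 : 0 ≤ m := by linarith [S.one_lt]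
  have hI : ∀ t ∈ Icc t' s, t ∈ Icc t₁ T := fun t ht => ⟨ht'.trans ht.1, ht.2.trans hsT⟩
  have hTI : T ∈ Icc t₁ T := ⟨by linarith, le_rfl⟩
  exact
    { one_lt := S.one_lt
      L_nonneg := D.L_nonneg
      c_lt := D.c_lt
      t_lt := hs
      contR := D.contR
      contu := D.contu
      contz := D.contz
      u_mem := fun x hx t ht => D.u_mem x hx t (hI t ht)
      z_mem := fun x hx t ht => D.z_mem x hx t (hI t ht)
      lip := D.lip
      sub_u := S.id₁.avgSol hm0 S.reac.cont S.cont₁ (by simp) ht' hsT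
      super_u := S.id₁.avgSol hm0 S.reac.cont S.cont₁ (by simp) ht' hsT
      sub_z := S.id₃.avgSol hm0 S.reac.cont S.cont₃ (by simp) ht' hsT
      super_z := S.id₃.avgSol hm0 S.reac.cont S.cont₃ (by simp) ht' hsT
      left_le := fun t ht => by
        rw [S.zero₃l t (hI t ht) c (hc.trans (S.antil₃ (hI t ht) hTI (hI t ht).2))]
        exact S.nonneg₁ (hI t ht) c
      right_le := fun t ht => by
        rw [S.zero₁ t (hI t ht) d ((S.mono₁ (hI t ht) hTI (hI t ht).2).trans hd)]
        exact S.nonneg₃ (hI t ht) d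
      init_left := fun x _ hx => hl x hx
      init_right := fun x _ hx => hr x hx }

theorem Sys.exists_compData (S : Sys m R u₁ u₃ r₁ l₃ r₃ t₁ T) (ht : t₁ < T) {c d : ℝ}
    (hcd : c < d) : ∃ M L, CompData m M L R u₁ u₃ c d t₁ T :=
  S.reac.exists_compData S.one_lt hcd ht S.cont₁ S.cont₃ (fun x _ _ ht => S.nonneg₁ ht x)
    fun x _ _ ht => S.nonneg₃ ht x

/-- The difference `u₁ - u₃` never changes sign from negative to positive. -/
theorem Sys.no_reverse (S : Sys m R u₁ u₃ r₁ l₃ r₃ t₁ T) (hini : r₁ t₁ = l₃ t₁) {t p y : ℝ}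
    (ht : t ∈ Icc t₁ T) (hpy : p < y) (hp : u₁ p t < u₃ p t) : u₁ y t ≤ u₃ y t := by
  rcases ht.1.eq_or_lt with rfl | h1
  · have := S.left_lt ht hp
    rw [S.zero₁ _ ht y (by linarith)]
    exact S.nonneg₃ ht y
  have h1I : t₁ ∈ Icc t₁ T := ⟨le_rfl, by linarith [ht.2]⟩
  set c := min p (min (l₃ T) (r₁ t₁)) - 1 with hc
  set d := max y (max (r₁ T) (r₁ t₁)) + 1 with hd
  have c1 : c < p := by linarith [min_le_left p (min (l₃ T) (r₁ t₁))]
  have c2 : c < l₃ T := by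
    linarith [min_le_right p (min (l₃ T) (r₁ t₁)), min_le_left (l₃ T) (r₁ t₁)]
  have c3 : c < r₁ t₁ := by
    linarith [min_le_right p (min (l₃ T) (r₁ t₁)), min_le_right (l₃ T) (r₁ t₁)]
  have d1 : y < d := by linarith [le_max_left y (max (r₁ T) (r₁ t₁))]
  have d2 : r₁ T < d := by
    linarith [le_max_right y (max (r₁ T) (r₁ t₁)), le_max_left (r₁ T) (r₁ t₁)]
  have d3 : r₁ t₁ < d := by
    linarith [le_max_right y (max (r₁ T) (r₁ t₁)), le_max_right (r₁ T) (r₁ t₁)]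
  obtain ⟨M, L, D⟩ := S.exists_compData (h1.trans_le ht.2) (c3.trans d3)
  refine (S.crossData D (X := r₁ t₁) le_rfl h1 ht.2 c2.le d2.le ?_ ?_).no_reverse ⟨c3, d3⟩
    ⟨c1.le, by linarith⟩ ⟨by linarith, d1.le⟩ hpy hp
  · intro x hx
    rw [S.zero₃l _ h1I x (by linarith)]
    exact S.nonneg₁ h1I x
  · intro x hx
    rw [S.zero₁ _ h1I x hx]
    exact S.nonneg₃ h1I x

theorem Sys.no_reverse' (S : Sys m R u₁ u₃ r₁ l₃ r₃ t₁ T) (hini : r₁ t₁ = l₃ t₁) {t p y : ℝ}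
    (ht : t ∈ Icc t₁ T) (hpy : p < y) (hy : u₃ y t < u₁ y t) : u₃ p t ≤ u₁ p t := by
  by_contra! h
  linarith [S.no_reverse hini ht hpy h]

end

theorem exists_forall_Icc_of_eventually {t₁ s T : ℝ} (h1 : t₁ < s) (hs : s ≤ T) {P : ℝ → Prop}
    (h : ∀ᶠ t in 𝓝[Icc t₁ T] s, P t) : ∃ t₀ ∈ Ioo t₁ s, ∀ t ∈ Icc t₀ s, P t := by
  have h' : ∀ᶠ t in 𝓝[≤] s, P t := by
    rw [← nhdsWithin_Icc_eq_nhdsLE h1]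
    exact h.filter_mono (nhdsWithin_mono _ (Icc_subset_Icc_right hs))
  obtain ⟨l, hl, H⟩ := (mem_nhdsLE_iff_exists_Ioc_subset' h1).1 h'
  rw [mem_Iio] at hl
  refine ⟨(max l t₁ + s) / 2, ⟨?_, ?_⟩, fun t ht => H ⟨?_, ht.2⟩⟩
  · linarith [le_max_right l t₁, max_lt hl h1]
  · linarith [max_lt hl h1]
  · linarith [le_max_left l t₁, max_lt hl h1, ht.1]

section

variable {m : ℝ} {R u₁ u₃ : ℝ → ℝ → ℝ} {r₁ l₃ r₃ : ℝ → ℝ} {t₁ T : ℝ}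

theorem Sys.eventually_lt (S : Sys m R u₁ u₃ r₁ l₃ r₃ t₁ T) {s x : ℝ} (h : u₃ x s < u₁ x s) :
    ∀ᶠ t in 𝓝[Icc t₁ T] s, u₃ x t < u₁ x t := by
  have := ((S.cont_diff_time x).tendsto s).eventually (lt_mem_nhds (sub_pos.2 h))
  exact (this.filter_mono nhdsWithin_le_nhds).mono fun t ht => sub_pos.1 ht

theorem Sys.eventually_gt (S : Sys m R u₁ u₃ r₁ l₃ r₃ t₁ T) {s x : ℝ} (h : u₁ x s < u₃ x s) :
    ∀ᶠ t in 𝓝[Icc t₁ T] s, u₁ x t < u₃ x t := by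
  have := ((S.cont_diff_time x).tendsto s).eventually (gt_mem_nhds (sub_neg.2 h))
  exact (this.filter_mono nhdsWithin_le_nhds).mono fun t ht => sub_neg.1 ht

theorem Sys.eventually_left (S : Sys m R u₁ u₃ r₁ l₃ r₃ t₁ T) {s x : ℝ} (hs : s ∈ Icc t₁ T)
    (h : l₃ s < x) : ∀ᶠ t in 𝓝[Icc t₁ T] s, l₃ t < x :=
  (S.contl₃ s hs).eventually (gt_mem_nhds h)

theorem Sys.eventually_right (S : Sys m R u₁ u₃ r₁ l₃ r₃ t₁ T) {s x : ℝ} (hs : s ∈ Icc t₁ T)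
    (h : x < r₃ s) : ∀ᶠ t in 𝓝[Icc t₁ T] s, x < r₃ t :=
  (S.contr₃ s hs).eventually (lt_mem_nhds h)

theorem exists_between_pos_left {g : ℝ → ℝ} (hg : Continuous g) {x q : ℝ} (hxq : x < q)
    (hq : 0 < g q) : ∃ x₀ ∈ Ioo x q, 0 < g x₀ := by
  have h1 : ∀ᶠ y in 𝓝[<] q, 0 < g y :=
    (hg.tendsto q).eventually (lt_mem_nhds hq) |>.filter_mono nhdsWithin_le_nhds
  have h2 : ∀ᶠ y in 𝓝[<] q, y ∈ Ioo x q := Ioo_mem_nhdsLT hxq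
  obtain ⟨y, hy1, hy2⟩ := (h1.and h2).exists
  exact ⟨y, hy2, hy1⟩

theorem exists_between_pos_right {g : ℝ → ℝ} (hg : Continuous g) {q x : ℝ} (hxq : q < x)
    (hq : 0 < g q) : ∃ x₀ ∈ Ioo q x, 0 < g x₀ := by
  have h1 : ∀ᶠ y in 𝓝[>] q, 0 < g y :=
    (hg.tendsto q).eventually (lt_mem_nhds hq) |>.filter_mono nhdsWithin_le_nhds
  have h2 : ∀ᶠ y in 𝓝[>] q, y ∈ Ioo q x := Ioo_mem_nhdsGT hxq
  obtain ⟨y, hy1, hy2⟩ := (h1.and h2).exists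
  exact ⟨y, hy2, hy1⟩

/-- Positivity of `u₁ - u₃` spreads to the left. -/
theorem Sys.pos_left (S : Sys m R u₁ u₃ r₁ l₃ r₃ t₁ T) (hini : r₁ t₁ = l₃ t₁) {s x q : ℝ}
    (h1 : t₁ < s) (hs : s ≤ T) (hq : q < r₃ s) (hpos : u₃ q s < u₁ q s) (hx : l₃ s < x)
    (hxq : x ≤ q) : u₃ x s < u₁ x s := by
  rcases hxq.eq_or_lt with rfl | hxq
  · exact hpos
  have hsI : s ∈ Icc t₁ T := ⟨h1.le, hs⟩
  obtain ⟨x₀, hx₀, hx₀'⟩ := exists_between_pos_left (S.cont_diff_space s) hxq (sub_pos.2 hpos)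
  obtain ⟨p, hp, hpx⟩ := exists_between hx
  obtain ⟨t₀, ht₀, H⟩ := exists_forall_Icc_of_eventually h1 hs
    (((S.eventually_lt hpos).and (S.eventually_lt (sub_pos.1 hx₀'))).and
      ((S.eventually_left hsI hp).and (S.eventually_right hsI hq)))
  have H0 := H t₀ ⟨le_rfl, ht₀.2.le⟩
  have hI : ∀ t ∈ Icc t₀ s, t ∈ Icc t₁ T := fun t ht => ⟨ht₀.1.le.trans ht.1, ht.2.trans hs⟩
  have hle : ∀ t ∈ Icc t₀ s, ∀ y ≤ q, u₃ y t ≤ u₁ y t := by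
    intro t ht y hy
    rcases hy.eq_or_lt with rfl | hy
    · exact (H t ht).1.1.le
    · exact S.no_reverse' hini (hI t ht) hy (H t ht).1.1
  have := S.strong_maximum (p := p) (q := q) (x₀ := x₀) (y := x) (σ := 1) (Or.inl rfl) ht₀.1 ht₀.2
    hs H0.2.1 H0.2.2 (fun y hy => by linarith [hle t₀ ⟨le_rfl, ht₀.2.le⟩ y hy.2])
    (fun t ht => by linarith [hle t ht p (by linarith)])
    (fun t ht => by linarith [hle t ht q le_rfl]) ⟨by linarith [hx₀.1], hx₀.2⟩ ⟨hpx, hxq⟩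
    (by linarith [H0.1.2])
  linarith

/-- Negativity of `u₁ - u₃` spreads to the right. -/
theorem Sys.neg_right (S : Sys m R u₁ u₃ r₁ l₃ r₃ t₁ T) (hini : r₁ t₁ = l₃ t₁) {s p x : ℝ}
    (h1 : t₁ < s) (hs : s ≤ T) (hneg : u₁ p s < u₃ p s) (hpx : p ≤ x)
    (hx : x < r₃ s) : u₁ x s < u₃ x s := by
  rcases hpx.eq_or_lt with rfl | hpx
  · exact hneg
  have hsI : s ∈ Icc t₁ T := ⟨h1.le, hs⟩
  have hlp := S.left_lt hsI hneg
  obtain ⟨x₀, hx₀, hx₀'⟩ := exists_between_pos_right (S.cont_diff_space s).neg hpx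
    (neg_pos.2 (sub_neg.2 hneg))
  obtain ⟨q, hxq, hq⟩ := exists_between hx
  obtain ⟨t₀, ht₀, H⟩ := exists_forall_Icc_of_eventually h1 hs
    (((S.eventually_gt hneg).and (S.eventually_gt (sub_neg.1 (neg_pos.1 hx₀')))).and
      ((S.eventually_left hsI hlp).and (S.eventually_right hsI hq)))
  have H0 := H t₀ ⟨le_rfl, ht₀.2.le⟩
  have hI : ∀ t ∈ Icc t₀ s, t ∈ Icc t₁ T := fun t ht => ⟨ht₀.1.le.trans ht.1, ht.2.trans hs⟩
  have hle : ∀ t ∈ Icc t₀ s, ∀ y, p ≤ y → u₁ y t ≤ u₃ y t := by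
    intro t ht y hy
    rcases hy.eq_or_lt with rfl | hy
    · exact (H t ht).1.1.le
    · exact S.no_reverse hini (hI t ht) hy (H t ht).1.1
  have := S.strong_maximum (p := p) (q := q) (x₀ := x₀) (y := x) (σ := -1) (Or.inr rfl) ht₀.1 ht₀.2
    hs H0.2.1 H0.2.2 (fun y hy => by linarith [hle t₀ ⟨le_rfl, ht₀.2.le⟩ y hy.1])
    (fun t ht => by linarith [hle t ht p le_rfl])
    (fun t ht => by linarith [hle t ht q (by linarith)]) ⟨hx₀.1, by linarith [hx₀.2]⟩ ⟨hpx, hxq⟩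
    (by linarith [H0.1.2])
  linarith

end

theorem forall_pos_of_ne_zero {g : ℝ → ℝ} (hg : Continuous g) {a b : ℝ}
    (h : ∀ x ∈ Icc a b, g x ≠ 0) {c : ℝ} (hc : c ∈ Icc a b) (hpos : 0 < g c) :
    ∀ x ∈ Icc a b, 0 < g x := by
  intro x hx
  by_contra! hx'
  obtain ⟨z, hz, hz0⟩ := intermediate_value_uIcc (a := c) (b := x) hg.continuousOn
    (mem_uIcc_of_ge hx' hpos.le)
  exact h z (uIcc_subset_Icc hc hx hz) hz0

section

variable {m : ℝ} {R u₁ u₃ : ℝ → ℝ → ℝ} {r₁ l₃ r₃ : ℝ → ℝ} {t₁ T : ℝ}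

/-- A zero of `u₁ - u₃` inside the support of `u₃` separates the two signs. -/
theorem Sys.sign_of_eq (S : Sys m R u₁ u₃ r₁ l₃ r₃ t₁ T) (hini : r₁ t₁ = l₃ t₁) {t X : ℝ}
    (h1 : t₁ < t) (ht : t ≤ T) (hr : r₁ t ≤ r₃ t) (hlX : l₃ t < X) (hXr : X < r₃ t)
    (hX : u₁ X t = u₃ X t) :
    (∀ x ≤ X, u₃ x t ≤ u₁ x t) ∧ ∀ x, X ≤ x → u₁ x t ≤ u₃ x t := by
  have htI : t ∈ Icc t₁ T := ⟨h1.le, ht⟩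
  constructor
  · intro x hx
    by_contra! h
    exact (S.neg_right hini h1 ht h hx hXr).ne hX
  · intro x hx
    rcases le_or_gt (r₃ t) x with h | h
    · rw [S.zero₁ t htI x (hr.trans h)]
      exact S.nonneg₃ htI x
    · by_contra! h'
      exact (S.pos_left hini h1 ht h h' hlX hx).ne' hX

/-- Near an interval on which `u₁ = u₃` at time `s`, the difference has a constant sign on a
smaller interval at every slightly earlier time. -/
theorem Sys.trichotomy (S : Sys m R u₁ u₃ r₁ l₃ r₃ t₁ T) (hini : r₁ t₁ = l₃ t₁) {s y ρ : ℝ}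
    (h1 : t₁ < s) (hs : s ≤ T) (hr : ∀ t ∈ Ico t₁ s, r₁ t ≤ r₃ t) (hρ : 0 < ρ)
    (hl : l₃ s < y - ρ) (hrs : y + ρ < r₃ s) (hw : ∀ x ∈ Icc (y - ρ) (y + ρ), u₁ x s = u₃ x s) :
    ∃ t₀ ∈ Ioo t₁ s, ∀ t ∈ Ico t₀ s,
      (∀ x ∈ Icc (y - ρ / 8) (y + ρ / 8), u₁ x t - u₃ x t ≠ 0) ∨
      ∀ x ∈ Icc (y - ρ / 8) (y + ρ / 8), u₁ x t = u₃ x t := by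
  have hsI : s ∈ Icc t₁ T := ⟨h1.le, hs⟩
  set c := min (l₃ T) (y - ρ) with hc
  set d := max (r₁ T) (y + ρ) with hd
  have c1 : c ≤ l₃ T := min_le_left _ _
  have c2 : c ≤ y - ρ := min_le_right _ _
  have d1 : r₁ T ≤ d := le_max_left _ _
  have d2 : y + ρ ≤ d := le_max_right _ _
  obtain ⟨M, L, D⟩ := S.exists_compData (h1.trans_le hs) (show c < d by linarith)
  obtain ⟨δ₀, hδ₀, H⟩ := crossing_rigidity (m := m) (M := M) (L := L) (R := R) (s := ρ / 16) hρ
    (by positivity) c2 d2 hw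
  have hev : ∀ᶠ t in 𝓝[Icc t₁ T] s, s - δ₀ < t :=
    (lt_mem_nhds (by linarith : s - δ₀ < s)).filter_mono nhdsWithin_le_nhds
  obtain ⟨t₀, ht₀, H0⟩ := exists_forall_Icc_of_eventually h1 hs
    (hev.and ((S.eventually_left hsI hl).and (S.eventually_right hsI hrs)))
  refine ⟨t₀, ht₀, fun t ht => ?_⟩
  obtain ⟨e1, e2, e3⟩ := H0 t ⟨ht.1, ht.2.le⟩
  have ht1 : t₁ < t := ht₀.1.trans_le ht.1
  have rigid : ∀ X, |X - y| ≤ ρ / 4 → u₁ X t = u₃ X t → ∀ x, |x - y| ≤ ρ / 4 → ρ / 16 ≤ |x - X| →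
      u₁ x t = u₃ x t := by
    intro X hX hX0
    obtain ⟨a1, a2⟩ := abs_le.1 hX
    obtain ⟨b1, b2⟩ := S.sign_of_eq hini ht1 (by linarith [ht.2]) (hr t ⟨ht1.le, ht.2⟩)
      (by linarith) (by linarith) hX0
    exact H t ⟨e1, ht.2⟩ X hX (S.crossData D ht1.le ht.2 hs c1 d1 b1 b2)
  by_cases h : ∀ x ∈ Icc (y - ρ / 8) (y + ρ / 8), u₁ x t - u₃ x t ≠ 0
  · exact Or.inl h
  right
  push Not at h
  obtain ⟨X, hX, hX0⟩ := h
  obtain ⟨a1, a2⟩ := hX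
  have hr4 : |y + ρ / 4 - y| ≤ ρ / 4 := by rw [add_sub_cancel_left, abs_of_pos (by positivity)]
  have h4 := rigid X (abs_le.2 ⟨by linarith, by linarith⟩) (by linarith) (y + ρ / 4) hr4
    (le_abs.2 (Or.inl (by linarith)))
  intro x hx
  obtain ⟨b1, b2⟩ := hx
  exact rigid _ hr4 h4 x (abs_le.2 ⟨by linarith, by linarith⟩) (le_abs.2 (Or.inr (by linarith)))

/-- If `u₁ - u₃` vanishes at time `s` on an interval, then so it does at earlier times. -/
theorem Sys.plateau_backward (S : Sys m R u₁ u₃ r₁ l₃ r₃ t₁ T) {s t₀ ν₁ ν₂ : ℝ}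
    (h1 : t₁ < t₀) (hts : t₀ < s) (hs : s ≤ T) (hν : ν₁ < ν₂) (hl : l₃ t₀ < ν₁)
    (hr : ν₂ < r₃ t₀)
    (htri : ∀ t ∈ Ico t₀ s, (∀ x ∈ Icc ν₁ ν₂, u₁ x t - u₃ x t ≠ 0) ∨
      ∀ x ∈ Icc ν₁ ν₂, u₁ x t = u₃ x t)
    (hw : ∀ x ∈ Icc ν₁ ν₂, u₁ x s = u₃ x s) : ∀ x ∈ Icc ν₁ ν₂, u₁ x t₀ = u₃ x t₀ := by
  rcases htri t₀ ⟨le_rfl, hts⟩ with h0 | h0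
  swap
  · exact h0
  exfalso
  have hν2 : ν₂ ∈ Icc ν₁ ν₂ := ⟨hν.le, le_rfl⟩
  have hν1 : ν₁ ∈ Icc ν₁ ν₂ := ⟨le_rfl, hν.le⟩
  obtain ⟨σ, hσ, hσ0⟩ : ∃ σ : ℝ, (σ = 1 ∨ σ = -1) ∧ 0 < σ * (u₁ ν₂ t₀ - u₃ ν₂ t₀) := by
    rcases lt_or_gt_of_ne (h0 ν₂ hν2) with h | h
    · exact ⟨-1, Or.inr rfl, by linarith⟩
    · exact ⟨1, Or.inl rfl, by linarith⟩
  have hσne : σ ≠ 0 := by rintro rfl; simp at hσ0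
  set Z := {t ∈ Icc t₀ s | u₁ ν₂ t - u₃ ν₂ t = 0} with hZ
  have hZc : IsCompact Z :=
    isCompact_Icc.inter_right (isClosed_singleton.preimage (S.cont_diff_time ν₂) :
      IsClosed {t | u₁ ν₂ t - u₃ ν₂ t = 0})
  obtain ⟨τ, hτ, hmin⟩ := hZc.exists_isLeast ⟨s, ⟨hts.le, le_rfl⟩, sub_eq_zero.2 (hw ν₂ hν2)⟩
  have hτ0 : t₀ < τ := by
    refine hτ.1.1.lt_of_ne ?_
    rintro rfl
    exact h0 ν₂ hν2 hτ.2
  have hzero : ∀ x ∈ Icc ν₁ ν₂, u₁ x τ = u₃ x τ := by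
    rcases hτ.1.2.eq_or_lt with h | h
    · rwa [h]
    · exact (htri τ ⟨hτ0.le, h⟩).resolve_left fun h' => h' ν₂ hν2 hτ.2
  have hsign : ∀ t ∈ Ico t₀ τ, ∀ x ∈ Icc ν₁ ν₂, 0 < σ * (u₁ x t - u₃ x t) := by
    intro t ht
    have hne : ∀ r ∈ Icc t₀ t, σ * (u₁ ν₂ r - u₃ ν₂ r) ≠ 0 := fun r hr hr0 =>
      absurd (hmin (show r ∈ Z from ⟨⟨hr.1, by linarith [hr.2, ht.2, hτ.1.2]⟩,
        (mul_eq_zero.1 hr0).resolve_left hσne⟩)) (by linarith [hr.2, ht.2])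
    have hpos := forall_pos_of_ne_zero ((S.cont_diff_time ν₂).const_mul σ) hne
      ⟨le_rfl, ht.1⟩ hσ0 t ⟨ht.1, le_rfl⟩
    rcases htri t ⟨ht.1, ht.2.trans_le hτ.1.2⟩ with h | h
    · exact forall_pos_of_ne_zero ((S.cont_diff_space t).const_mul σ)
        (fun x hx => mul_ne_zero hσne (h x hx)) hν2 hpos
    · rw [h ν₂ hν2] at hpos
      simp at hpos
  have hlat : ∀ t ∈ Icc t₀ τ, ∀ x ∈ Icc ν₁ ν₂, 0 ≤ σ * (u₁ x t - u₃ x t) := by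
    intro t ht x hx
    rcases ht.2.eq_or_lt with rfl | h
    · rw [hzero x hx, sub_self, mul_zero]
    · exact (hsign t ⟨ht.1, h⟩ x hx).le
  have hmid : (ν₁ + ν₂) / 2 ∈ Ioo ν₁ ν₂ := ⟨by linarith, by linarith⟩
  have := S.strong_maximum hσ h1 hτ0 (hτ.1.2.trans hs) hl hr (hlat t₀ ⟨le_rfl, hτ0.le⟩)
    (fun t ht => hlat t ht ν₁ hν1) (fun t ht => hlat t ht ν₂ hν2) hmid hmid
    (hsign t₀ ⟨le_rfl, hτ0⟩ _ (Ioo_subset_Icc_self hmid))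
  rw [hzero _ (Ioo_subset_Icc_self hmid)] at this
  simp at this

/-- The solutions never coincide on an interval inside the support of `u₃`. -/
theorem Sys.no_plateau (S : Sys m R u₁ u₃ r₁ l₃ r₃ t₁ T) (hini : r₁ t₁ = l₃ t₁) {s p q : ℝ}
    (h1 : t₁ < s) (hs : s ≤ T) (hr : ∀ t ∈ Ico t₁ s, r₁ t ≤ r₃ t) (hpq : p < q)
    (hp : l₃ s < p) (hq : q < r₃ s) (hw : ∀ x ∈ Icc p q, u₁ x s = u₃ x s) : False := by
  have hsI : s ∈ Icc t₁ T := ⟨h1.le, hs⟩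
  have hl : 0 < u₁ (l₃ s) s - u₃ (l₃ s) s := by
    rw [S.zero₃l s hsI _ le_rfl, sub_zero]
    refine S.pos₁ s hsI _ (hp.trans ?_)
    by_contra! h
    have e1 := S.zero₁ s hsI p h
    have e2 := S.pos₃ s hsI p ⟨hp, hpq.trans hq⟩
    linarith [hw p ⟨le_rfl, hpq.le⟩]
  set A := {x ∈ Icc (l₃ s) p | 0 < u₁ x s - u₃ x s} with hA
  obtain ⟨xb, hxb, hxb0⟩ := exists_between_pos_right (S.cont_diff_space s) hp hl
  have hbA : xb ∈ A := ⟨⟨hxb.1.le, hxb.2.le⟩, hxb0⟩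
  have hAb : BddAbove A := ⟨p, fun x hx => hx.1.2⟩
  set xa := sSup A with hxa
  have hab : xb ≤ xa := le_csSup hAb hbA
  have hap : xa ≤ p := csSup_le ⟨xb, hbA⟩ fun x hx => hx.1.2
  have hzero : ∀ x, xa < x → x ≤ q → u₁ x s = u₃ x s := by
    intro x hx hxq
    rcases le_or_gt p x with h | h
    · exact hw x ⟨h, hxq⟩
    apply le_antisymm
    · by_contra! h'
      exact absurd (le_csSup hAb (show x ∈ A from ⟨⟨by linarith [hxb.1], h.le⟩, sub_pos.2 h'⟩))
        (not_le.2 hx)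
    · by_contra! h'
      exact (S.neg_right hini h1 hs h' h.le (by linarith)).ne (hw p ⟨le_rfl, hpq.le⟩)
  obtain ⟨xc, hxc, hcb⟩ := exists_between hxb.1
  obtain ⟨y, ρ, hρ, hy1, hy2⟩ : ∃ y ρ, 0 < ρ ∧ xa < y - ρ ∧ y + ρ < q :=
    ⟨(xa + q) / 2, (q - xa) / 4, by linarith, by linarith, by linarith⟩
  have hwy : ∀ x ∈ Icc (y - ρ) (y + ρ), u₁ x s = u₃ x s := fun x hx =>
    hzero x (by linarith [hx.1]) (by linarith [hx.2])
  have hwν : ∀ x ∈ Icc (y - ρ / 8) (y + ρ / 8), u₁ x s = u₃ x s := fun x hx =>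
    hwy x ⟨by linarith [hx.1], by linarith [hx.2]⟩
  obtain ⟨t₂, ht₂, htri⟩ := S.trichotomy hini h1 hs hr hρ (by linarith) (by linarith) hwy
  have hev : ∀ᶠ t in 𝓝[Icc t₁ T] s, t₂ < t :=
    (lt_mem_nhds ht₂.2).filter_mono nhdsWithin_le_nhds
  obtain ⟨t₀, ht₀, H⟩ := exists_forall_Icc_of_eventually h1 hs
    ((hev.and (S.eventually_lt (sub_pos.1 hxb0))).and
      ((S.eventually_left hsI hxc).and (S.eventually_right hsI hq)))
  have hν2 : y + ρ / 8 ∈ Icc (y - ρ / 8) (y + ρ / 8) := ⟨by linarith, le_rfl⟩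
  have hback : ∀ t ∈ Icc t₀ s, ∀ x ∈ Icc (y - ρ / 8) (y + ρ / 8), u₁ x t = u₃ x t := by
    intro t ht
    rcases ht.2.eq_or_lt with rfl | hts
    · exact hwν
    obtain ⟨⟨a1, -⟩, a3, a4⟩ := H t ht
    exact S.plateau_backward (ht₀.1.trans_le ht.1) hts hs (by linarith) (by linarith) (by linarith)
      (fun r hr => htri r ⟨by linarith [hr.1], hr.2⟩) hwν
  have hle : ∀ t ∈ Icc t₀ s, ∀ x ≤ y + ρ / 8, u₃ x t ≤ u₁ x t := by
    intro t ht x hx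
    obtain ⟨⟨-, -⟩, -, a4⟩ := H t ht
    by_contra! h
    exact (S.neg_right hini (ht₀.1.trans_le ht.1) (ht.2.trans hs) h hx (by linarith)).ne
      (hback t ht _ hν2)
  have h0I : t₀ ∈ Icc t₀ s := ⟨le_rfl, ht₀.2.le⟩
  obtain ⟨⟨-, a2⟩, a3, a4⟩ := H t₀ h0I
  have := S.strong_maximum (p := xc) (q := y + ρ / 8) (x₀ := xb) (y := y) (σ := 1) (Or.inl rfl)
    ht₀.1 ht₀.2 hs a3 (by linarith) (fun x hx => by linarith [hle t₀ h0I x hx.2])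
    (fun t ht => by linarith [hle t ht xc (by linarith)])
    (fun t ht => by linarith [hle t ht _ le_rfl]) ⟨hcb, by linarith⟩ ⟨by linarith, by linarith⟩
    (by linarith)
  linarith [hwν y ⟨by linarith, by linarith⟩]

end

section

variable {m : ℝ} {R u₁ u₃ : ℝ → ℝ → ℝ} {r₁ l₃ r₃ : ℝ → ℝ} {t₁ T : ℝ}

theorem Sys.exists_crossing (S : Sys m R u₁ u₃ r₁ l₃ r₃ t₁ T) (hini : r₁ t₁ = l₃ t₁) {t : ℝ}
    (h1 : t₁ < t) (ht : t ≤ T) (hr : ∀ τ ∈ Ico t₁ t, r₁ τ ≤ r₃ τ) (hlr : l₃ t < r₁ t)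
    (hrr : r₁ t < r₃ t) :
    ∃ X, l₃ t < X ∧ X < r₁ t ∧ (∀ x, l₃ t ≤ x → x < X → u₃ x t < u₁ x t) ∧
      ∀ x, X < x → x ≤ r₁ t → u₁ x t < u₃ x t := by
  have htI : t ∈ Icc t₁ T := ⟨h1.le, ht⟩
  have hl : u₃ (l₃ t) t < u₁ (l₃ t) t := by
    rw [S.zero₃l t htI _ le_rfl]
    exact S.pos₁ t htI _ hlr
  have hr' : u₁ (r₁ t) t < u₃ (r₁ t) t := by
    rw [S.zero₁ t htI _ le_rfl]
    exact S.pos₃ t htI _ ⟨hlr, hrr⟩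
  obtain ⟨X, hX, hX0⟩ := intermediate_value_Icc' hlr.le (S.cont_diff_space t).continuousOn
    (show (0 : ℝ) ∈ Icc _ _ from ⟨(sub_neg.2 hr').le, (sub_pos.2 hl).le⟩)
  have hX0' : u₁ X t = u₃ X t := sub_eq_zero.1 hX0
  have hlX : l₃ t < X := hX.1.lt_of_ne (by rintro rfl; exact hl.ne' hX0')
  have hXr : X < r₁ t := hX.2.lt_of_ne (by rintro rfl; exact hr'.ne hX0')
  obtain ⟨s1, s2⟩ := S.sign_of_eq hini h1 ht hrr.le hlX (hXr.trans hrr) hX0'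
  refine ⟨X, hlX, hXr, fun x hlx hxX => (s1 x hxX.le).lt_of_ne fun h => ?_,
    fun x hXx hxr => (s2 x hXx.le).lt_of_ne fun h => ?_⟩
  · have hlx' : l₃ t < x := hlx.lt_of_ne (by rintro rfl; exact hl.ne h)
    obtain ⟨s3, s4⟩ := S.sign_of_eq hini h1 ht hrr.le hlx' (by linarith) h.symm
    exact S.no_plateau hini h1 ht hr hxX hlx' (hXr.trans hrr) fun z hz =>
      le_antisymm (s4 z hz.1) (s1 z hz.2)
  · obtain ⟨s3, s4⟩ := S.sign_of_eq hini h1 ht hrr.le (by linarith) (by linarith) h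
    exact S.no_plateau hini h1 ht hr hXx hlX (by linarith) fun z hz =>
      le_antisymm (s2 z hz.1) (s3 z hz.2)

/-- When the right free boundaries meet, no region with `u₁ < u₃` is left. -/
theorem Sys.lt_of_meet (S : Sys m R u₁ u₃ r₁ l₃ r₃ t₁ T) (hini : r₁ t₁ = l₃ t₁) {s x : ℝ}
    (h1 : t₁ < s) (hs : s ≤ T) (hr : ∀ t ∈ Ico t₁ s, r₁ t < r₃ t) (hrs : r₁ s = r₃ s)
    (hx : x ∈ Ioo (l₃ s) (r₃ s)) : u₃ x s < u₁ x s := by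
  have hsI : s ∈ Icc t₁ T := ⟨h1.le, hs⟩
  have hTI : T ∈ Icc t₁ T := ⟨h1.le.trans hs, le_rfl⟩
  have hnn : ∀ x ∈ Ioo (l₃ s) (r₃ s), u₃ x s ≤ u₁ x s := by
    intro x hx
    by_contra! h
    obtain ⟨s₀, hs₀, H⟩ := exists_forall_Icc_of_eventually h1 hs
      ((S.eventually_gt h).and (S.eventually_left hsI hx.1))
    have hs₀I : s₀ ∈ Icc t₁ T := ⟨hs₀.1.le, hs₀.2.le.trans hs⟩
    obtain ⟨ρ, hρ, hρ'⟩ := exists_between (hr s₀ ⟨hs₀.1.le, hs₀.2⟩)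
    obtain ⟨ξ, hξ, t, ht, hle⟩ := exists_translate_le S.one_lt S.reac S.cont₁ S.cont₃ S.id₁ S.id₃
      (fun t ht x => S.nonneg₁ ht x) (fun t ht x => S.nonneg₃ ht x) (y := x) (D := r₁ T)
      hs₀.1.le hs₀.2.le hs hρ (fun t ht z hz => S.zero₁ t ht z ((S.mono₁ ht hTI ht.2).trans hz))
      (fun z hz => S.zero₁ _ hs₀I z hz)
      (fun z hz => S.neg_right hini hs₀.1 hs₀I.2 (H s₀ ⟨le_rfl, hs₀.2.le⟩).1 hz.1
        (hz.2.trans_lt hρ')) (fun t ht => (H t ht).1)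
    obtain ⟨a, ha, har⟩ := exists_between (show max x (r₁ s - ξ) < r₁ s from
      max_lt (by linarith [hx.2]) (by linarith))
    have htI : t ∈ Icc t₁ T := ⟨by linarith [ht.1, hs₀.1], ht.2.trans hs⟩
    have h2 := hle (a + ξ) (by linarith [le_max_left x (r₁ s - ξ)])
    rw [add_sub_cancel_right, S.zero₃r t htI (a + ξ)
      (by linarith [le_max_right x (r₁ s - ξ), S.mono₃ htI hsI ht.2])] at h2
    linarith [S.pos₁ s hsI a har]
  refine (hnn x hx).lt_of_ne fun h => ?_
  obtain ⟨q, hxq, hq⟩ := exists_between hx.2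
  obtain ⟨-, s2⟩ := S.sign_of_eq hini h1 hs hrs.le hx.1 hx.2 h.symm
  exact S.no_plateau hini h1 hs (fun t ht => (hr t ht).le) hxq hx.1 hq fun z hz =>
    le_antisymm (s2 z hz.1) (hnn z ⟨hx.1.trans_le hz.1, hz.2.trans_lt hq⟩)

theorem Sys.ordered (S : Sys m R u₁ u₃ r₁ l₃ r₃ t₁ T) {s : ℝ} (h1 : t₁ ≤ s)
    (hord : ∀ x, u₃ x s ≤ u₁ x s) {t : ℝ} (ht : t ∈ Icc s T) (x : ℝ) : u₃ x t ≤ u₁ x t := by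
  have hm0 : 0 ≤ m := by linarith [S.one_lt]
  have hI : ∀ r ∈ Icc s t, r ∈ Icc t₁ T := fun r hr => ⟨h1.trans hr.1, hr.2.trans ht.2⟩
  have hTI : T ∈ Icc t₁ T := ⟨h1.trans (ht.1.trans ht.2), le_rfl⟩
  have c1 : min x (l₃ T) - 1 < x := by linarith [min_le_left x (l₃ T)]
  have c2 : min x (l₃ T) - 1 < l₃ T := by linarith [min_le_right x (l₃ T)]
  have d1 : x < max x (r₃ T) + 1 := by linarith [le_max_left x (r₃ T)]
  have d2 : r₃ T < max x (r₃ T) + 1 := by linarith [le_max_right x (r₃ T)]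
  refine S.reac.comparison S.one_lt (c1.trans d1) ht.1 S.cont₃ S.cont₁
    (fun x _ r hr => S.nonneg₃ (hI r hr) x) (fun x _ r hr => S.nonneg₁ (hI r hr) x)
    (S.id₃.avgSol hm0 S.reac.cont S.cont₃ (by simp) h1 ht.2)
    (S.id₁.avgSol hm0 S.reac.cont S.cont₁ (by simp) h1 ht.2) (fun x _ => hord x) ?_ ?_ x
    ⟨c1.le, d1.le⟩
  · intro r hr
    rw [S.zero₃l r (hI r hr) _ (c2.le.trans (S.antil₃ (hI r hr) hTI (hI r hr).2))]
    exact S.nonneg₁ (hI r hr) _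
  · intro r hr
    rw [S.zero₃r r (hI r hr) _ ((S.mono₃ (hI r hr) hTI (hI r hr).2).trans d2.le)]
    exact S.nonneg₁ (hI r hr) _

theorem Sys.ordered_of_lt (S : Sys m R u₁ u₃ r₁ l₃ r₃ t₁ T) {s : ℝ} (hs : s ∈ Icc t₁ T)
    (hpos : ∀ x ∈ Ioo (l₃ s) (r₃ s), u₃ x s < u₁ x s) (x : ℝ) : u₃ x s ≤ u₁ x s := by
  by_contra! h
  exact absurd (hpos x ⟨S.left_lt hs h, S.lt_right hs h⟩) h.not_gt

theorem Sys.right_le_of_ordered (S : Sys m R u₁ u₃ r₁ l₃ r₃ t₁ T) {t : ℝ} (ht : t ∈ Icc t₁ T)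
    (hord : ∀ x, u₃ x t ≤ u₁ x t) : r₃ t ≤ r₁ t := by
  by_contra! h
  obtain ⟨x, hx, hxr⟩ := exists_between (max_lt h (S.lt₃ t ht))
  have e1 := S.zero₁ t ht x ((le_max_left _ _).trans hx.le)
  have e2 := S.pos₃ t ht x ⟨(le_max_right _ _).trans_lt hx, hxr⟩
  linarith [hord x]

theorem Sys.lt_of_ordered (S : Sys m R u₁ u₃ r₁ l₃ r₃ t₁ T) {s : ℝ} (h1 : t₁ ≤ s)
    (hord : ∀ x, u₃ x s ≤ u₁ x s) {t : ℝ} (hst : s < t) (ht : t ≤ T) {x : ℝ}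
    (hx : x ∈ Ioo (l₃ t) (r₃ t)) : u₃ x t < u₁ x t := by
  have h1t := h1.trans_lt hst
  have htI : t ∈ Icc t₁ T := ⟨h1t.le, ht⟩
  have hev : ∀ᶠ r in 𝓝[Icc t₁ T] t, s < r :=
    (lt_mem_nhds hst).filter_mono nhdsWithin_le_nhds
  obtain ⟨t₀, ht₀, H⟩ := exists_forall_Icc_of_eventually h1t ht
    (hev.and ((S.eventually_left htI hx.1).and (S.eventually_right htI hx.2)))
  obtain ⟨e1, e2, e3⟩ := H t₀ ⟨le_rfl, ht₀.2.le⟩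
  have ht₀I : t₀ ∈ Icc t₁ T := ⟨ht₀.1.le, ht₀.2.le.trans ht⟩
  have hle : ∀ r ∈ Icc t₀ t, ∀ x, u₃ x r ≤ u₁ x r := fun r hr x =>
    S.ordered h1 hord ⟨by linarith [hr.1], hr.2.trans ht⟩ x
  have h0 := hle t₀ ⟨le_rfl, ht₀.2.le⟩
  have hl : 0 < u₁ (l₃ t₀) t₀ - u₃ (l₃ t₀) t₀ := by
    rw [S.zero₃l t₀ ht₀I _ le_rfl, sub_zero]
    exact S.pos₁ t₀ ht₀I _ ((S.lt₃ t₀ ht₀I).trans_le (S.right_le_of_ordered ht₀I h0))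
  obtain ⟨x₀, hx₀, hx₀'⟩ := exists_between_pos_right (S.cont_diff_space t₀) e2 hl
  obtain ⟨p, hp, hpx⟩ := exists_between hx₀.1
  obtain ⟨q, hxq, hq⟩ := exists_between e3
  have := S.strong_maximum (σ := 1) (Or.inl rfl) ht₀.1 ht₀.2 ht hp hq
    (fun x _ => by linarith [h0 x]) (fun r hr => by linarith [hle r hr p])
    (fun r hr => by linarith [hle r hr q]) (x₀ := x₀) (y := x) ⟨hpx, by linarith [hx₀.2]⟩
    ⟨by linarith [hx₀.2], hxq⟩ (by linarith)
  linarith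

/-- Once strictly separated, the right free boundaries stay separated. -/
theorem Sys.right_lt (S : Sys m R u₁ u₃ r₁ l₃ r₃ t₁ T) {s : ℝ} (h1 : t₁ ≤ s)
    (hpos : ∀ x ∈ Ioo (l₃ s) (r₃ s), u₃ x s < u₁ x s) (hr : r₃ s < r₁ s) {t : ℝ}
    (ht : t ∈ Icc s T) : r₃ t < r₁ t := by
  have hsI : s ∈ Icc t₁ T := ⟨h1, ht.1.trans ht.2⟩
  have htI : t ∈ Icc t₁ T := ⟨h1.trans ht.1, ht.2⟩
  have hTI : T ∈ Icc t₁ T := ⟨htI.1.trans ht.2, le_rfl⟩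
  have hord := S.ordered_of_lt hsI hpos
  obtain ⟨y, hy1, hy2⟩ := exists_between (S.lt₃ s hsI)
  obtain ⟨ρ, hρ1, hρ2⟩ := exists_between hr
  obtain ⟨ξ, hξ, t', ht', hle⟩ := exists_translate_le S.one_lt S.reac S.cont₃ S.cont₁ S.id₃ S.id₁
    (fun t ht x => S.nonneg₃ ht x) (fun t ht x => S.nonneg₁ ht x) (y := y) (D := r₃ T)
    h1 ht.1 ht.2 hρ1 (fun t ht z hz => S.zero₃r t ht z ((S.mono₃ ht hTI ht.2).trans hz))
    (fun z hz => S.zero₃r _ hsI z hz)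
    (by
      intro x hx
      rcases lt_or_ge x (r₃ s) with h | h
      · exact hpos x ⟨hy1.trans_le hx.1, h⟩
      · rw [S.zero₃r s hsI x h]
        exact S.pos₁ s hsI x (hx.2.trans_lt hρ2))
    (by
      intro r hr
      have hrI : r ∈ Icc t₁ T := ⟨h1.trans hr.1, hr.2.trans ht.2⟩
      rcases hr.1.eq_or_lt with rfl | h
      · exact hpos y ⟨hy1, hy2⟩
      · exact S.lt_of_ordered h1 hord h hrI.2 ⟨(S.antil₃ hsI hrI hr.1).trans_lt hy1,
          hy2.trans_le (S.mono₃ hsI hrI hr.1)⟩)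
  by_contra! hle'
  obtain ⟨a, ha, har⟩ := exists_between (show max y (r₃ t - ξ) < r₃ t from
    max_lt (hy2.trans_le (S.mono₃ hsI htI ht.1)) (by linarith))
  have ht'I : t' ∈ Icc t₁ T := ⟨h1.trans ht'.1, ht'.2.trans ht.2⟩
  have h2 := hle (a + ξ) (by linarith [le_max_left y (r₃ t - ξ)])
  rw [add_sub_cancel_right, S.zero₁ t' ht'I (a + ξ)
    (by linarith [le_max_right y (r₃ t - ξ), S.mono₁ ht'I htI ht'.2])] at h2
  linarith [S.pos₃ t htI a ⟨by linarith [le_max_left y (r₃ t - ξ), S.antil₃ hsI htI ht.1], har⟩]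

end

/-- The order of the stages follows from the behaviour of the free boundaries. -/
theorem exists_stages {r₁ l₃ r₃ : ℝ → ℝ} {t₁ t₂ : ℝ} (ht : t₁ < t₂)
    (c₁ : ContinuousOn r₁ (Ico t₁ t₂)) (cl : ContinuousOn l₃ (Ico t₁ t₂))
    (c₃ : ContinuousOn r₃ (Ico t₁ t₂)) (mono₁ : MonotoneOn r₁ (Ico t₁ t₂))
    (anti : AntitoneOn l₃ (Ico t₁ t₂)) (lt₃ : ∀ t ∈ Ico t₁ t₂, l₃ t < r₃ t)
    (hini : r₁ t₁ = l₃ t₁) {Tri G : ℝ → Prop}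
    (hA : ∀ t ∈ Ioo t₁ t₂, (∀ τ ∈ Ico t₁ t, r₁ τ < r₃ τ) → l₃ t < r₁ t → r₁ t < r₃ t → Tri t)
    (hB : ∀ t ∈ Ioo t₁ t₂, (∀ τ ∈ Ico t₁ t, r₁ τ < r₃ τ) → r₁ t = r₃ t → G t)
    (hC : ∀ s ∈ Ico t₁ t₂, r₃ s ≤ r₁ s → G s → ∀ t ∈ Ico s t₂, r₃ t ≤ r₁ t ∧ G t)
    (hD : ∀ s ∈ Ico t₁ t₂, r₃ s < r₁ s → G s → ∀ t ∈ Ico s t₂, r₃ t < r₁ t) :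
    (∀ t ∈ Ico t₁ t₂, r₁ t = l₃ t) ∨
    ∃ s₃ s₄ s₅ : ℝ, t₁ ≤ s₃ ∧ s₃ < s₄ ∧ s₄ ≤ s₅ ∧ s₅ ≤ t₂ ∧
      (∀ t ∈ Icc t₁ s₃, r₁ t = l₃ t) ∧ (∀ t ∈ Ioo s₃ s₄, Tri t) ∧
      (∀ t ∈ Icc s₄ s₅ ∩ Ico t₁ t₂, r₃ t = r₁ t ∧ G t) ∧ (∀ t ∈ Ioo s₅ t₂, r₃ t < r₁ t ∧ G t) := by
  have h1I : t₁ ∈ Ico t₁ t₂ := ⟨le_rfl, ht⟩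
  have hge : ∀ t ∈ Ico t₁ t₂, l₃ t ≤ r₁ t := fun t h => by
    linarith [mono₁ h1I h h.1, anti h1I h h.1]
  rcases forall_or_exists_not fun t => t ∈ Ico t₁ t₂ → r₁ t = l₃ t with h | ⟨T, hT⟩
  · exact Or.inl h
  right
  push Not at hT
  obtain ⟨hTI, hT⟩ := hT
  have hTlt : l₃ T < r₁ T := (hge T hTI).lt_of_ne' hT
  have comp : ∀ a b : ℝ, t₁ ≤ a → b < t₂ → ∀ g : ℝ → ℝ, ContinuousOn g (Ico t₁ t₂) →
      ∀ K : Set ℝ, IsClosed K → IsCompact (Icc a b ∩ g ⁻¹' K) := by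
    intro a b ha hb g hg K hK
    exact isCompact_Icc.of_isClosed_subset
      ((hg.mono fun x hx => ⟨ha.trans hx.1, hx.2.trans_lt hb⟩).preimage_isClosed_of_isClosed
        isClosed_Icc hK) inter_subset_left
  obtain ⟨s₃, ⟨hs₃, hs₃0⟩, hmax⟩ := (comp t₁ T le_rfl hTI.2 _ (c₁.sub cl) {0}
    isClosed_singleton).exists_isGreatest ⟨t₁, ⟨le_rfl, hTI.1⟩, sub_eq_zero.2 hini⟩
  replace hs₃0 : r₁ s₃ = l₃ s₃ := sub_eq_zero.1 hs₃0
  have hs₃I : s₃ ∈ Ico t₁ t₂ := ⟨hs₃.1, hs₃.2.trans_lt hTI.2⟩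
  have hcontact : ∀ t ∈ Icc t₁ s₃, r₁ t = l₃ t := by
    intro t h
    have htI : t ∈ Ico t₁ t₂ := ⟨h.1, h.2.trans_lt hs₃I.2⟩
    linarith [hge t htI, mono₁ htI hs₃I h.2, anti htI hs₃I h.2]
  have hsep : ∀ t ∈ Ioo s₃ t₂, l₃ t < r₁ t := by
    intro t h
    have htI : t ∈ Ico t₁ t₂ := ⟨hs₃.1.trans h.1.le, h.2⟩
    rcases le_total t T with htT | htT
    · refine (hge t htI).lt_of_ne' fun h0 => ?_
      exact absurd (hmax ⟨⟨htI.1, htT⟩, sub_eq_zero.2 h0⟩) (not_le.2 h.1)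
    · linarith [mono₁ hTI htI htT, anti hTI htI htT]
  by_cases hE : ∀ t ∈ Ioo s₃ t₂, r₁ t < r₃ t
  · have hlt : ∀ t ∈ Ico t₁ t₂, r₁ t < r₃ t := by
      intro t h
      rcases le_or_gt t s₃ with h' | h'
      · rw [hcontact t ⟨h.1, h'⟩]
        exact lt₃ t h
      · exact hE t ⟨h', h.2⟩
    refine ⟨s₃, t₂, t₂, hs₃.1, hs₃I.2, le_rfl, le_rfl, hcontact, fun t h => ?_, fun t h => ?_,
      fun t h => ?_⟩
    · have htI : t ∈ Ioo t₁ t₂ := ⟨hs₃.1.trans_lt h.1, h.2⟩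
      exact hA t htI (fun τ hτ => hlt τ ⟨hτ.1, hτ.2.trans htI.2⟩) (hsep t h) (hE t h)
    · exact absurd h.1.1 (not_le.2 h.2.2)
    · exact absurd h.1 (not_lt.2 h.2.le)
  push Not at hE
  obtain ⟨T', hT', hT'le⟩ := hE
  obtain ⟨s₄, ⟨hs₄, hs₄le⟩, hmin⟩ := (comp s₃ T' hs₃.1 hT'.2 _ (c₃.sub c₁) (Iic 0)
    isClosed_Iic).exists_isLeast ⟨T', ⟨hT'.1.le, le_rfl⟩, sub_nonpos.2 hT'le⟩
  replace hs₄le : r₃ s₄ ≤ r₁ s₄ := sub_nonpos.1 hs₄le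
  have hs₄I : s₄ ∈ Ico t₁ t₂ := ⟨hs₃.1.trans hs₄.1, hs₄.2.trans_lt hT'.2⟩
  have hs₃₄ : s₃ < s₄ := by
    refine hs₄.1.lt_of_ne ?_
    rintro rfl
    linarith [lt₃ s₃ hs₃I]
  have hlt : ∀ t ∈ Ico t₁ s₄, r₁ t < r₃ t := by
    intro t h
    rcases le_or_gt t s₃ with h' | h'
    · rw [hcontact t ⟨h.1, h'⟩]
      exact lt₃ t ⟨h.1, h.2.trans hs₄I.2⟩
    · by_contra! h0
      exact absurd (hmin ⟨⟨h'.le, h.2.le.trans hs₄.2⟩, sub_nonpos.2 h0⟩) (not_le.2 h.2)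
  have hs₄eq : r₁ s₄ = r₃ s₄ := by
    obtain ⟨z, hz, hz0⟩ := intermediate_value_Icc' hs₃₄.le
      ((c₃.sub c₁).mono fun x hx => ⟨hs₃.1.trans hx.1, hx.2.trans_lt hs₄I.2⟩)
      (show (0 : ℝ) ∈ Icc _ _ from ⟨sub_nonpos.2 hs₄le, by
        rw [Pi.sub_apply, sub_nonneg, hs₃0]
        exact (lt₃ s₃ hs₃I).le⟩)
    replace hz0 : r₃ z = r₁ z := sub_eq_zero.1 hz0
    have := hmin ⟨⟨hz.1, hz.2.trans hs₄.2⟩, sub_nonpos.2 hz0.le⟩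
    rw [le_antisymm this hz.2, hz0]
  have hG := hC s₄ hs₄I hs₄le (hB s₄ ⟨hs₃.1.trans_lt hs₃₄, hs₄I.2⟩ hlt hs₄eq)
  set A := {t ∈ Ico s₄ t₂ | r₁ t = r₃ t} with hAdef
  have hAne : s₄ ∈ A := ⟨⟨le_rfl, hs₄I.2⟩, hs₄eq⟩
  have hAb : BddAbove A := ⟨t₂, fun t h => h.1.2.le⟩
  refine ⟨s₃, s₄, sSup A, hs₃.1, hs₃₄, le_csSup hAb hAne, csSup_le ⟨s₄, hAne⟩ fun t h => h.1.2.le,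
    hcontact, fun t h => ?_, fun t h => ?_, fun t h => ?_⟩
  · have htI : t ∈ Ioo t₁ t₂ := ⟨hs₃.1.trans_lt h.1, h.2.trans hs₄I.2⟩
    exact hA t htI (fun τ hτ => hlt τ ⟨hτ.1, hτ.2.trans h.2⟩) (hsep t ⟨h.1, htI.2⟩)
      (hlt t ⟨htI.1.le, h.2⟩)
  · obtain ⟨⟨h4, h5⟩, htI⟩ := h
    obtain ⟨g1, g2⟩ := hG t ⟨h4, htI.2⟩
    refine ⟨g1.eq_of_not_lt fun hlt' => ?_, g2⟩
    obtain ⟨b, ⟨hb, hb0⟩, hbmax⟩ := (comp s₄ t hs₄I.1 htI.2 _ (c₁.sub c₃) {0}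
      isClosed_singleton).exists_isGreatest ⟨s₄, ⟨le_rfl, h4⟩, sub_eq_zero.2 hs₄eq⟩
    replace hb0 : r₁ b = r₃ b := sub_eq_zero.1 hb0
    have hbt : b < t := hb.2.lt_of_ne (by rintro rfl; exact hlt'.ne hb0.symm)
    refine absurd (h5.trans (csSup_le ⟨s₄, hAne⟩ fun a ha => ?_)) (not_le.2 hbt)
    rcases le_or_gt a t with hat | hat
    · exact hbmax ⟨⟨ha.1.1, hat⟩, sub_eq_zero.2 ha.2⟩
    · exact absurd ha.2 (hD t htI hlt' g2 a ⟨hat.le, ha.1.2⟩).ne'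
  · have ht4 : s₄ ≤ t := (le_csSup hAb hAne).trans h.1.le
    obtain ⟨g1, g2⟩ := hG t ⟨ht4, h.2⟩
    exact ⟨g1.lt_of_ne fun h0 =>
      absurd (le_csSup hAb (show t ∈ A from ⟨⟨ht4, h.2⟩, h0.symm⟩)) (not_le.2 h.1), g2⟩

end

/-- Intersection-number property for a pressure solution `v₁` with left free
boundary `-∞` and a compactly supported pressure solution `v₃` whose supports initially touch:
either the boundaries stay in contact, or the solutions evolve through the ordered stages
contact, `▷`, `⪆`, `≻`. -/
theorem intersection_number_touching_supports
    (m : ℝ) (hm : 1 < m) (f : ℝ → ℝ → ℝ) (κ : ℝ → ℝ) (θ : ℝ)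
    (hF1 : CondF1 f κ θ) (t₁ t₂ : ℝ) (ht : t₁ < t₂)
    (v₁ v₃ : ℝ → ℝ → ℝ) (r₁ l₃ r₃ : ℝ → ℝ)
    (h₁ : PressureSolLeftInf m f κ t₁ t₂ v₁ r₁)
    (h₃ : PressureSolBdd m f κ t₁ t₂ v₃ l₃ r₃)
    (hini : r₁ t₁ = l₃ t₁) :
    (∀ t ∈ Ico t₁ t₂, r₁ t = l₃ t) ∨
    ∃ s₃ s₄ s₅ : ℝ, t₁ ≤ s₃ ∧ s₃ < s₄ ∧ s₄ ≤ s₅ ∧ s₅ ≤ t₂ ∧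
      (∀ t ∈ Icc t₁ s₃, r₁ t = l₃ t) ∧
      (∀ t ∈ Ioo s₃ s₄, TriRelMix (fun x => v₁ x t) (fun x => v₃ x t) (r₁ t) (l₃ t) (r₃ t)) ∧
      (∀ t ∈ Icc s₄ s₅ ∩ Ico t₁ t₂,
        SteepGeMix (fun x => v₁ x t) (fun x => v₃ x t) (r₁ t) (l₃ t) (r₃ t)) ∧
      (∀ t ∈ Ioo s₅ t₂,
        SteepGtMix (fun x => v₁ x t) (fun x => v₃ x t) (r₁ t) (l₃ t) (r₃ t)) := by
  have S : ∀ T ∈ Ico t₁ t₂, Sys m (fun x a => f x a * (κ x - a))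
      (clampT t₁ T (PressureDensity m v₁)) (clampT t₁ T (PressureDensity m v₃)) r₁ l₃ r₃ t₁ T :=
    fun T hT => sys_of_pressureSol hm hF1 hT.1 hT.2 h₁ h₃
  have hv₁ : ∀ t ∈ Ico t₁ t₂, ∀ x, 0 ≤ v₁ x t := fun t h x =>
    (lt_or_ge x (r₁ t)).elim (fun hx => ((h₁.2.2.2.1 t h x).1 hx).le)
      fun hx => ((h₁.2.2.2.1 t h x).2 hx).ge
  have lt₃ : ∀ t ∈ Ico t₁ t₂, l₃ t < r₃ t := h₃.2.2.2.2.1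
  have hv₃ : ∀ t ∈ Ico t₁ t₂, ∀ x, 0 ≤ v₃ x t := by
    intro t h x
    obtain ⟨e1, e2, e3⟩ := h₃.2.2.2.2.2.1 t h x
    rcases le_or_gt x (l₃ t) with hl | hl
    · exact (e2 hl).ge
    rcases le_or_gt (r₃ t) x with hr | hr
    · exact (e3 hr).ge
    · exact (e1 hl hr).le
  have iff₁ : ∀ T ∈ Ico t₁ t₂, ∀ t ∈ Icc t₁ T, ∀ x,
      clampT t₁ T (PressureDensity m v₃) x t < clampT t₁ T (PressureDensity m v₁) x t ↔
        v₃ x t < v₁ x t := by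
    intro T hT t h x
    have htI : t ∈ Ico t₁ t₂ := ⟨h.1, h.2.trans_lt hT.2⟩
    rw [clampT_of_mem h, clampT_of_mem h, pressureDensity_lt_iff hm (hv₃ t htI x) (hv₁ t htI x)]
  have iff₃ : ∀ T ∈ Ico t₁ t₂, ∀ t ∈ Icc t₁ T, ∀ x,
      clampT t₁ T (PressureDensity m v₁) x t < clampT t₁ T (PressureDensity m v₃) x t ↔
        v₁ x t < v₃ x t := by
    intro T hT t h x
    have htI : t ∈ Ico t₁ t₂ := ⟨h.1, h.2.trans_lt hT.2⟩
    rw [clampT_of_mem h, clampT_of_mem h, pressureDensity_lt_iff hm (hv₁ t htI x) (hv₃ t htI x)]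
  have mono₁ : MonotoneOn r₁ (Ico t₁ t₂) := fun a ha b hb hab =>
    (S b hb).mono₁ ⟨ha.1, hab⟩ ⟨hb.1, le_rfl⟩ hab
  have anti : AntitoneOn l₃ (Ico t₁ t₂) := fun a ha b hb hab =>
    (S b hb).antil₃ ⟨ha.1, hab⟩ ⟨hb.1, le_rfl⟩ hab
  have key := exists_stages ht h₁.2.1 h₃.2.1 h₃.2.2.1 mono₁ anti lt₃ hini
    (Tri := fun t => TriRelMix (fun x => v₁ x t) (fun x => v₃ x t) (r₁ t) (l₃ t) (r₃ t))
    (G := fun t => ∀ x, l₃ t < x → x < r₃ t → v₃ x t < v₁ x t) ?_ ?_ ?_ ?_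
  · rcases key with h | ⟨s₃, s₄, s₅, e1, e2, e3, e4, e5, e6, e7, e8⟩
    · exact Or.inl h
    refine Or.inr ⟨s₃, s₄, s₅, e1, e2, e3, e4, e5, e6, fun t h => ⟨lt₃ t h.2, e7 t h⟩,
      fun t h => ⟨lt₃ t ⟨?_, h.2⟩, e8 t h⟩⟩
    linarith [h.1]
  · intro t h hr hl hlt
    have htI : t ∈ Ico t₁ t₂ := ⟨h.1.le, h.2⟩
    have htt : t ∈ Icc t₁ t := ⟨h.1.le, le_rfl⟩
    obtain ⟨X, hX1, hX2, hX3, hX4⟩ := (S t htI).exists_crossing hini h.1 le_rfl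
      (fun τ hτ => (hr τ hτ).le) hl hlt
    refine ⟨X, hX1, ?_, fun x hx hxX => (iff₁ t htI t htt x).1 (hX3 x hx hxX), fun x hx hxX => ?_⟩
    · rwa [min_eq_left hlt.le]
    · rw [min_eq_left hlt.le] at hxX
      exact (iff₃ t htI t htt x).1 (hX4 x hx hxX)
  · intro t h hr heq x hl hx
    have htI : t ∈ Ico t₁ t₂ := ⟨h.1.le, h.2⟩
    exact (iff₁ t htI t ⟨h.1.le, le_rfl⟩ x).1
      ((S t htI).lt_of_meet hini h.1 le_rfl hr heq ⟨hl, hx⟩)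
  · intro s hs hr hG t h
    have htI : t ∈ Ico t₁ t₂ := ⟨hs.1.trans h.1, h.2⟩
    have hsT : s ∈ Icc t₁ t := ⟨hs.1, h.1⟩
    have htT : t ∈ Icc t₁ t := ⟨htI.1, le_rfl⟩
    have hord := (S t htI).ordered_of_lt hsT fun x hx => (iff₁ t htI s hsT x).2 (hG x hx.1 hx.2)
    refine ⟨(S t htI).right_le_of_ordered htT ((S t htI).ordered hs.1 hord ⟨h.1, le_rfl⟩), ?_⟩
    rcases h.1.eq_or_lt with rfl | hst
    · exact hG
    · exact fun x hl hx => (iff₁ t htI t htT x).1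
        ((S t htI).lt_of_ordered hs.1 hord hst le_rfl ⟨hl, hx⟩)
  · intro s hs hr hG t h
    have htI : t ∈ Ico t₁ t₂ := ⟨hs.1.trans h.1, h.2⟩
    have hsT : s ∈ Icc t₁ t := ⟨hs.1, h.1⟩
    exact (S t htI).right_lt hs.1 (fun x hx => (iff₁ t htI s hsT x).2 (hG x hx.1 hx.2)) hr
      ⟨h.1, le_rfl⟩
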